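/- arXiv:math/0407292 — 4 statements merged into one kernel-verified Lean document; each statement's English description precedes it below -/
import Mathlib

section
/- Let G be a connected maximal nontraceable graph with two distinct nonadjacent vertices v₁ and v₂, both of degree 2, such that v₁ and v₂ have the same two neighbours x₁ and x₂. Then N(x₁) \ {x₂} = N(x₂) \ {x₁}, and consequently x₁ and x₂ have the same degree, which is at least 5. -/
open SimpleGraph

/-- A graph is traceable if it has a Hamiltonian path, i.e. a path containing
all the vertices of the graph. -/
def Traceable {V : Type*} (G : SimpleGraph V) : Prop :=
  ∃ (u v : V) (p : G.Walk u v), p.IsPath ∧ ∀ w, w ∈ p.support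

/-- A graph is maximal nontraceable if it is not traceable, but adding any edge
of the complement produces a traceable graph. -/
def MaxNontraceable {V : Type*} (G : SimpleGraph V) : Prop :=
  ¬ Traceable G ∧ ∀ u v : V, u ≠ v → ¬ G.Adj u v → Traceable (G ⊔ SimpleGraph.edge u v)
/-- A list that visits every vertex exactly once along edges of `G`. -/
def IsHamList {V : Type*} (G : SimpleGraph V) (l : List V) : Prop :=
  l.IsChain G.Adj ∧ l.Nodup ∧ ∀ w, w ∈ l

theorem Traceable.exists_isHamList {V : Type*} {G : SimpleGraph V} (h : Traceable G) :
    ∃ l, IsHamList G l := by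
  obtain ⟨u, v, p, hp, hw⟩ := h
  exact ⟨p.support, p.isChain_adj_support, hp.support_nodup, hw⟩

theorem IsHamList.traceable {V : Type*} [Nonempty V] {G : SimpleGraph V} {l : List V}
    (h : IsHamList G l) : Traceable G := by
  obtain ⟨hc, hn, hw⟩ := h
  have hne : l ≠ [] := List.ne_nil_of_mem (hw (Classical.arbitrary V))
  refine ⟨_, _, Walk.ofSupport l hne hc, ?_, ?_⟩
  · rw [Walk.isPath_def, Walk.support_ofSupport]
    exact hn
  · rw [Walk.support_ofSupport]
    exact hw

theorem IsHamList.reverse {V : Type*} {G : SimpleGraph V} {l : List V}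
    (h : IsHamList G l) : IsHamList G l.reverse := by
  refine ⟨?_, List.nodup_reverse.2 h.2.1, fun w => List.mem_reverse.2 (h.2.2 w)⟩
  rw [List.isChain_reverse]
  exact h.1.imp fun _ _ h => h.symm

/-- Chains avoiding an endpoint of an added edge are chains of the original graph. -/
theorem List.IsChain.of_sup_edge {V : Type*} {G : SimpleGraph V} {u v : V} {l : List V}
    (h : l.IsChain (G ⊔ SimpleGraph.edge u v).Adj) (hl : u ∉ l ∨ v ∉ l) : l.IsChain G.Adj := by
  refine h.imp_of_mem_imp fun a b ha hb hab => ?_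
  rw [sup_adj, edge_adj] at hab
  grind

/-- Adding a missing edge to a maximal nontraceable graph produces a Hamiltonian list in which
the two endpoints of the new edge are consecutive. -/
theorem MaxNontraceable.exists_split {V : Type*} {G : SimpleGraph V} (hG : MaxNontraceable G)
    {u v : V} (huv : u ≠ v) (hadj : ¬ G.Adj u v) :
    ∃ a b : List V, (a ++ [u]).IsChain G.Adj ∧ (v :: b).IsChain G.Adj ∧
      (a ++ u :: v :: b).Nodup ∧ ∀ w, w ∈ a ++ u :: v :: b := by
  have : Nonempty V := ⟨u⟩
  suffices H : ∃ a b, IsHamList (G ⊔ SimpleGraph.edge u v) (a ++ u :: v :: b) by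
    obtain ⟨a, b, hc, hn, hw⟩ := H
    rw [List.isChain_append_cons_cons] at hc
    refine ⟨a, b, hc.1.of_sup_edge (Or.inr ?_), hc.2.2.of_sup_edge (Or.inl ?_), hn, hw⟩ <;>
      grind
  obtain ⟨l, hl⟩ := (hG.2 u v huv hadj).exists_isHamList
  have hnc : ¬ l.IsChain G.Adj := fun h => hG.1 (IsHamList.traceable ⟨h, hl.2⟩)
  rw [List.isChain_iff_forall_rel_of_append_cons_cons] at hnc
  push Not at hnc
  obtain ⟨s, t, a, b, rfl, hst⟩ := hnc
  have hst' := (List.isChain_append_cons_cons.1 hl.1).2.1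
  rw [sup_adj, edge_adj] at hst'
  rcases hst' with h | ⟨⟨rfl, rfl⟩ | ⟨rfl, rfl⟩, -⟩
  · exact absurd h hst
  · exact ⟨a, b, hl⟩
  · exact ⟨b.reverse, a.reverse, by simpa using hl.reverse⟩

/-- A vertex with at most one neighbour on a chain is at one of its ends. -/
theorem List.IsChain.eq_of_unique_neighbor {V : Type*} {G : SimpleGraph V} {l : List V} {v x : V}
    (h : l.IsChain G.Adj) (hn : l.Nodup) (hv : v ∈ l) (hx : ∀ y ∈ l, G.Adj v y → y = x) :
    l = [v] ∨ (∃ t, l = v :: x :: t) ∨ ∃ t, l = t ++ [x, v] := by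
  obtain ⟨c, d, rfl⟩ := List.append_of_mem hv
  have hpre : c = [] ∨ ∃ c', c = c' ++ [x] := by
    rcases List.eq_nil_or_concat c with rfl | ⟨c', y, rfl⟩
    · exact Or.inl rfl
    · have h' := h
      rw [List.concat_eq_append, List.append_assoc, List.singleton_append,
        List.isChain_append_cons_cons] at h'
      have := hx y (by simp) h'.2.1.symm
      subst this
      exact Or.inr ⟨c', by simp⟩
  have hsuf : d = [] ∨ ∃ d', d = x :: d' := by
    rcases d with - | ⟨y, d'⟩
    · exact Or.inl rfl
    · rw [List.isChain_append_cons_cons] at h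
      have := hx y (by simp) h.2.1
      subst this
      exact Or.inr ⟨d', rfl⟩
  rcases hpre with rfl | ⟨c', rfl⟩ <;> rcases hsuf with rfl | ⟨d', rfl⟩
  · simp
  · simp
  · simp
  · exfalso
    grind

/-- A vertex in the tail of a chain whose only neighbour on the chain is the head is the whole
tail. -/
theorem List.IsChain.tail_eq_of_unique_neighbor {V : Type*} {G : SimpleGraph V} {b : List V}
    {v x : V} (h : (x :: b).IsChain G.Adj) (hn : (x :: b).Nodup) (hv : v ∈ b)
    (hx : ∀ y ∈ x :: b, G.Adj v y → y = x) : b = [v] := by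
  rcases h.eq_of_unique_neighbor hn (List.mem_cons_of_mem _ hv) hx with h | ⟨t, h⟩ | ⟨t, h⟩
  · grind
  · grind
  · rcases t with - | ⟨y, t⟩ <;> grind

/-- The two neighbours of a degree-2 vertex of a maximal nontraceable graph are adjacent. -/
theorem MaxNontraceable.adj_of_common_neighbor {V : Type*} {G : SimpleGraph V}
    (hG : MaxNontraceable G) {v x₁ x₂ : V} (hx : x₁ ≠ x₂)
    (hv : ∀ y, G.Adj v y ↔ y = x₁ ∨ y = x₂) : G.Adj x₁ x₂ := by
  have : Nonempty V := ⟨v⟩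
  by_contra hadj
  obtain ⟨a, b, ha, hb, hn, hw⟩ := hG.exists_split hx hadj
  have h1 := (hv x₁).2 (Or.inl rfl)
  have h2 := (hv x₂).2 (Or.inr rfl)
  rcases List.mem_append.1 (hw v) with hva | hvb
  · have ha' : (x₁ :: a.reverse).IsChain G.Adj := by
      have := List.isChain_reverse.2 (ha.imp fun _ _ h => h.symm)
      simpa using this
    have := ha'.tail_eq_of_unique_neighbor (v := v) (by grind) (by simpa using hva) (by grind)
    obtain rfl : a = [v] := by simpa using this
    refine hG.1 (IsHamList.traceable (l := x₁ :: v :: x₂ :: b) ⟨?_, by grind, fun w => by have := hw w; grind⟩)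
    simp [h1.symm, h2, hb]
  · have hvb' : v ∈ b := by
      have := h1.ne
      have := h2.ne
      grind
    obtain rfl := hb.tail_eq_of_unique_neighbor (v := v) (by grind) hvb' (by grind)
    refine hG.1 (IsHamList.traceable (l := a ++ x₁ :: v :: [x₂]) ⟨?_, by grind, fun w => by have := hw w; grind⟩)
    rw [List.isChain_append_cons_cons]
    simp [ha, h1.symm, h2]

/-- If two vertices have the same two neighbours `x₁` and `x₂`, then every further neighbour of
`x₁` is a neighbour of `x₂`. -/
theorem MaxNontraceable.adj_of_twins {V : Type*} {G : SimpleGraph V}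
    (hG : MaxNontraceable G) {v₁ v₂ x₁ x₂ p : V} (hne : v₁ ≠ v₂)
    (hv₁ : ∀ y, G.Adj v₁ y ↔ y = x₁ ∨ y = x₂) (hv₂ : ∀ y, G.Adj v₂ y ↔ y = x₁ ∨ y = x₂)
    (hp : p ≠ x₂) (h : G.Adj x₁ p) : G.Adj x₂ p := by
  have : Nonempty V := ⟨p⟩
  by_contra hadj
  obtain ⟨a, b, ha, hb, hn, hw⟩ := hG.exists_split hp (fun h => hadj h.symm)
  have e11 := (hv₁ x₁).2 (Or.inl rfl)
  have e12 := (hv₁ x₂).2 (Or.inr rfl)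
  have e21 := (hv₂ x₁).2 (Or.inl rfl)
  have e22 := (hv₂ x₂).2 (Or.inr rfl)
  have n11 := e11.ne
  have n12 := e12.ne
  have n21 := e21.ne
  have n22 := e22.ne
  have np := h.ne
  have np1 : p ≠ v₁ := fun hh => hadj (hh ▸ e12.symm)
  have np2 : p ≠ v₂ := fun hh => hadj (hh ▸ e22.symm)
  have hx : x₁ ≠ x₂ := fun hh => hadj (hh ▸ h)
  have hb' : b.IsChain G.Adj := hb.of_cons
  have hx₁ : x₁ ∈ a ∨ x₁ ∈ b := by
    have := hw x₁
    grind
  have hna : (a ++ [p]).Nodup := by grind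
  have hnb : (x₂ :: b).Nodup := by grind
  rcases hx₁ with hxa | hxb
  · have hB : ∀ v, (∀ y, G.Adj v y ↔ y = x₁ ∨ y = x₂) → v ∈ b → b = [v] := fun v hv hvb =>
      hb.tail_eq_of_unique_neighbor hnb hvb (by grind)
    have hA : ∀ v, (∀ y, G.Adj v y ↔ y = x₁ ∨ y = x₂) → p ≠ v → v ∈ a →
        ∃ t, a ++ [p] = v :: x₁ :: t := by
      intro v hv hpv hva
      rcases ha.eq_of_unique_neighbor (v := v) (x := x₁) hna (by simp [hva]) (by grind) with
        h | h | ⟨t, h⟩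
      · grind
      · exact h
      · have := congrArg List.getLast? h
        grind
    have key : ∀ v w, G.Adj v x₂ → G.Adj w x₁ → G.Adj w x₂ → b = [w] →
        (∃ t, a ++ [p] = v :: x₁ :: t) → False := by
      rintro v w e1 e2 e3 rfl ⟨t, ht⟩
      have hs : a ++ p :: x₂ :: [w] = v :: x₁ :: t ++ [x₂, w] := by
        rw [← ht]
        simp
      rw [hs] at hn hw
      rw [ht] at ha
      refine hG.1 (IsHamList.traceable (l := v :: x₂ :: w :: x₁ :: t) ⟨?_, by grind, fun w => by have := hw w; grind⟩)
      simp only [List.isChain_cons_cons] at ha ⊢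
      exact ⟨e1, e3.symm, e2, ha.2⟩
    have m1 : v₁ ∈ a ∨ v₁ ∈ b := by
      have := hw v₁
      grind
    have m2 : v₂ ∈ a ∨ v₂ ∈ b := by
      have := hw v₂
      grind
    rcases m1 with m1 | m1 <;> rcases m2 with m2 | m2
    · obtain ⟨t, ht⟩ := hA v₁ hv₁ np1 m1
      obtain ⟨t', ht'⟩ := hA v₂ hv₂ np2 m2
      grind
    · exact key v₁ v₂ e12 e21 e22 (hB v₂ hv₂ m2) (hA v₁ hv₁ np1 m1)
    · exact key v₂ v₁ e22 e11 e12 (hB v₁ hv₁ m1) (hA v₂ hv₂ np2 m2)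
    · have := hB v₁ hv₁ m1
      grind
  · have hxn : x₁ ∉ a ++ [p] := by grind
    have hA : ∀ v, (∀ y, G.Adj v y ↔ y = x₁ ∨ y = x₂) → v ≠ x₁ → v ≠ x₂ → p ≠ v → v ∈ b := by
      intro v hv hv1 hv2 hpv
      by_contra hvb
      have hva : v ∈ a ++ [p] := by
        have := hw v
        grind
      rcases ha.eq_of_unique_neighbor (v := v) (x := x₁) hna hva (by grind) with
        h | ⟨t, h⟩ | ⟨t, h⟩
      · have := congrArg List.getLast? h
        grind
      · rw [h] at hxn
        simp at hxn
      · rw [h] at hxn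
        simp at hxn
    have m1 := hA v₁ hv₁ n11 n12 np1
    have m2 := hA v₂ hv₂ n21 n22 np2
    have hnb' : b.Nodup := by grind
    have key : ∀ v w, G.Adj v x₁ → G.Adj v x₂ → G.Adj w x₂ → (∃ t, b = v :: x₁ :: t) →
        (∃ t, b = t ++ [x₁, w]) → False := by
      rintro v w e1 e2 e3 ⟨t, rfl⟩ ⟨t', ht'⟩
      obtain rfl : t = [w] := by
        rcases t' with - | ⟨_, - | ⟨_, t'⟩⟩ <;> grind
      refine hG.1 (IsHamList.traceable (l := a ++ p :: x₁ :: v :: x₂ :: [w])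
        ⟨?_, by simp [List.nodup_append] at hn ⊢; grind, fun w => by have := hw w; grind⟩)
      rw [List.isChain_append_cons_cons]
      simp [ha, h.symm, e1.symm, e2, e3.symm]
    rcases hb'.eq_of_unique_neighbor (x := x₁) hnb' m1 (by grind) with h1 | h1 | h1 <;>
      rcases hb'.eq_of_unique_neighbor (x := x₁) hnb' m2 (by grind) with h2 | h2 | h2
    · grind
    · grind
    · grind
    · grind
    · grind
    · exact key v₁ v₂ e11 e12 e22 h1 h2
    · grind
    · exact key v₂ v₁ e21 e22 e12 h2 h1
    · obtain ⟨t, h1⟩ := h1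
      obtain ⟨t', h2⟩ := h2
      have := congrArg List.getLast? (h1.symm.trans h2)
      simp [hne] at this

/-- A property that is preserved along the edges of a chain holds everywhere or nowhere on it. -/
theorem List.IsChain.forall_or_forall_not {α : Type*} {R : α → α → Prop} {P : α → Prop}
    {l : List α} (h : l.IsChain R) (hP : ∀ x ∈ l, ∀ y ∈ l, R x y → (P x ↔ P y)) :
    (∀ x ∈ l, P x) ∨ ∀ x ∈ l, ¬ P x := by
  induction l with
  | nil => simp
  | cons x l ih =>
    have := ih h.of_cons (fun y hy z hz => hP y (by simp [hy]) z (by simp [hz]))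
    rcases l with - | ⟨y, l⟩
    · grind
    · have := hP x (by simp) y (by simp) (List.isChain_cons_cons.1 h).1
      grind

theorem SimpleGraph.Connected.forall_of_adj_closed {V : Type*} {G : SimpleGraph V}
    (hc : G.Connected) {P : V → Prop} {u : V} (hu : P u) (hP : ∀ x y, G.Adj x y → P x → P y)
    (w : V) : P w := by
  obtain ⟨p⟩ := hc.preconnected u w
  induction p with
  | nil => exact hu
  | cons h _ ih => exact ih (hP _ _ h hu)

/-- If two vertices have the same two neighbours `x₁` and `x₂`, then `x₁` has two further
neighbours other than `x₂`. -/
theorem MaxNontraceable.exists_two_neighbors_of_twins {V : Type*} {G : SimpleGraph V}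
    (hc : G.Connected) (hG : MaxNontraceable G) {v₁ v₂ x₁ x₂ : V} (hne : v₁ ≠ v₂) (hx : x₁ ≠ x₂)
    (hv₁ : ∀ y, G.Adj v₁ y ↔ y = x₁ ∨ y = x₂) (hv₂ : ∀ y, G.Adj v₂ y ↔ y = x₁ ∨ y = x₂) :
    ∃ w w', w ≠ w' ∧ (G.Adj x₁ w ∧ w ≠ v₁ ∧ w ≠ v₂ ∧ w ≠ x₂) ∧
      (G.Adj x₁ w' ∧ w' ≠ v₁ ∧ w' ≠ v₂ ∧ w' ≠ x₂) := by
  have : Nonempty V := ⟨v₁⟩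
  have e11 := (hv₁ x₁).2 (Or.inl rfl)
  have e12 := (hv₁ x₂).2 (Or.inr rfl)
  have e21 := (hv₂ x₁).2 (Or.inl rfl)
  have e22 := (hv₂ x₂).2 (Or.inr rfl)
  have n11 := e11.ne
  have n12 := e12.ne
  have n21 := e21.ne
  have n22 := e22.ne
  have hadj : ¬ G.Adj v₁ v₂ := by grind
  have hN : ∀ p, p ≠ x₁ → p ≠ x₂ → (G.Adj x₁ p ↔ G.Adj x₂ p) := fun p hp1 hp2 =>
    ⟨hG.adj_of_twins hne hv₁ hv₂ hp2,
      hG.adj_of_twins hne (fun y => (hv₁ y).trans or_comm) (fun y => (hv₂ y).trans or_comm) hp1⟩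
  have irr₁ : ¬ G.Adj x₁ x₁ := G.irrefl
  have irr₂ : ¬ G.Adj x₂ x₂ := G.irrefl
  by_contra! hcon
  by_cases hw : ∃ w, G.Adj x₁ w ∧ w ≠ v₁ ∧ w ≠ v₂ ∧ w ≠ x₂
  · obtain ⟨w, hw1, hw2, hw3, hw4⟩ := hw
    have hwx : w ≠ x₁ := hw1.ne'
    have hwx₂ : G.Adj x₂ w := (hN w hwx hw4).1 hw1
    have huniq : ∀ y, G.Adj x₁ y → y = v₁ ∨ y = v₂ ∨ y = x₂ ∨ y = w := by grind
    let P : V → Prop := fun y => y = v₁ ∨ y = v₂ ∨ y = x₁ ∨ y = x₂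
    have hPG : ∀ x y, x ≠ w → y ≠ w → G.Adj x y → P x → P y := by
      intro x y hxw hyw hxy hPx
      by_cases hy : y = x₁ ∨ y = x₂
      · grind
      rcases hPx with rfl | rfl | rfl | rfl <;> grind
    have hPE : ∀ x y, x ≠ w → y ≠ w → (G ⊔ SimpleGraph.edge v₁ v₂).Adj x y → (P x ↔ P y) := by
      intro x y hxw hyw hxy
      rw [sup_adj, edge_adj] at hxy
      rcases hxy with h | h
      · exact ⟨hPG x y hxw hyw h, hPG y x hyw hxw h.symm⟩
      · grind
    have key : ∀ a b : List V, IsHamList (G ⊔ SimpleGraph.edge v₁ v₂) (a ++ w :: b) →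
        (∀ y ∈ a, P y) → (∀ y ∈ b, ¬ P y) → False := by
      rintro a b ⟨h1, h2, h3⟩ ha hb
      refine hG.1 (IsHamList.traceable (l := v₁ :: x₁ :: v₂ :: x₂ :: w :: b)
        ⟨?_, by grind, fun z => by have := h3 z; grind⟩)
      have hwb : (w :: b).IsChain G.Adj :=
        (List.isChain_split.1 h1).2.of_sup_edge (Or.inl (by grind))
      simp [e11, e21.symm, e22, hwx₂, hwb]
    obtain ⟨l, hl⟩ := (hG.2 v₁ v₂ hne hadj).exists_isHamList
    obtain ⟨a, b, rfl⟩ := List.append_of_mem (hl.2.2 w)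
    obtain ⟨h1, h2, h3⟩ := id hl
    have hca := (List.isChain_append.1 h1).1
    have hcb := (List.isChain_split.1 h1).2.of_cons
    have hPa := hca.forall_or_forall_not (P := P) fun x hx y hy => hPE x y (by grind) (by grind)
    have hPb := hcb.forall_or_forall_not (P := P) fun x hx y hy => hPE x y (by grind) (by grind)
    rcases hPa with hPa | hPa <;> rcases hPb with hPb | hPb
    · refine hG.1 (IsHamList.traceable (l := [v₁, x₁, v₂, x₂, w]) ⟨?_, by grind, fun z => by have := h3 z; grind⟩)
      simp [e11, e21.symm, e22, hwx₂]
    · exact key a b hl hPa hPb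
    · exact key b.reverse a.reverse (by simpa using hl.reverse) (by simpa using hPb)
        (by simpa using hPa)
    · have := h3 v₁
      grind
  · push Not at hw
    have hall := hc.forall_of_adj_closed (P := fun y => y = v₁ ∨ y = v₂ ∨ y = x₁ ∨ y = x₂)
      (u := v₁) (Or.inl rfl) (by
        intro x y hxy hPx
        by_cases hy : y = x₁ ∨ y = x₂
        · grind
        rcases hPx with rfl | rfl | rfl | rfl <;> grind)
    refine hG.1 (IsHamList.traceable (l := [v₁, x₁, v₂, x₂]) ⟨?_, by grind, fun z => by have := hall z; grind⟩)
    simp [e11, e21.symm, e22]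

/-- If two distinct nonadjacent degree-2 vertices of a connected MNT graph have the
same two neighbours x₁ and x₂, then N(x₁) \ {x₂} = N(x₂) \ {x₁} and
d(x₁) = d(x₂) ≥ 5. -/
theorem stmt_6 {V : Type*} [Fintype V] (G : SimpleGraph V)
    (hc : G.Connected) (hG : MaxNontraceable G) (v₁ v₂ x₁ x₂ : V)
    (hne : v₁ ≠ v₂) (hnadj : ¬ G.Adj v₁ v₂) (hx : x₁ ≠ x₂)
    (h1 : Nat.card (G.neighborSet v₁) = 2) (h2 : Nat.card (G.neighborSet v₂) = 2)
    (hN1 : G.neighborSet v₁ = {x₁, x₂}) (hN2 : G.neighborSet v₂ = {x₁, x₂}) :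
    G.neighborSet x₁ \ {x₂} = G.neighborSet x₂ \ {x₁} ∧
    Nat.card (G.neighborSet x₁) = Nat.card (G.neighborSet x₂) ∧
    5 ≤ Nat.card (G.neighborSet x₁) := by
  have hv₁ : ∀ y, G.Adj v₁ y ↔ y = x₁ ∨ y = x₂ := fun y => by
    rw [← mem_neighborSet, hN1]
    simp
  have hv₂ : ∀ y, G.Adj v₂ y ↔ y = x₁ ∨ y = x₂ := fun y => by
    rw [← mem_neighborSet, hN2]
    simp
  have hadj : G.Adj x₁ x₂ := hG.adj_of_common_neighbor hx hv₁
  have hN : G.neighborSet x₁ \ {x₂} = G.neighborSet x₂ \ {x₁} := by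
    ext p
    simp only [Set.mem_sdiff, mem_neighborSet, Set.mem_singleton_iff]
    exact ⟨fun h => ⟨hG.adj_of_twins hne hv₁ hv₂ h.2 h.1, h.1.ne'⟩,
      fun h => ⟨hG.adj_of_twins hne (fun y => (hv₁ y).trans or_comm)
        (fun y => (hv₂ y).trans or_comm) h.2 h.1, h.1.ne'⟩⟩
  refine ⟨hN, ?_, ?_⟩
  · simp only [Nat.card_coe_set_eq]
    rw [← Set.ncard_sdiff_singleton_add_one (s := G.neighborSet x₁) (a := x₂) hadj, hN,
      Set.ncard_sdiff_singleton_add_one (s := G.neighborSet x₂) (a := x₁) hadj.symm]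
  · obtain ⟨w, w', hww, ⟨hw, hw1, hw2, hw3⟩, hw', hw'1, hw'2, hw'3⟩ :=
      hG.exists_two_neighbors_of_twins hc hne hx hv₁ hv₂
    have e1 := (hv₁ x₁).2 (Or.inl rfl)
    have e2 := (hv₂ x₁).2 (Or.inl rfl)
    have n1 := ((hv₁ x₂).2 (Or.inr rfl)).ne
    have n2 := ((hv₂ x₂).2 (Or.inr rfl)).ne
    classical
    have hsub : (({v₁, v₂, x₂, w, w'} : Finset V) : Set V) ⊆ G.neighborSet x₁ := by
      intro y hy
      simp only [Finset.coe_insert, Finset.coe_singleton, Set.mem_insert_iff,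
        Set.mem_singleton_iff] at hy
      rw [mem_neighborSet]
      rcases hy with rfl | rfl | rfl | rfl | rfl
      exacts [e1.symm, e2.symm, hadj, hw, hw']
    have hcard : ({v₁, v₂, x₂, w, w'} : Finset V).card = 5 := by
      repeat rw [Finset.card_insert_of_notMem (by grind)]
      simp
    rw [Nat.card_coe_set_eq, ← hcard, ← Set.ncard_coe_finset]
    exact Set.ncard_le_ncard hsub (Set.toFinite _)
end

section
/- Let G be a connected maximal nontraceable graph of order n ≥ 7 that has no vertex of degree 1 and no two adjacent vertices of degree 2, and suppose G has exactly m vertices of degree 2. Then the number of edges of G is at least (3n + m)/2, i.e. 2·e(G) ≥ 3n + m. -/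
open SimpleGraph

namespace SimpleGraph

variable {V : Type*}

/-- A list of vertices that traces a Hamiltonian path. -/
def IsHamList (G : SimpleGraph V) (l : List V) : Prop :=
  l.Nodup ∧ (∀ w, w ∈ l) ∧ l.IsChain G.Adj

theorem traceable_iff_exists_isHamList [Nonempty V] {G : SimpleGraph V} :
    Traceable G ↔ ∃ l, G.IsHamList l := by
  constructor
  · rintro ⟨u, v, p, hp, hw⟩
    exact ⟨p.support, hp.support_nodup, hw, p.isChain_adj_support⟩
  · rintro ⟨l, hn, hm, hl⟩
    have hne : l ≠ [] := List.ne_nil_of_mem (hm (Classical.arbitrary V))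
    refine ⟨_, _, Walk.ofSupport l hne hl, ?_, ?_⟩
    · rw [Walk.isPath_def, Walk.support_ofSupport]
      exact hn
    · rw [Walk.support_ofSupport]
      exact hm

theorem isChain_adj_reverse {G : SimpleGraph V} {l : List V} :
    l.reverse.IsChain G.Adj ↔ l.IsChain G.Adj := by
  simp [List.isChain_reverse, G.adj_comm]

/-- Deleting from a path a set of vertices whose outer neighbours lie in `{s, t}` leaves a
sequence whose consecutive terms are adjacent or are `s` and `t`. -/
theorem isChain_filter_of_attachments [DecidableEq V] {G G' : SimpleGraph V} {F : List V} {s t : V}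
    (hR : ∀ x y, x ∉ F → y ∉ F → G'.Adj x y → G.Adj x y ∨ s(x, y) = s(s, t))
    (hF : ∀ f x, f ∈ F → x ∉ F → G'.Adj f x → x = s ∨ x = t) (l : List V) (hn : l.Nodup)
    (hl : l.IsChain G'.Adj) :
    (l.filter (· ∉ F)).IsChain (fun x y => G.Adj x y ∨ s(x, y) = s(s, t)) ∧
      ∀ f ∈ l.head?, f ∈ F → ∀ r ∈ (l.filter (· ∉ F)).head?, r = s ∨ r = t := by
  induction l with
  | nil => simp
  | cons x l ih =>
    rw [List.nodup_cons] at hn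
    rw [List.isChain_cons] at hl
    obtain ⟨ih1, ih2⟩ := ih hn.2 hl.2
    by_cases hx : x ∈ F
    · have e : (x :: l).filter (· ∉ F) = l.filter (· ∉ F) := by simp [hx]
      rw [e]
      refine ⟨ih1, ?_⟩
      intro f hf hfF r hr
      rcases l with _ | ⟨y, l⟩
      · simp at hr
      · by_cases hy : y ∈ F
        · exact ih2 y (by simp) hy r hr
        · simp only [hy, not_false_eq_true, decide_true, List.filter_cons_of_pos,
            List.head?_cons, Option.mem_def, Option.some.injEq] at hr
          subst hr
          exact hF x y hx hy (hl.1 y (by simp))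
    · have e : (x :: l).filter (· ∉ F) = x :: l.filter (· ∉ F) := by simp [hx]
      rw [e]
      refine ⟨?_, ?_⟩
      · rw [List.isChain_cons]
        refine ⟨fun r hr => ?_, ih1⟩
        rcases l with _ | ⟨y, l⟩
        · simp at hr
        · by_cases hy : y ∈ F
          · have h1 := ih2 y (by simp) hy r hr
            have h2 := hF y x hy hx (hl.1 y (by simp)).symm
            have h3 : r ∈ y :: l := (List.mem_filter.1 (List.mem_of_mem_head? hr)).1
            have h4 : x ≠ r := fun h => hn.1 (h ▸ h3)
            right
            rw [Sym2.eq_iff]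
            grind
          · simp only [hy, not_false_eq_true, decide_true, List.filter_cons_of_pos,
              List.head?_cons, Option.mem_def, Option.some.injEq] at hr
            subst hr
            exact hR x y hx hy (hl.1 y (by simp))
      · intro f hf hfF
        simp only [List.head?_cons, Option.mem_def, Option.some.injEq] at hf
        exact absurd (hf ▸ hfF) hx

theorem exists_first_mem_append {F l : List V} (h : ∃ f ∈ l, f ∈ F) :
    ∃ A f B, l = A ++ f :: B ∧ f ∈ F ∧ ∀ a ∈ A, a ∉ F := by
  induction l with
  | nil => simp at h
  | cons x l ih =>
    by_cases hx : x ∈ F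
    · exact ⟨[], x, l, rfl, hx, by simp⟩
    · obtain ⟨A, f, B, rfl, hf, hA⟩ := ih (by
        obtain ⟨f, hf, hfF⟩ := h
        rcases List.mem_cons.1 hf with rfl | hf
        · exact absurd hfF hx
        · exact ⟨f, hf, hfF⟩)
      exact ⟨x :: A, f, B, rfl, hf, by
        intro a ha
        rcases List.mem_cons.1 ha with rfl | ha
        · exact hx
        · exact hA a ha⟩

theorem exists_append_of_not_isChain {R : V → V → Prop} {l : List V} (h : ¬ l.IsChain R) :
    ∃ A x y B, l = A ++ x :: y :: B ∧ ¬ R x y := by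
  induction l with
  | nil => simp at h
  | cons x l ih =>
    rcases l with _ | ⟨y, l⟩
    · simp at h
    · by_cases hxy : R x y
      · obtain ⟨A, a, b, B, e, hab⟩ := ih (fun h' => h (by simp [hxy, h']))
        exact ⟨x :: A, a, b, B, by simp [e], hab⟩
      · exact ⟨[], x, y, l, rfl, hxy⟩

/-- Glueing a path on `F` to the end of a path on the complement of `F`. -/
theorem exists_isHamList_of_head {G : SimpleGraph V} {F l : List V} {s t a b : V}
    (hFn : F.Nodup) (hFc : F.IsChain G.Adj) (ha : F.head? = some a) (hb : F.getLast? = some b)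
    (hsa : G.Adj s a) (htb : s ≠ t → G.Adj t b) (hn : l.Nodup) (hm : ∀ x, x ∈ l ↔ x ∉ F)
    (hl : l.IsChain G.Adj) (hh : ∀ r ∈ l.head?, r = s ∨ r = t) : ∃ l, G.IsHamList l := by
  by_cases hs : ∀ r ∈ l.head?, r = s
  · refine ⟨F.reverse ++ l, ?_, ?_, ?_⟩
    · rw [List.nodup_append]
      refine ⟨List.nodup_reverse.2 hFn, hn, ?_⟩
      rintro x hx y hy rfl
      exact (hm x).1 hy (List.mem_reverse.1 hx)
    · intro w
      by_cases hw : w ∈ F <;> simp [hw, hm]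
    · rw [List.isChain_append]
      refine ⟨isChain_adj_reverse.2 hFc, hl, ?_⟩
      intro x hx y hy
      rw [List.getLast?_reverse, ha] at hx
      cases hx
      rw [hs y hy]
      exact hsa.symm
  · have ht : ∀ r ∈ l.head?, r = t ∧ s ≠ t := by
      push Not at hs
      obtain ⟨r, hr, hrs⟩ := hs
      have := hh r hr
      intro r' hr'
      have e : r' = r := by
        simp only [Option.mem_def] at hr hr'
        rw [hr] at hr'
        exact (Option.some.inj hr').symm
      grind
    refine ⟨F ++ l, ?_, ?_, ?_⟩
    · rw [List.nodup_append]
      refine ⟨hFn, hn, ?_⟩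
      rintro x hx y hy rfl
      exact (hm x).1 hy hx
    · intro w
      by_cases hw : w ∈ F <;> simp [hw, hm]
    · rw [List.isChain_append]
      refine ⟨hFc, hl, ?_⟩
      intro x hx y hy
      rw [hb] at hx
      cases hx
      rw [(ht y hy).1]
      exact (htb (ht y hy).2).symm

/-- A path on `F` between neighbours of `s` and `t` can be inserted between `s` and `t`. -/
theorem exists_isHamList_of_insert {G : SimpleGraph V} {F A B : List V} {x y a b : V}
    (hFn : F.Nodup) (hFc : F.IsChain G.Adj) (ha : F.head? = some a) (hb : F.getLast? = some b)
    (hxa : G.Adj x a) (hyb : G.Adj y b) (hn : (A ++ x :: y :: B).Nodup)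
    (hm : ∀ w, w ∈ A ++ x :: y :: B ↔ w ∉ F)
    (hA : (A ++ [x]).IsChain G.Adj) (hB : (y :: B).IsChain G.Adj) : ∃ l, G.IsHamList l := by
  have hp : ((A ++ [x]) ++ (F ++ y :: B)).Perm (F ++ (A ++ x :: y :: B)) := by
    refine (List.perm_append_comm_assoc _ _ _).trans ?_
    simp
  refine ⟨(A ++ [x]) ++ (F ++ y :: B), ?_, ?_, ?_⟩
  · rw [hp.nodup_iff, List.nodup_append]
    refine ⟨hFn, hn, ?_⟩
    rintro z hz w hw rfl
    exact (hm z).1 hw hz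
  · intro w
    rw [hp.mem_iff, List.mem_append, hm]
    exact em _
  · have hne : F ≠ [] := by rintro rfl; simp at ha
    refine List.isChain_append.2 ⟨hA, List.isChain_append.2 ⟨hFc, hB, ?_⟩, ?_⟩
    · intro u hu v hv
      rw [hb] at hu
      cases hu
      simp only [List.head?_cons, Option.mem_def, Option.some.injEq] at hv
      exact hv ▸ hyb.symm
    · intro u hu v hv
      rw [List.head?_append_of_ne_nil _ hne, ha] at hv
      cases hv
      simp only [List.getLast?_append, List.getLast?_singleton, Option.some_or, Option.mem_def,
        Option.some.injEq] at hu
      exact hu ▸ hxa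

/-- Let `F` trace a path from a neighbour of `s` to a neighbour of `t`, where only `s` and `t` have
neighbours in `F`. Edges within `F ∪ {s, t}` do not affect traceability. -/
theorem exists_isHamList_of_attachments {G G' : SimpleGraph V} {F l : List V} {s t a b : V}
    (hFn : F.Nodup) (hFc : F.IsChain G.Adj) (ha : F.head? = some a) (hb : F.getLast? = some b)
    (hsa : G.Adj s a) (htb : s ≠ t → G.Adj t b)
    (hR : ∀ x y, x ∉ F → y ∉ F → G'.Adj x y → G.Adj x y ∨ s(x, y) = s(s, t))
    (hF : ∀ f x, f ∈ F → x ∉ F → G'.Adj f x → x = s ∨ x = t)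
    (hl : G'.IsHamList l) : ∃ l, G.IsHamList l := by
  classical
  obtain ⟨hn, hm, hc⟩ := hl
  have hm' : ∀ x, x ∈ l.filter (· ∉ F) ↔ x ∉ F := by simp [hm]
  have hn' : (l.filter (· ∉ F)).Nodup := hn.filter _
  have hc' := (isChain_filter_of_attachments hR hF l hn hc).1
  by_cases hG : (l.filter (· ∉ F)).IsChain G.Adj
  · have haF : a ∈ F := List.mem_of_mem_head? (by simp [ha])
    obtain ⟨A, f, B, rfl, hf, hA⟩ := exists_first_mem_append ⟨a, hm a, haF⟩
    have hB := List.isChain_append.1 hc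
    have hBn := List.nodup_append.1 hn
    have hh := (isChain_filter_of_attachments hR hF (f :: B) hBn.2.1 hB.2.1).2 f (by simp) hf
    have e : (A ++ f :: B).filter (· ∉ F) = A ++ (f :: B).filter (· ∉ F) := by
      rw [List.filter_append]
      congr 1
      rw [List.filter_eq_self]
      simpa using hA
    rw [e] at hm' hn' hc' hG
    rcases A.eq_nil_or_concat with rfl | ⟨A', x, rfl⟩
    · exact exists_isHamList_of_head hFn hFc ha hb hsa htb hn' hm' hG hh
    · have hx := hF f x hf (hA x (by simp)) (hB.2.2 x (by simp) f (by simp)).symm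
      rcases hD : (f :: B).filter (· ∉ F) with _ | ⟨y, D⟩
      · rw [hD] at hm' hn' hc' hG
        refine exists_isHamList_of_head (l := (A'.concat x ++ []).reverse) hFn hFc ha hb hsa htb
          (List.nodup_reverse.2 hn') (fun z => by rw [List.mem_reverse, hm'])
          (isChain_adj_reverse.2 hG) ?_
        intro r hr
        have : r = x := by simpa using hr.symm
        exact this ▸ hx
      · rw [hD] at hm' hn' hc' hG hh
        have hy := hh y (by simp)
        have hxy : x ≠ y := by
          rintro rfl
          simp [List.nodup_append] at hn'
        have e2 : A'.concat x ++ y :: D = A' ++ x :: y :: D := by simp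
        have e3 : A'.concat x ++ y :: D = (A' ++ [x]) ++ y :: D := by simp
        have hG' := List.isChain_append.1 (e3 ▸ hG)
        rw [e2] at hm' hn'
        rcases hx with rfl | rfl
        · have : y = t := by grind
          subst this
          exact exists_isHamList_of_insert hFn hFc ha hb hsa (htb hxy) hn' hm' hG'.1 hG'.2.1
        · have : y = s := by grind
          subst this
          exact exists_isHamList_of_insert (F := F.reverse) (List.nodup_reverse.2 hFn)
            (isChain_adj_reverse.2 hFc) (by simpa using hb) (by simpa using ha) (htb hxy.symm) hsa
            hn' (fun z => by rw [hm', List.mem_reverse]) hG'.1 hG'.2.1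
  · obtain ⟨A, x, y, B, e, hxy⟩ := exists_append_of_not_isChain hG
    rw [e] at hm' hn' hc'
    have e3 : A ++ x :: y :: B = (A ++ [x]) ++ y :: B := by simp
    have hQ := List.isChain_append.1 (e3 ▸ hc')
    have hst : s(x, y) = s(s, t) := (hQ.2.2 x (by simp) y (by simp)).resolve_left hxy
    rw [e3, List.nodup_append] at hn'
    rw [e3] at hm'
    have hne : x ≠ y := hn'.2.2 x (by simp) y (by simp)
    have hA : (A ++ [x]).IsChain G.Adj := by
      refine hQ.1.imp_of_mem_imp ?_
      intro u v hu hv huv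
      refine huv.resolve_right ?_
      intro h
      have := hn'.2.2 u hu y (by simp)
      have := hn'.2.2 v hv y (by simp)
      rw [← hst, Sym2.eq_iff] at h
      grind
    have hB : (y :: B).IsChain G.Adj := by
      refine hQ.2.1.imp_of_mem_imp ?_
      intro u v hu hv huv
      refine huv.resolve_right ?_
      intro h
      have := hn'.2.2 x (by simp) u hu
      have := hn'.2.2 x (by simp) v hv
      rw [← hst, Sym2.eq_iff] at h
      grind
    have hn'' : (A ++ x :: y :: B).Nodup := by rw [e3, List.nodup_append]; exact hn'
    rw [← e3] at hm'
    rcases Sym2.eq_iff.1 hst with ⟨rfl, rfl⟩ | ⟨rfl, rfl⟩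
    · exact exists_isHamList_of_insert hFn hFc ha hb hsa (htb hne) hn'' hm' hA hB
    · exact exists_isHamList_of_insert (F := F.reverse) (List.nodup_reverse.2 hFn)
            (isChain_adj_reverse.2 hFc) (by simpa using hb) (by simpa using ha) (htb hne.symm) hsa
            hn'' (fun z => by rw [hm', List.mem_reverse]) hA hB

theorem eq_singleton_of_forall_not_adj {G : SimpleGraph V} {l : List V} {v : V}
    (hl : l.IsChain G.Adj) (hv : v ∈ l) (h : ∀ w ∈ l, ¬ G.Adj v w) : l = [v] := by
  obtain ⟨A, B, rfl⟩ := List.append_of_mem hv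
  have hc := List.isChain_append.1 hl
  have hA : A = [] := by
    rcases A.eq_nil_or_concat with rfl | ⟨A', x, rfl⟩
    · rfl
    · exact absurd (hc.2.2 x (by simp) v (by simp)).symm (h x (by simp))
  have hB : B = [] := by
    rcases B with _ | ⟨x, B⟩
    · rfl
    · exact absurd ((List.isChain_cons.1 hc.2.1).1 x (by simp)) (h x (by simp))
  simp [hA, hB]

theorem exists_third_list {A B C : List V} {u v h : V} (huv : u ≠ v) (hu : h ≠ u) (hv : h ≠ v)
    (A1 : u ∈ A → A = [u]) (A2 : v ∈ A → A = [v]) (B1 : u ∈ B → B = [u]) (B2 : v ∈ B → B = [v])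
    (C1 : u ∈ C → C = [u]) (C2 : v ∈ C → C = [v]) (mu : u ∈ A ∨ u ∈ B ∨ u ∈ C)
    (mv : v ∈ A ∨ v ∈ B ∨ v ∈ C) (mh : h ∈ A ∨ h ∈ B ∨ h ∈ C)
    (du : (u ∈ A → u ∉ B ∧ u ∉ C) ∧ (u ∈ B → u ∉ C))
    (dv : (v ∈ A → v ∉ B ∧ v ∉ C) ∧ (v ∈ B → v ∉ C)) :
    (u ∉ A ∧ v ∉ A ∧ h ∈ A ∧ ∀ w, w ∈ B ∨ w ∈ C → w = u ∨ w = v) ∨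
      (u ∉ B ∧ v ∉ B ∧ h ∈ B ∧ ∀ w, w ∈ A ∨ w ∈ C → w = u ∨ w = v) ∨
      (u ∉ C ∧ v ∉ C ∧ h ∈ C ∧ ∀ w, w ∈ A ∨ w ∈ B → w = u ∨ w = v) := by
  have ne : [u] ≠ [v] := by simpa using huv
  rcases mu with m | m | m <;> rcases mv with m' | m' | m'
  · exact absurd ((A1 m).symm.trans (A2 m')) ne
  · right; right
    obtain rfl := A1 m
    obtain rfl := B2 m'
    exact ⟨(du.1 m).2, dv.2 m', by simpa [hu, hv] using mh, by simp⟩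
  · right; left
    obtain rfl := A1 m
    obtain rfl := C2 m'
    exact ⟨(du.1 m).1, fun h => dv.2 h m', by simpa [hu, hv] using mh, by simp⟩
  · right; right
    obtain rfl := B1 m
    obtain rfl := A2 m'
    exact ⟨du.2 m, (dv.1 m').2, by simpa [hu, hv] using mh, by simp [or_comm]⟩
  · exact absurd ((B1 m).symm.trans (B2 m')) ne
  · left
    obtain rfl := B1 m
    obtain rfl := C2 m'
    exact ⟨fun h => (du.1 h).1 m, fun h => (dv.1 h).2 m', by simpa [hu, hv] using mh, by simp⟩
  · right; left
    obtain rfl := C1 m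
    obtain rfl := A2 m'
    exact ⟨fun h => du.2 h m, (dv.1 m').1, by simpa [hu, hv] using mh, by simp [or_comm]⟩
  · left
    obtain rfl := C1 m
    obtain rfl := B2 m'
    exact ⟨fun h => (du.1 h).2 m, fun h => (dv.1 h).1 m', by simpa [hu, hv] using mh,
      by simp [or_comm]⟩
  · exact absurd ((C1 m).symm.trans (C2 m')) ne

theorem IsHamList.exists_of_twins_of_eq_append {G : SimpleGraph V} {v₁ v₂ y s h : V}
    {A B C : List V} (h1 : ∀ w, G.Adj v₁ w → w = y ∨ w = s) (h2 : ∀ w, G.Adj v₂ w → w = y ∨ w = s)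
    (hnd : [v₁, v₂, y, s].Nodup) (hh : h ∉ [v₁, v₂, y, s])
    (hl : G.IsHamList (A ++ y :: (B ++ s :: C))) :
    ∃ x X, (x :: X).Nodup ∧ (∀ w, w ∈ x :: X ↔ w ∉ [v₁, v₂, y, s]) ∧ (x :: X).IsChain G.Adj ∧
      (G.Adj y x ∨ G.Adj s x) := by
  obtain ⟨hn, hm, hc⟩ := hl
  have hc1 := List.isChain_append.1 hc
  have hc2 := List.isChain_cons.1 hc1.2.1
  have hc3 := List.isChain_append.1 hc2.2
  have hc4 := List.isChain_cons.1 hc3.2.1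
  have hn1 := List.nodup_append.1 hn
  have hn3 := List.nodup_append.1 (List.nodup_cons.1 hn1.2.1).2
  have key : ∀ v X, (∀ w, G.Adj v w → w = y ∨ w = s) → v ∈ X → y ∉ X → s ∉ X →
      X.IsChain G.Adj → X = [v] := by
    intro v X hv hvX hyX hsX hX
    refine eq_singleton_of_forall_not_adj hX hvX fun w hw hvw => ?_
    rcases hv w hvw with rfl | rfl
    · exact hyX hw
    · exact hsX hw
  have hy3 := (List.nodup_cons.1 hn1.2.1).1
  have hs3 := (List.nodup_cons.1 hn3.2.1).1
  simp only [List.mem_append, List.mem_cons, not_or] at hy3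
  have hyA : y ∉ A ∧ y ∉ B ∧ y ∉ C :=
    ⟨fun h => hn1.2.2 y h y (by simp) rfl, hy3.1, hy3.2.2⟩
  have hsA : s ∉ A ∧ s ∉ B ∧ s ∉ C :=
    ⟨fun h => hn1.2.2 s h s (by simp) rfl, fun h => hn3.2.2 s h s (by simp) rfl, hs3⟩
  have A1 := fun h => key v₁ A h1 h hyA.1 hsA.1 hc1.1
  have A2 := fun h => key v₂ A h2 h hyA.1 hsA.1 hc1.1
  have B1 := fun h => key v₁ B h1 h hyA.2.1 hsA.2.1 hc3.1
  have B2 := fun h => key v₂ B h2 h hyA.2.1 hsA.2.1 hc3.1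
  have C1 := fun h => key v₁ C h1 h hyA.2.2 hsA.2.2 hc4.2
  have C2 := fun h => key v₂ C h2 h hyA.2.2 hsA.2.2 hc4.2
  simp only [List.nodup_cons, List.mem_cons, List.not_mem_nil, or_false, not_or] at hnd hh
  have hmem : ∀ w, w ≠ y → w ≠ s → w ∈ A ∨ w ∈ B ∨ w ∈ C := by
    intro w hwy hws
    simpa [hwy, hws] using hm w
  have hd : ∀ w, (w ∈ A → w ∉ B ∧ w ∉ C) ∧ (w ∈ B → w ∉ C) := by
    exact fun w => ⟨fun h => ⟨fun h' => hn1.2.2 w h w (by simp [h']) rfl,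
      fun h' => hn1.2.2 w h w (by simp [h']) rfl⟩, fun h h' => hn3.2.2 w h w (by simp [h']) rfl⟩
  have hmem' : ∀ w, w ∉ [v₁, v₂, y, s] ↔ w ≠ v₁ ∧ w ≠ v₂ ∧ w ≠ y ∧ w ≠ s := by simp
  have m1 := hmem v₁ hnd.1.2.1 hnd.1.2.2
  have m2 := hmem v₂ hnd.2.1.1 hnd.2.1.2
  have mh := hmem h hh.2.2.1 hh.2.2.2
  have hcase := exists_third_list (Ne.intro hnd.1.1) hh.1 hh.2.1 A1 A2 B1 B2 C1 C2 m1 m2 mh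
    (hd v₁) (hd v₂)
  have hX : ∀ X : List V, y ∉ X → s ∉ X → v₁ ∉ X → v₂ ∉ X →
      (∀ w, w ∉ X → w ≠ y → w ≠ s → w = v₁ ∨ w = v₂) → ∀ w, w ∈ X ↔ w ∉ [v₁, v₂, y, s] := by
    intro X a b c d e w
    rw [hmem']
    refine ⟨fun hw => ⟨?_, ?_, ?_, ?_⟩, fun hw => by_contra fun h => ?_⟩
    · exact ne_of_mem_of_not_mem hw c
    · exact ne_of_mem_of_not_mem hw d
    · exact ne_of_mem_of_not_mem hw a
    · exact ne_of_mem_of_not_mem hw b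
    · exact (e w h hw.2.2.1 hw.2.2.2).elim hw.1 hw.2.1
  rcases hcase with ⟨n1, n2, hA, ho⟩ | ⟨n1, n2, hB, ho⟩ | ⟨n1, n2, hC, ho⟩
  · rcases A.eq_nil_or_concat with rfl | ⟨A', x, rfl⟩
    · simp at hA
    · refine ⟨x, A'.reverse, ?_⟩
      have e : x :: A'.reverse = (A'.concat x).reverse := by simp
      rw [e]
      refine ⟨List.nodup_reverse.2 hn1.1, ?_, isChain_adj_reverse.2 hc1.1,
        Or.inl (hc1.2.2 x (by simp) y (by simp)).symm⟩
      intro w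
      rw [List.mem_reverse]
      exact hX _ hyA.1 hsA.1 n1 n2 (fun w a b c => ho w ((hmem w b c).resolve_left a)) w
  · rcases B with _ | ⟨x, B⟩
    · simp at hB
    · exact ⟨x, B, hn3.1, hX _ hyA.2.1 hsA.2.1 n1 n2 (fun w a b c => ho w
        ((hmem w b c).imp_right fun h => h.resolve_left a)), hc3.1, Or.inl (hc2.1 x (by simp))⟩
  · rcases C with _ | ⟨x, C⟩
    · simp at hC
    · exact ⟨x, C, (List.nodup_cons.1 hn3.2.1).2, hX _ hyA.2.2 hsA.2.2 n1 n2 (fun w a b c => ho w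
        ((hmem w b c).imp_right fun h => h.resolve_right a)), hc4.2, Or.inr (hc4.1 x (by simp))⟩

/-- If `v₁` and `v₂` have no neighbours besides `y` and `s`, a Hamiltonian path yields one of the
graph without these four vertices. -/
theorem IsHamList.exists_of_twins {G : SimpleGraph V} {v₁ v₂ y s h : V} {l : List V}
    (h1 : ∀ w, G.Adj v₁ w → w = y ∨ w = s) (h2 : ∀ w, G.Adj v₂ w → w = y ∨ w = s)
    (hnd : [v₁, v₂, y, s].Nodup) (hh : h ∉ [v₁, v₂, y, s]) (hl : G.IsHamList l) :
    ∃ x X, (x :: X).Nodup ∧ (∀ w, w ∈ x :: X ↔ w ∉ [v₁, v₂, y, s]) ∧ (x :: X).IsChain G.Adj ∧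
      (G.Adj y x ∨ G.Adj s x) := by
  obtain ⟨A, B, rfl⟩ := List.append_of_mem (hl.2.1 y)
  have hs : s ∈ A ∨ s ∈ B := by
    have := hl.2.1 s
    grind
  rcases hs with hs | hs
  · obtain ⟨C, D, rfl⟩ := List.append_of_mem hs
    have e : C ++ s :: D ++ y :: B = C ++ s :: (D ++ y :: B) := by simp
    rw [e] at hl
    obtain ⟨x, X, a, b, c, d⟩ := IsHamList.exists_of_twins_of_eq_append
      (fun w hw => (h1 w hw).symm) (fun w hw => (h2 w hw).symm)
      (y := s) (s := y) (h := h) (by grind) (by grind) hl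
    exact ⟨x, X, a, fun w => by rw [b]; grind, c, d.symm⟩
  · obtain ⟨C, D, rfl⟩ := List.append_of_mem hs
    exact IsHamList.exists_of_twins_of_eq_append h1 h2 hnd hh hl

theorem exists_isHamList_of_twins {G : SimpleGraph V} {v₁ v₂ y s x : V} {X : List V}
    (h1y : G.Adj v₁ y) (h2y : G.Adj v₂ y) (h2s : G.Adj v₂ s) (hnd : [v₁, v₂, y, s].Nodup)
    (hX : (x :: X).Nodup) (hm : ∀ w, w ∈ x :: X ↔ w ∉ [v₁, v₂, y, s])
    (hc : (x :: X).IsChain G.Adj) (hx : G.Adj s x) : ∃ l, G.IsHamList l := by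
  refine ⟨[v₁, y, v₂, s] ++ x :: X, ?_, ?_, ?_⟩
  · rw [List.nodup_append]
    refine ⟨by grind, hX, ?_⟩
    rintro a ha b hb rfl
    have := (hm a).1 hb
    grind
  · intro w
    have := hm w
    grind
  · simp only [List.cons_append, List.nil_append, List.isChain_cons_cons]
    exact ⟨h1y, h2y.symm, h2s, hx, hc⟩

end SimpleGraph

namespace MaxNontraceable

variable {V : Type*} {G : SimpleGraph V}

theorem not_isHamList [Nonempty V] (hG : MaxNontraceable G) (l : List V) : ¬ G.IsHamList l :=
  fun hl => hG.1 (traceable_iff_exists_isHamList.2 ⟨l, hl⟩)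

theorem exists_isHamList_sup_edge (hG : MaxNontraceable G) {u w : V} (huw : u ≠ w)
    (h : ¬ G.Adj u w) : ∃ l, (G ⊔ edge u w).IsHamList l := by
  have : Nonempty V := ⟨u⟩
  exact traceable_iff_exists_isHamList.1 (hG.2 u w huw h)

/-- If `F` traces a path from a neighbour of `s` to a neighbour of `t`, and only `s` and `t` have
neighbours in `F`, then `F ∪ {s, t}` is a clique. -/
theorem adj_of_attachments [Nonempty V] (hG : MaxNontraceable G) {F : List V} {s t a b u w : V}
    (hFn : F.Nodup) (hFc : F.IsChain G.Adj) (ha : F.head? = some a) (hb : F.getLast? = some b)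
    (hsa : G.Adj s a) (htb : s ≠ t → G.Adj t b)
    (hF : ∀ f x, f ∈ F → x ∉ F → G.Adj f x → x = s ∨ x = t)
    (hu : u ∈ F ∨ u = s ∨ u = t) (hw : w ∈ F ∨ w = s ∨ w = t) (huw : u ≠ w) : G.Adj u w := by
  by_contra h
  obtain ⟨l, hl⟩ := hG.exists_isHamList_sup_edge huw h
  obtain ⟨l', hl'⟩ := exists_isHamList_of_attachments (G := G) hFn hFc ha hb hsa htb
    (by
      intro x y hx hy hxy
      rw [sup_adj, edge_adj] at hxy
      refine hxy.imp_right fun hxy => ?_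
      rw [Sym2.eq_iff]
      grind only)
    (by
      intro f x hf hx hfx
      rw [sup_adj, edge_adj] at hfx
      rcases hfx with hfx | hfx
      · exact hF f x hf hx hfx
      · grind only) hl
  exact hG.not_isHamList l' hl'

theorem exists_of_twins [Nonempty V] (hG : MaxNontraceable G) {v₁ v₂ y s h : V}
    (h1 : ∀ w, G.Adj v₁ w ↔ w = y ∨ w = s) (h2 : ∀ w, G.Adj v₂ w ↔ w = y ∨ w = s)
    (hnd : [v₁, v₂, y, s].Nodup) (hh : h ∉ [v₁, v₂, y, s]) (hyh : ¬ G.Adj y h) :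
    ∃ X, (h :: X).Nodup ∧ (∀ w, w ∈ h :: X ↔ w ∉ [v₁, v₂, y, s]) ∧ (h :: X).IsChain G.Adj := by
  have hd := hnd
  have hh' := hh
  simp only [List.nodup_cons, List.mem_cons, List.not_mem_nil, or_false, not_or] at hd hh'
  obtain ⟨l, hl⟩ := hG.exists_isHamList_sup_edge (Ne.symm hh'.2.2.1) hyh
  obtain ⟨x, X, hn, hm, hc, hx⟩ := hl.exists_of_twins (v₁ := v₁) (v₂ := v₂)
    (y := y) (s := s) (h := h)
    (by
      intro w hw
      rw [sup_adj, edge_adj, h1] at hw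
      grind only)
    (by
      intro w hw
      rw [sup_adj, edge_adj, h2] at hw
      grind only) hnd hh
  have hyX : y ∉ x :: X := by simp [hm]
  have hc' : (x :: X).IsChain G.Adj := by
    refine hc.imp_of_mem_imp fun a b ha hb hab => ?_
    rw [sup_adj, edge_adj] at hab
    refine hab.resolve_right ?_
    rintro ⟨⟨rfl, rfl⟩ | ⟨rfl, rfl⟩, -⟩
    · exact hyX ha
    · exact hyX hb
  have hys : ¬ (G.Adj y x ∨ G.Adj s x) := by
    rintro (hx | hx)
    · obtain ⟨l, hl⟩ := exists_isHamList_of_twins (v₁ := v₁) (v₂ := v₂) (y := s) (s := y)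
        ((h1 s).2 (Or.inr rfl)) ((h2 s).2 (Or.inr rfl)) ((h2 y).2 (Or.inl rfl))
        (by simp only [List.nodup_cons, List.mem_cons, List.not_mem_nil, or_false, not_or]
            grind only) hn (fun w => by rw [hm]; simp only [List.mem_cons]; grind only) hc' hx
      exact hG.not_isHamList l hl
    · obtain ⟨l, hl⟩ := exists_isHamList_of_twins (v₁ := v₁) (v₂ := v₂) (y := y) (s := s)
        ((h1 y).2 (Or.inl rfl)) ((h2 y).2 (Or.inl rfl)) ((h2 s).2 (Or.inr rfl)) hnd hn hm hc' hx
      exact hG.not_isHamList l hl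
  have hxh : x = h := by
    rw [sup_adj, sup_adj, edge_adj, edge_adj] at hx
    grind only
  subst hxh
  exact ⟨X, hn, hm, hc'⟩

/-- The two neighbours of a pair of twins of degree two have the same further neighbours. -/
theorem adj_of_twins_s8 [Nonempty V] (hG : MaxNontraceable G) {v₁ v₂ y s h : V}
    (h1 : ∀ w, G.Adj v₁ w ↔ w = y ∨ w = s) (h2 : ∀ w, G.Adj v₂ w ↔ w = y ∨ w = s)
    (hnd : [v₁, v₂, y, s].Nodup) (hh : h ∉ [v₁, v₂, y, s]) (hsh : G.Adj s h) : G.Adj y h := by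
  by_contra hyh
  obtain ⟨X, hn, hm, hc⟩ := hG.exists_of_twins h1 h2 hnd hh hyh
  obtain ⟨l, hl⟩ := exists_isHamList_of_twins (v₁ := v₁) (v₂ := v₂) (y := y) (s := s)
        ((h1 y).2 (Or.inl rfl)) ((h2 y).2 (Or.inl rfl)) ((h2 s).2 (Or.inr rfl)) hnd hn hm hc hsh
  exact hG.not_isHamList l hl

theorem adj_of_triplets [Nonempty V] (hG : MaxNontraceable G) {v₁ v₂ v₃ y s h : V}
    (h1 : ∀ w, G.Adj v₁ w ↔ w = y ∨ w = s) (h2 : ∀ w, G.Adj v₂ w ↔ w = y ∨ w = s)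
    (h3 : ∀ w, G.Adj v₃ w ↔ w = y ∨ w = s)
    (hnd : [v₁, v₂, y, s].Nodup) (h3' : v₃ ∉ [v₁, v₂, y, s]) (hh : h ∉ [v₁, v₂, y, s]) :
    G.Adj y h := by
  by_contra hyh
  obtain ⟨X, hn, hm, hc⟩ := hG.exists_of_twins h1 h2 hnd hh hyh
  have := eq_singleton_of_forall_not_adj hc ((hm v₃).2 h3') (by
    intro w hw h
    have := (hm w).1 hw
    rcases (h3 w).1 h with rfl | rfl <;> simp at this)
  have hh3 : h = v₃ := (List.cons.inj this).1
  subst hh3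
  exact hyh ((h3 y).2 (Or.inl rfl)).symm

theorem not_quintuplets [Nonempty V] (hG : MaxNontraceable G) {v₁ v₂ v₃ v₄ v₅ y s : V}
    (h1 : ∀ w, G.Adj v₁ w ↔ w = y ∨ w = s) (h2 : ∀ w, G.Adj v₂ w ↔ w = y ∨ w = s)
    (h3 : ∀ w, G.Adj v₃ w ↔ w = y ∨ w = s) (h5 : ∀ w, G.Adj v₅ w ↔ w = y ∨ w = s)
    (hnd : [v₁, v₂, v₃, v₄, v₅, y, s].Nodup) : False := by
  simp only [List.nodup_cons, List.mem_cons, List.not_mem_nil, or_false, not_or] at hnd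
  obtain ⟨l, hl⟩ := hG.exists_isHamList_sup_edge (u := v₃) (w := v₄) (by grind only)
    (by rw [h3]; grind only)
  obtain ⟨x, X, hn, hm, hc, hx⟩ := hl.exists_of_twins (v₁ := v₁) (v₂ := v₂) (y := y) (s := s)
    (h := v₃)
    (by
      intro w hw
      rw [sup_adj, edge_adj, h1] at hw
      grind only)
    (by
      intro w hw
      rw [sup_adj, edge_adj, h2] at hw
      grind only)
    (by simp only [List.nodup_cons, List.mem_cons, List.not_mem_nil, or_false, not_or]; grind only)
    (by simp only [List.mem_cons, List.not_mem_nil, or_false, not_or]; grind only)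
  simp only [List.mem_cons (a := _) (b := v₁), List.mem_cons (b := v₂), List.mem_cons (b := y),
    List.mem_cons (b := s), List.not_mem_nil, or_false] at hm
  have m3 : v₃ ∈ x :: X := (hm v₃).2 (by grind only)
  have m5 : v₅ ∈ x :: X := (hm v₅).2 (by grind only)
  have := eq_singleton_of_forall_not_adj hc m5 (by
    intro w hw h
    have := (hm w).1 hw
    rw [sup_adj, edge_adj, h5] at h
    grind only)
  rw [this, List.mem_singleton] at m3
  grind only

section Degree

variable [Fintype V] [DecidableEq V] [DecidableRel G.Adj]

/-- The neighbourhood of a vertex of degree two induces an edge. -/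
theorem exists_adj_iff_of_degree_eq_two (hG : MaxNontraceable G) {v y : V} (hv : G.degree v = 2)
    (hvy : G.Adj v y) : ∃ s, s ≠ y ∧ (∀ w, G.Adj v w ↔ w = y ∨ w = s) ∧ G.Adj y s := by
  have : Nonempty V := ⟨v⟩
  obtain ⟨a, b, hab, hN⟩ := Finset.card_eq_two.1 ((G.card_neighborFinset_eq_degree v).trans hv)
  have hN' : ∀ w, G.Adj v w ↔ w = a ∨ w = b := by
    intro w
    rw [← mem_neighborFinset, hN]
    simp
  have hab' : G.Adj a b := by
    refine hG.adj_of_attachments (F := [v]) (s := a) (t := b) (a := v) (b := v) (by simp) (by simp)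
      rfl rfl ((hN' a).2 (Or.inl rfl)).symm (fun _ => ((hN' b).2 (Or.inr rfl)).symm) ?_ (by simp)
      (by simp) hab
    intro f x hf _ hfx
    rw [List.mem_singleton] at hf
    subst hf
    exact (hN' x).1 hfx
  rcases (hN' y).1 hvy with rfl | rfl
  · exact ⟨b, hab.symm, hN', hab'⟩
  · exact ⟨a, hab, fun w => by rw [hN', or_comm], hab'.symm⟩

theorem four_le_degree_of_adj (hG : MaxNontraceable G) (h1 : ∀ v, G.degree v ≠ 1)
    (h2 : ∀ u v, G.Adj u v → ¬ (G.degree u = 2 ∧ G.degree v = 2)) {v y : V}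
    (hv : G.degree v = 2) (hvy : G.Adj v y) : 4 ≤ G.degree y := by
  have : Nonempty V := ⟨v⟩
  have h0 : G.degree y ≠ 0 := (G.degree_pos_iff_exists_adj y).2 ⟨v, hvy.symm⟩ |>.ne'
  have h2' : G.degree y ≠ 2 := fun h => h2 v y hvy ⟨hv, h⟩
  have h3 : G.degree y ≠ 3 := by
    intro h3
    obtain ⟨s, hsy, hN, hys⟩ := hG.exists_adj_iff_of_degree_eq_two hv hvy
    have hvs : G.Adj v s := (hN s).2 (Or.inr rfl)
    have hc : (G.neighborFinset y \ {v, s}).card = 1 := by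
      rw [Finset.card_sdiff_of_subset, card_neighborFinset_eq_degree, h3,
        Finset.card_pair hvs.ne]
      intro w hw
      rw [mem_neighborFinset]
      rcases Finset.mem_insert.1 hw with rfl | hw
      · exact hvy.symm
      · rw [Finset.mem_singleton] at hw
        exact hw ▸ hys
    obtain ⟨z, hz⟩ := Finset.card_eq_one.1 hc
    have hz' : ∀ w, (G.Adj y w ∧ w ≠ v ∧ w ≠ s) ↔ w = z := by
      intro w
      rw [← Finset.mem_singleton, ← hz]
      simp
    have hzz := (hz' z).2 rfl
    have hvz : G.Adj v z := by
      refine hG.adj_of_attachments (F := [v, y]) (s := s) (t := z) (a := v) (b := y)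
        (by simpa using hvy.ne) (by simpa using hvy) rfl rfl hvs.symm (fun _ => hzz.1.symm) ?_
        (by simp) (by simp) hzz.2.1.symm
      intro f x hf hx hfx
      simp only [List.mem_cons, List.not_mem_nil, or_false, not_or] at hf hx
      rcases hf with rfl | rfl
      · exact Or.inl (((hN x).1 hfx).resolve_left hx.2)
      · by_cases hxs : x = s
        · exact Or.inl hxs
        · exact Or.inr ((hz' x).1 ⟨hfx, hx.1, hxs⟩)
    rcases (hN z).1 hvz with rfl | rfl
    · exact hzz.1.ne rfl
    · exact hzz.2.2 rfl
  have := h1 y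
  omega

/-- If two neighbours of `y` of degree two are twins, then `y` has at least three neighbours of
larger degree. -/
theorem not_twins (hG : MaxNontraceable G) (hn : 7 ≤ Fintype.card V) (h0 : ∀ v, G.degree v ≠ 0)
    (h1 : ∀ v, G.degree v ≠ 1)
    (h2 : ∀ u v, G.Adj u v → ¬ (G.degree u = 2 ∧ G.degree v = 2)) {v₁ v₂ y r t : V}
    (hd : G.degree v₁ = 2) (hv : v₁ ≠ v₂)
    (hv1 : ∀ w, G.Adj v₁ w ↔ w = y ∨ w = r) (hv2 : ∀ w, G.Adj v₂ w ↔ w = y ∨ w = r)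
    (hry : r ≠ y) (hyr : G.Adj y r) (hyt : G.Adj y t) (ht : G.degree t ≠ 2)
    (hN : ∀ w, G.Adj y w → G.degree w = 2 ∨ w = r ∨ w = t) : False := by
  have : Nonempty V := ⟨y⟩
  have a1y := (hv1 y).2 (Or.inl rfl)
  have a2y := (hv2 y).2 (Or.inl rfl)
  have a1r := (hv1 r).2 (Or.inr rfl)
  have a2r := (hv2 r).2 (Or.inr rfl)
  have hnd : [v₁, v₂, y, r].Nodup := by
    simp only [List.nodup_cons, List.mem_cons, List.not_mem_nil, or_false, not_or]
    exact ⟨⟨hv, a1y.ne, a1r.ne⟩, ⟨a2y.ne, a2r.ne⟩, hry.symm, not_false, List.nodup_nil⟩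
  have hnd' : [v₁, v₂, r, y].Nodup := by
    simp only [List.nodup_cons, List.mem_cons, List.not_mem_nil, or_false, not_or]
    exact ⟨⟨hv, a1r.ne, a1y.ne⟩, ⟨a2r.ne, a2y.ne⟩, hry, not_false, List.nodup_nil⟩
  have hd2 : G.degree v₂ = 2 := by
    rw [← hd, ← card_neighborFinset_eq_degree, ← card_neighborFinset_eq_degree]
    congr 1
    ext w
    rw [mem_neighborFinset, mem_neighborFinset, hv1, hv2]
  have dy : 4 ≤ G.degree y := hG.four_le_degree_of_adj h1 h2 hd a1y
  have dr : 4 ≤ G.degree r := hG.four_le_degree_of_adj h1 h2 hd a1r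
  have hyr' : ∀ h, h ∉ [v₁, v₂, y, r] → (G.Adj y h ↔ G.Adj r h) := by
    intro h hh
    refine ⟨fun h' => ?_, hG.adj_of_twins_s8 hv1 hv2 hnd hh⟩
    refine hG.adj_of_twins_s8 (y := r) (s := y) (fun w => (hv1 w).trans or_comm)
      (fun w => (hv2 w).trans or_comm) hnd' ?_ h'
    simp only [List.mem_cons, List.not_mem_nil, or_false, not_or] at hh ⊢
    exact ⟨hh.1, hh.2.1, hh.2.2.2, hh.2.2.1⟩
  have hB : ∀ v, G.degree v = 2 → G.Adj y v → ∀ w, G.Adj v w ↔ w = y ∨ w = r := by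
    intro v hv hyv
    have hrv : G.Adj v r := by
      by_cases hm : v ∈ [v₁, v₂, y, r]
      · simp only [List.mem_cons, List.not_mem_nil, or_false] at hm
        rcases hm with rfl | rfl | rfl | rfl
        · exact a1r
        · exact a2r
        · omega
        · omega
      · exact ((hyr' v hm).1 hyv).symm
    obtain ⟨p, hpy, hp, -⟩ := hG.exists_adj_iff_of_degree_eq_two hv hyv.symm
    have := ((hp r).1 hrv).resolve_left hry
    subst this
    exact hp
  have hty : t ≠ y := hyt.ne'
  by_cases h3 : ∃ v₃, v₃ ≠ v₁ ∧ v₃ ≠ v₂ ∧ G.degree v₃ = 2 ∧ G.Adj y v₃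
  · obtain ⟨v₃, h31, h32, h3d, h3y⟩ := h3
    have h3N := hB v₃ h3d h3y
    have h3r : v₃ ≠ r := by rintro rfl; omega
    have huniv : ∀ h, h ≠ y → G.Adj y h := by
      intro h hh
      by_cases hm : h ∈ [v₁, v₂, y, r]
      · simp only [List.mem_cons, List.not_mem_nil, or_false] at hm
        rcases hm with rfl | rfl | rfl | rfl
        · exact a1y.symm
        · exact a2y.symm
        · exact absurd rfl hh
        · exact hyr
      · refine hG.adj_of_triplets hv1 hv2 h3N hnd ?_ hm
        simp only [List.mem_cons, List.not_mem_nil, or_false, not_or]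
        exact ⟨h31, h32, h3y.ne', h3r⟩
    have htr : t = r := by
      by_contra htr
      have hs : G.neighborFinset t ⊆ {y, r} := by
        intro w hw
        rw [mem_neighborFinset] at hw
        rw [Finset.mem_insert, Finset.mem_singleton]
        by_contra hwn
        rw [not_or] at hwn
        have hyw := huniv w hwn.1
        rcases hN w hyw with h | h | h
        · rcases (hB w h hyw t).1 hw.symm with h | h
          · exact hty h
          · exact htr h
        · exact hwn.2 h
        · exact hw.ne h.symm
      have := (Finset.card_le_card hs).trans Finset.card_le_two
      rw [card_neighborFinset_eq_degree] at this
      have := h0 t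
      have := h1 t
      omega
    subst htr
    have hc : 1 < (Finset.univ \ {v₁, v₂, v₃, y, t} : Finset V).card := by
      have e := Finset.le_card_sdiff ({v₁, v₂, v₃, y, t} : Finset V) Finset.univ
      have := Finset.card_le_five (a := v₁) (b := v₂) (c := v₃) (d := y) (e := t)
      rw [Finset.card_univ] at e
      omega
    obtain ⟨v₄, m4, v₅, m5, h45⟩ := Finset.one_lt_card.1 hc
    simp only [Finset.mem_sdiff, Finset.mem_univ, Finset.mem_insert, Finset.mem_singleton,
      true_and, not_or] at m4 m5
    have h5y := huniv v₅ m5.2.2.2.1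
    refine hG.not_quintuplets (v₄ := v₄) hv1 hv2 h3N
      (hB v₅ ((hN v₅ h5y).resolve_right (by simp [m5])) h5y) ?_
    simp only [List.nodup_cons, List.mem_cons, List.not_mem_nil, or_false, not_or] at hnd ⊢
    have := h3y.ne'
    grind only
  · push Not at h3
    have hB2 : ∀ w, G.Adj y w → w = v₁ ∨ w = v₂ ∨ w = r ∨ w = t := by
      intro w hw
      have := h3 w
      have := hN w hw
      tauto
    have htr : t ≠ r := by
      rintro rfl
      have hs : G.neighborFinset y ⊆ {v₁, v₂, t} := by
        intro w hw
        rw [mem_neighborFinset] at hw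
        have := hB2 w hw
        simp only [Finset.mem_insert, Finset.mem_singleton]
        tauto
      have := (Finset.card_le_card hs).trans Finset.card_le_three
      rw [card_neighborFinset_eq_degree] at this
      omega
    have t1 : t ≠ v₁ := by rintro rfl; exact ht hd
    have t2 : t ≠ v₂ := by rintro rfl; exact ht hd2
    have h12 : G.Adj v₁ v₂ := by
      refine hG.adj_of_attachments (F := [y, v₁, r, v₂]) (s := t) (t := t) (a := y) (b := v₂)
        ?_ ?_ rfl rfl hyt.symm (fun h => absurd rfl h) ?_ (by simp) (by simp) hv
      · simp only [List.nodup_cons, List.mem_cons, List.not_mem_nil, or_false, not_or] at hnd ⊢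
        grind only
      · simp [a1y.symm, a1r, a2r.symm]
      · intro f x hf hx hfx
        simp only [List.mem_cons, List.not_mem_nil, or_false, not_or] at hf hx
        have hyx : G.Adj y x → x = t := fun h => by
          have := hB2 x h
          tauto
        rcases hf with rfl | rfl | rfl | rfl
        · exact Or.inl (hyx hfx)
        · rcases (hv1 x).1 hfx with h | h <;> simp [h] at hx
        · refine Or.inl (hyx ((hyr' x ?_).2 hfx))
          simp only [List.mem_cons, List.not_mem_nil, or_false, not_or]
          tauto
        · rcases (hv2 x).1 hfx with h | h <;> simp [h] at hx
    rcases (hv1 v₂).1 h12 with h | h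
    · exact a2y.ne h
    · exact a2r.ne h

theorem three_add_card_le_degree (hG : MaxNontraceable G) (hn : 7 ≤ Fintype.card V)
    (h0 : ∀ v, G.degree v ≠ 0) (h1 : ∀ v, G.degree v ≠ 1)
    (h2 : ∀ u v, G.Adj u v → ¬ (G.degree u = 2 ∧ G.degree v = 2)) {y : V} (hy : G.degree y ≠ 2) :
    3 + ((G.neighborFinset y).filter (G.degree · = 2)).card ≤ G.degree y := by
  have : Nonempty V := ⟨y⟩
  have hsum := Finset.card_filter_add_card_filter_not (s := G.neighborFinset y) (G.degree · = 2)
  rw [card_neighborFinset_eq_degree] at hsum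
  set B := (G.neighborFinset y).filter (G.degree · = 2) with hBdef
  set N := (G.neighborFinset y).filter (¬ G.degree · = 2) with hNdef
  have mB : ∀ w, w ∈ B ↔ G.Adj y w ∧ G.degree w = 2 := by simp [hBdef]
  have mN : ∀ w, w ∈ N ↔ G.Adj y w ∧ G.degree w ≠ 2 := by simp [hNdef]
  rcases B.eq_empty_or_nonempty with hB | ⟨v, hv⟩
  · rw [hB, Finset.card_empty]
    have := h0 y
    have := h1 y
    omega
  by_contra hlt
  have hN2 : N.card ≤ 2 := by omega
  have hv' := (mB v).1 hv
  have hd4 := hG.four_le_degree_of_adj h1 h2 hv'.2 hv'.1.symm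
  have hpart : ∀ v ∈ B, ∃ p ∈ N, p ≠ y ∧ ∀ w, G.Adj v w ↔ w = y ∨ w = p := by
    intro v hv
    obtain ⟨hyv, hv⟩ := (mB v).1 hv
    obtain ⟨p, hpy, hp, hyp⟩ := hG.exists_adj_iff_of_degree_eq_two hv hyv.symm
    exact ⟨p, (mN p).2 ⟨hyp, fun h => h2 v p ((hp p).2 (Or.inr rfl)) ⟨hv, h⟩⟩, hpy, hp⟩
  have hother : ∀ p ∈ N, ∃ t ∈ N, ∀ w ∈ N, w = p ∨ w = t := by
    intro p hp
    rcases (N.erase p).eq_empty_or_nonempty with h | ⟨t, ht⟩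
    · refine ⟨p, hp, fun w hw => ?_⟩
      by_contra hwp
      rw [or_self] at hwp
      have := Finset.mem_erase.2 ⟨hwp, hw⟩
      rw [h] at this
      exact Finset.notMem_empty _ this
    · refine ⟨t, Finset.mem_of_mem_erase ht, fun w hw => ?_⟩
      by_contra hwt
      rw [not_or] at hwt
      have hc : (N.erase p).card ≤ 1 := by
        rw [Finset.card_erase_of_mem hp]
        omega
      exact hwt.2 (Finset.card_le_one.1 hc w (Finset.mem_erase.2 ⟨hwt.1, hw⟩) t ht)
  have htwin : ∀ v₁ ∈ B, ∀ v₂ ∈ B, v₁ ≠ v₂ → ∀ p ∈ N, (∀ w, G.Adj v₁ w ↔ w = y ∨ w = p) →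
      ¬ ∀ w, G.Adj v₂ w ↔ w = y ∨ w = p := by
    intro v₁ m₁ v₂ m₂ hne p hp a₁ a₂
    obtain ⟨t, ht, htN⟩ := hother p hp
    have hp' := (mN p).1 hp
    have ht' := (mN t).1 ht
    refine hG.not_twins hn h0 h1 h2 ((mB v₁).1 m₁).2 hne a₁ a₂ hp'.1.ne' hp'.1 ht'.1 ht'.2 ?_
    intro w hw
    by_cases hw2 : G.degree w = 2
    · exact Or.inl hw2
    · exact Or.inr (htN w ((mN w).2 ⟨hw, hw2⟩))
  have hB2 : 1 < B.card := by omega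
  obtain ⟨v₁, m₁, v₂, m₂, hne⟩ := Finset.one_lt_card.1 hB2
  obtain ⟨p, hp, hpy, a₁⟩ := hpart v₁ m₁
  obtain ⟨q, hq, hqy, a₂⟩ := hpart v₂ m₂
  have hpq : p ≠ q := by
    rintro rfl
    exact htwin v₁ m₁ v₂ m₂ hne p hp a₁ a₂
  have hNpq : ∀ w ∈ N, w = p ∨ w = q := by
    obtain ⟨t, ht, htN⟩ := hother p hp
    have := (htN q hq).resolve_left hpq.symm
    subst this
    exact htN
  have hBv : ∀ v ∈ B, v = v₁ ∨ v = v₂ := by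
    intro v hv
    obtain ⟨r, hr, hry, a⟩ := hpart v hv
    by_contra h
    rw [not_or] at h
    rcases hNpq r hr with rfl | rfl
    · exact htwin v hv v₁ m₁ h.1 r hr a a₁
    · exact htwin v hv v₂ m₂ h.2 r hr a a₂
  have b₁ := (mB v₁).1 m₁
  have b₂ := (mB v₂).1 m₂
  have h12 : G.Adj v₁ v₂ := by
    refine hG.adj_of_attachments (F := [v₁, y, v₂]) (s := p) (t := q) (a := v₁) (b := v₂)
      (by simp [b₁.1.ne', b₂.1.ne, hne]) (by simp [b₁.1.symm, b₂.1]) rfl rfl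
      ((a₁ p).2 (Or.inr rfl)).symm (fun _ => ((a₂ q).2 (Or.inr rfl)).symm) ?_ (by simp) (by simp)
      hne
    intro f x hf hx hfx
    simp only [List.mem_cons, List.not_mem_nil, or_false, not_or] at hf hx
    rcases hf with rfl | rfl | rfl
    · exact Or.inl (((a₁ x).1 hfx).resolve_left hx.2.1)
    · by_cases hx2 : G.degree x = 2
      · rcases hBv x ((mB x).2 ⟨hfx, hx2⟩) with h | h
        · exact absurd h hx.1
        · exact absurd h hx.2.2
      · exact hNpq x ((mN x).2 ⟨hfx, hx2⟩)
    · exact Or.inr (((a₂ x).1 hfx).resolve_left hx.2.1)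
  exact h2 v₁ v₂ h12 ⟨b₁.2, b₂.2⟩

theorem three_mul_card_add_le (hG : MaxNontraceable G) (hn : 7 ≤ Fintype.card V)
    (h0 : ∀ v, G.degree v ≠ 0) (h1 : ∀ v, G.degree v ≠ 1)
    (h2 : ∀ u v, G.Adj u v → ¬ (G.degree u = 2 ∧ G.degree v = 2)) :
    3 * Fintype.card V + (Finset.univ.filter (G.degree · = 2)).card ≤ ∑ v, G.degree v := by
  set D := Finset.univ.filter (G.degree · = 2) with hD
  have hdc : ∑ y, ((G.neighborFinset y).filter (G.degree · = 2)).card = 2 * D.card := by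
    have h := Finset.sum_card_bipartiteAbove_eq_sum_card_bipartiteBelow
      (s := (Finset.univ : Finset V)) (t := D) G.Adj
    have e1 : ∀ y, (G.neighborFinset y).filter (G.degree · = 2) = D.bipartiteAbove G.Adj y := by
      intro y
      ext w
      simp [hD, Finset.mem_bipartiteAbove, and_comm]
    simp only [e1]
    rw [h, mul_comm, ← smul_eq_mul, ← Finset.sum_const]
    refine Finset.sum_congr rfl fun v hv => ?_
    have : Finset.univ.bipartiteBelow G.Adj v = G.neighborFinset v := by
      ext w
      simp [Finset.mem_bipartiteBelow, G.adj_comm]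
    rw [this, card_neighborFinset_eq_degree]
    simpa [hD] using hv
  have hle : ∀ y, 3 + ((G.neighborFinset y).filter (G.degree · = 2)).card ≤
      G.degree y + if G.degree y = 2 then 1 else 0 := by
    intro y
    split_ifs with hy
    · have : (G.neighborFinset y).filter (G.degree · = 2) = ∅ := by
        rw [Finset.filter_eq_empty_iff]
        intro w hw hw2
        exact h2 y w ((mem_neighborFinset ..).1 hw) ⟨hy, hw2⟩
      rw [this, hy, Finset.card_empty]
    · exact hG.three_add_card_le_degree hn h0 h1 h2 hy
  have hs := Finset.sum_le_sum fun y (_ : y ∈ Finset.univ) => hle y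
  rw [Finset.sum_add_distrib, Finset.sum_add_distrib, hdc, Finset.sum_const, ← Finset.card_filter,
    ← hD, Finset.card_univ, smul_eq_mul] at hs
  omega

end Degree

end MaxNontraceable

/-- A connected MNT graph of order n ≥ 7 with no vertex of degree 1, no two adjacent
vertices of degree 2, and m vertices of degree 2 has at least (3n + m)/2 edges. -/
theorem stmt_8 {V : Type*} [Fintype V] (G : SimpleGraph V)
    (hc : G.Connected) (hG : MaxNontraceable G)
    (hn : 7 ≤ Fintype.card V)
    (h1 : ∀ v : V, Nat.card (G.neighborSet v) ≠ 1)
    (h2 : ∀ u v : V, G.Adj u v →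
      ¬ (Nat.card (G.neighborSet u) = 2 ∧ Nat.card (G.neighborSet v) = 2)) :
    3 * Fintype.card V + {v : V | Nat.card (G.neighborSet v) = 2}.ncard ≤
      2 * Nat.card G.edgeSet := by
  classical
  have hdeg : ∀ v, Nat.card (G.neighborSet v) = G.degree v := fun v => by
    rw [Nat.card_eq_fintype_card, card_neighborSet_eq_degree]
  have : Nontrivial V := Fintype.one_lt_card_iff_nontrivial.1 (by omega)
  simp only [hdeg] at h1 h2 ⊢
  have hD : {v : V | G.degree v = 2}.ncard = (Finset.univ.filter (G.degree · = 2)).card := by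
    rw [← Set.ncard_coe_finset]
    simp
  rw [hD, Nat.card_eq_fintype_card, ← edgeFinset_card, ← sum_degrees_eq_twice_card_edges]
  exact hG.three_mul_card_add_le hn
    (fun v => (hc.preconnected.degree_pos_of_nontrivial v).ne') h1 h2
end

section
/- Every maximal nontraceable graph G of order n ≥ 10 has at least (3n − 2)/2 edges, i.e. 2·e(G) ≥ 3n − 2. -/
open SimpleGraph

section Sequences

variable {V : Type*} [Fintype V] {G : SimpleGraph V} {f : ℕ → V} {i : ℕ}

/-- `f 0, f 1, …, f (n - 1)` lists every vertex of a graph of order `n` exactly once. -/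
def IsListing (f : ℕ → V) : Prop :=
  ∀ s < Fintype.card V, ∀ t < Fintype.card V, f s = f t → s = t

/-- A listing whose consecutive terms are adjacent, except possibly at position `i`. -/
structure IsBrokenPath (G : SimpleGraph V) (f : ℕ → V) (i : ℕ) : Prop where
  inj : IsListing f
  adj : ∀ t, t + 1 < Fintype.card V → t ≠ i → G.Adj (f t) (f (t + 1))

theorem IsListing.surj (hf : IsListing f) (w : V) : ∃ t < Fintype.card V, f t = w := by
  have hinj : Function.Injective (fun t : Fin (Fintype.card V) => f t) :=
    fun s t h => Fin.ext (hf s s.2 t t.2 h)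
  obtain ⟨t, ht⟩ := ((Fintype.bijective_iff_injective_and_card _).2 ⟨hinj, by simp⟩).2 w
  exact ⟨t, t.2, ht⟩

omit [Fintype V] in
theorem exists_walk_of_adj (f : ℕ → V) (k : ℕ) (h : ∀ t < k, G.Adj (f t) (f (t + 1))) :
    ∃ p : G.Walk (f 0) (f k), p.support = (List.range (k + 1)).map f := by
  induction k with
  | zero => exact ⟨.nil, by simp⟩
  | succ k ih =>
    obtain ⟨p, hp⟩ := ih fun t ht => h t (by omega)
    refine ⟨p.concat (h k (by omega)), ?_⟩
    rw [SimpleGraph.Walk.support_concat, hp, List.range_succ (n := k + 1)]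
    simp

theorem traceable_of_listing [Nonempty V] (hf : IsListing f)
    (h : ∀ t, t + 1 < Fintype.card V → G.Adj (f t) (f (t + 1))) : Traceable G := by
  have hn : 0 < Fintype.card V := Fintype.card_pos
  obtain ⟨p, hp⟩ := exists_walk_of_adj (G := G) f (Fintype.card V - 1) fun t ht => h t (by omega)
  rw [Nat.sub_add_cancel hn] at hp
  refine ⟨_, _, p, ?_, fun w => ?_⟩
  · rw [SimpleGraph.Walk.isPath_def, hp]
    refine List.Nodup.map_on ?_ List.nodup_range
    intro s hs t ht
    exact hf s (List.mem_range.1 hs) t (List.mem_range.1 ht)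
  · obtain ⟨t, ht, rfl⟩ := hf.surj w
    rw [hp]
    exact List.mem_map_of_mem (List.mem_range.2 ht)

theorem Traceable.exists_listing (h : Traceable G) :
    ∃ f : ℕ → V, IsListing f ∧ ∀ t, t + 1 < Fintype.card V → G.Adj (f t) (f (t + 1)) := by
  classical
  obtain ⟨u, v, p, hp, hw⟩ := h
  have hlen : p.length + 1 = Fintype.card V := by
    rw [← SimpleGraph.Walk.length_support, ← List.toFinset_card_of_nodup hp.support_nodup]
    exact congrArg Finset.card (Finset.eq_univ_iff_forall.2 fun w => List.mem_toFinset.2 (hw w))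
  refine ⟨p.getVert, fun s hs t ht => ?_, fun t ht => p.adj_getVert_succ (by omega)⟩
  exact hp.getVert_injOn (show s ≤ _ by omega) (show t ≤ _ by omega)

theorem MaxNontraceable.not_listing (hG : MaxNontraceable G) [Nonempty V] (hf : IsListing f)
    (h : ∀ t, t + 1 < Fintype.card V → G.Adj (f t) (f (t + 1))) : False :=
  hG.1 (traceable_of_listing hf h)

theorem IsBrokenPath.reverse (h : IsBrokenPath G f i) (hi : i + 1 < Fintype.card V) :
    IsBrokenPath G (fun t => f (Fintype.card V - 1 - t)) (Fintype.card V - 1 - (i + 1)) := by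
  refine ⟨fun s hs t ht hst => ?_, fun t ht hti => ?_⟩
  · have := h.inj _ (by omega) _ (by omega) hst
    omega
  · have := h.adj (Fintype.card V - 1 - (t + 1)) (by omega) (by omega)
    rw [show Fintype.card V - 1 - (t + 1) + 1 = Fintype.card V - 1 - t by omega] at this
    exact this.symm

theorem MaxNontraceable.exists_brokenPath (hG : MaxNontraceable G) [Nonempty V] {y z : V}
    (hyz : y ≠ z) (h : ¬ G.Adj y z) :
    ∃ f i, IsBrokenPath G f i ∧ i + 1 < Fintype.card V ∧ f i = y ∧ f (i + 1) = z := by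
  obtain ⟨f, hf, hadj⟩ := (hG.2 y z hyz h).exists_listing
  simp only [SimpleGraph.sup_adj, SimpleGraph.edge_adj] at hadj
  obtain ⟨i, hi, hni⟩ : ∃ i, i + 1 < Fintype.card V ∧ ¬ G.Adj (f i) (f (i + 1)) := by
    by_contra! hc
    exact hG.not_listing hf hc
  have hi' := (hadj i hi).resolve_left hni
  have hbroken : IsBrokenPath G f i := by
    refine ⟨hf, fun t ht hti => (hadj t ht).resolve_right ?_⟩
    have h1 := hf t (by omega) i (by omega)
    have h2 := hf t (by omega) (i + 1) (by omega)
    have h3 := hf (t + 1) (by omega) i (by omega)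
    grind
  rcases hi' with ⟨⟨h1, h2⟩ | ⟨h1, h2⟩, -⟩
  · exact ⟨f, i, hbroken, hi, h1, h2⟩
  · refine ⟨_, _, hbroken.reverse hi, by omega, ?_, ?_⟩
    · simpa [show Fintype.card V - 1 - (Fintype.card V - 1 - (i + 1)) = i + 1 by omega] using h2
    · simpa [show Fintype.card V - 1 - (Fintype.card V - 1 - (i + 1) + 1) = i by omega] using h1

theorem IsBrokenPath.adj_pred (h : IsBrokenPath G f i) {t : ℕ} (ht : t < Fintype.card V)
    (h0 : t ≠ 0) (hi : t ≠ i + 1) : G.Adj (f t) (f (t - 1)) := by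
  have := h.adj (t - 1) (by omega) (by omega)
  rw [Nat.sub_add_cancel (by omega)] at this
  exact this.symm

end Sequences

section LowDegree

variable {V : Type*} [Fintype V] {G : SimpleGraph V} {f : ℕ → V} {i t a b c : ℕ}

theorem IsListing.comp (hf : IsListing f) {σ : ℕ → ℕ}
    (hlt : ∀ t < Fintype.card V, σ t < Fintype.card V)
    (hinj : ∀ s < Fintype.card V, ∀ t < Fintype.card V, σ s = σ t → s = t) :
    IsListing (f ∘ σ) :=
  fun s hs t ht h => hinj s hs t ht (hf _ (hlt s hs) _ (hlt t ht) h)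

theorem IsBrokenPath.position_of_two (hf : IsBrokenPath G f i) (ht : t < Fintype.card V)
    (ha : a < Fintype.card V) (hb : b < Fintype.card V)
    (hv : ∀ w, G.Adj (f t) w → w = f a ∨ w = f b) :
    (t ≠ 0 → t ≠ i + 1 → t - 1 = a ∨ t - 1 = b) ∧
      (t + 1 < Fintype.card V → t ≠ i → t + 1 = a ∨ t + 1 = b) :=
  ⟨fun h h' => (hv _ (hf.adj_pred ht h h')).imp (hf.inj _ (by omega) _ ha)
    (hf.inj _ (by omega) _ hb),
  fun h h' => (hv _ (hf.adj _ h h')).imp (hf.inj _ h _ ha) (hf.inj _ h _ hb)⟩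

theorem IsBrokenPath.position_of_three (hf : IsBrokenPath G f i) (ht : t < Fintype.card V)
    (ha : a < Fintype.card V) (hb : b < Fintype.card V) (hc : c < Fintype.card V)
    (hv : ∀ w, G.Adj (f t) w → w = f a ∨ w = f b ∨ w = f c) :
    (t ≠ 0 → t ≠ i + 1 → t - 1 = a ∨ t - 1 = b ∨ t - 1 = c) ∧
      (t + 1 < Fintype.card V → t ≠ i → t + 1 = a ∨ t + 1 = b ∨ t + 1 = c) :=
  ⟨fun h h' => (hv _ (hf.adj_pred ht h h')).imp (hf.inj _ (by omega) _ ha)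
    (Or.imp (hf.inj _ (by omega) _ hb) (hf.inj _ (by omega) _ hc)),
  fun h h' => (hv _ (hf.adj _ h h')).imp (hf.inj _ h _ ha)
    (Or.imp (hf.inj _ h _ hb) (hf.inj _ h _ hc))⟩

variable [Nonempty V]

theorem MaxNontraceable.adj_of_degree_two (hG : MaxNontraceable G) {v x y : V}
    (hxy : x ≠ y) (hvx : G.Adj v x) (hvy : G.Adj v y)
    (hv : ∀ w, G.Adj v w → w = x ∨ w = y) : G.Adj x y := by
  by_contra hadj
  obtain ⟨f, i, hf, hi, rfl, rfl⟩ := hG.exists_brokenPath hxy hadj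
  obtain ⟨t, ht, rfl⟩ := hf.inj.surj v
  have hpos := hf.position_of_two ht (by omega) hi hv
  have h3 : t ≠ i := by rintro rfl; exact G.irrefl hvx
  have h4 : t ≠ i + 1 := by rintro rfl; exact G.irrefl hvy
  refine hG.not_listing (hf.inj.comp
    (σ := fun s => if t = 0 then (if s = 0 then 1 else if s = 1 then 0 else s) else
      if s = i + 1 then i + 2 else if s = i + 2 then i + 1 else s) ?_ ?_) ?_
  · grind
  · grind
  · intro s hs
    have := hf.adj s hs
    have := hvx.symm
    have := hvy.symm
    simp only [Function.comp]
    grind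

theorem MaxNontraceable.not_degree_three_of_degree_two (hG : MaxNontraceable G) {v x y z : V}
    (hxy : x ≠ y) (hzv : z ≠ v) (hzy : z ≠ y) (hvx : G.Adj v x) (hvy : G.Adj v y)
    (hxz : G.Adj x z) (hv : ∀ w, G.Adj v w → w = x ∨ w = y)
    (hx : ∀ w, G.Adj x w → w = v ∨ w = y ∨ w = z) : False := by
  have hyx : G.Adj y x := (hG.adj_of_degree_two hxy hvx hvy hv).symm
  have hnadj : ¬ G.Adj v z := fun h => (hv z h).elim hxz.ne' hzy
  obtain ⟨f, i, hf, hi, rfl, rfl⟩ := hG.exists_brokenPath hzv.symm hnadj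
  obtain ⟨k, hk, rfl⟩ := hf.inj.surj x
  obtain ⟨j, hj, rfl⟩ := hf.inj.surj y
  have hposv := hf.position_of_two (by omega) hk hj hv
  have hposx := hf.position_of_three hk (by omega) hj hi hx
  have hki : k ≠ i := by rintro rfl; exact G.irrefl hvx
  have hkj : k ≠ j := by rintro rfl; exact hxy rfl
  have hji : j ≠ i := by rintro rfl; exact G.irrefl hvy
  have hkz : k ≠ i + 1 := by rintro rfl; exact G.irrefl hxz
  have hjz : j ≠ i + 1 := by rintro rfl; exact hzy rfl
  have hxv := hvx.symm
  have hyv := hvy.symm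
  have hzx := hxz.symm
  have hxy' := hyx.symm
  have hi0 : i = 0 ∨ k + 1 = i ∨ j + 1 = i := by
    have := hposv.1
    omega
  have hcases : (i = 0 ∧ k + 1 = Fintype.card V) ∨ (i = 0 ∧ k = 2 ∧ j = 3) ∨
      (k + 1 = i ∧ (k ≠ 0 → j + 1 = k)) ∨ (k = 0 ∧ j = 1 ∧ i = 2) ∨
      (j + 1 = i ∧ k = i + 2 ∧ k + 1 = Fintype.card V) := by
    obtain ⟨hpred, hsucc⟩ := hposx
    rcases hi0 with h | h | h
    · by_cases hlast : k + 1 = Fintype.card V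
      · exact Or.inl ⟨h, hlast⟩
      · refine Or.inr (Or.inl ?_)
        have := hpred (by omega) (by omega)
        have := hsucc (by omega) (by omega)
        omega
    · refine Or.inr (Or.inr (Or.inl ⟨h, fun hk0 => ?_⟩))
      have := hpred hk0 (by omega)
      omega
    · by_cases hlast : k + 1 = Fintype.card V
      · have := hpred (by omega) (by omega)
        omega
      · have := hsucc (by omega) (by omega)
        by_cases hk0 : k = 0
        · omega
        · have := hpred (by omega) (by omega)
          omega
  rcases hcases with h | h | h | h | h
  · refine hG.not_listing (hf.inj.comp
      (σ := fun s => if s + 1 = Fintype.card V then 0 else s + 1) ?_ ?_) ?_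
    · grind
    · grind
    · intro s hs
      have := hf.adj (s + 1)
      simp only [Function.comp]
      grind
  · refine hG.not_listing (hf.inj.comp
      (σ := fun s => if s = 0 then 1 else if s = 1 then 2 else if s = 2 then 0 else s) ?_ ?_) ?_
    · grind
    · grind
    · intro s hs
      have := hf.adj s
      simp only [Function.comp]
      grind
  · refine hG.not_listing (hf.inj.comp
      (σ := fun s => if s = k then i else if s = i then k else s) ?_ ?_) ?_
    · grind
    · grind
    · intro s hs
      have := hf.adj s
      simp only [Function.comp]
      grind
  · refine hG.not_listing (hf.inj.comp
      (σ := fun s => if s = 0 then 2 else if s = 2 then 0 else s) ?_ ?_) ?_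
    · grind
    · grind
    · intro s hs
      have := hf.adj s
      simp only [Function.comp]
      grind
  · refine hG.not_listing (hf.inj.comp
      (σ := fun s => if s = i + 1 then i + 2 else if s = i + 2 then i + 1 else s) ?_ ?_) ?_
    · grind
    · grind
    · intro s hs
      have := hf.adj s
      simp only [Function.comp]
      grind

end LowDegree

section Ends

variable {V : Type*} [Fintype V] {G : SimpleGraph V} {f : ℕ → V} {i : ℕ}
  {v v' x v₁ v₁' x₁ v₂ v₂' x₂ v₃ v₃' x₃ : V}

/-- `x` separates a pendant vertex `v = v'` or a pendant triangle `v v' x` from the rest of `G`. -/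
structure IsEnd (G : SimpleGraph V) (v v' x : V) : Prop where
  adj : G.Adj v x
  adj' : G.Adj v' x
  eq_or_adj : v = v' ∨ G.Adj v v'
  eq_of_adj : ∀ w, G.Adj v w → w = v' ∨ w = x
  eq_of_adj' : ∀ w, G.Adj v' w → w = v ∨ w = x

/-- The vertices `v, v'` and `w, w'` of two ends are distinct. -/
def EndsDisjoint (v v' w w' : V) : Prop := v ≠ w ∧ v ≠ w' ∧ v' ≠ w ∧ v' ≠ w'

theorem position_triangle {n a b c : ℕ} (hn : 5 ≤ n) (hab : a ≠ b) (hac : a ≠ c) (hbc : b ≠ c)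
    (ha : a < n) (hb : b < n) (hc : c < n)
    (hpa : a ≠ 0 → a - 1 = b ∨ a - 1 = c) (hsa : a + 1 < n → a + 1 = b ∨ a + 1 = c)
    (hpb : b ≠ 0 → b - 1 = a ∨ b - 1 = c) (hsb : b + 1 < n → b + 1 = a ∨ b + 1 = c) :
    c = 2 ∧ a + b = 1 ∨ c + 2 = n ∧ a = c + 1 ∧ b = c + 1 ∨
      c + 3 = n ∧ (a = c + 1 ∧ b = c + 2 ∨ a = c + 2 ∧ b = c + 1) := by
  have first : ∀ a b, a ≠ b → a ≠ c → b ≠ c → a = 0 → b < n →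
      (a + 1 < n → a + 1 = b ∨ a + 1 = c) → (b ≠ 0 → b - 1 = a ∨ b - 1 = c) →
      (b + 1 < n → b + 1 = a ∨ b + 1 = c) → c = 2 ∧ b = 1 := by
    intro a b hab hac hbc ha0 hb hsa hpb hsb
    have h1 := hsa (by omega)
    have h2 := hpb (by omega)
    by_cases hb1 : b + 1 < n
    · have h3 := hsb hb1
      clear hsa hpb hsb
      omega
    · clear hsa hpb hsb
      omega
  have last : ∀ a b, a ≠ b → a ≠ c → b ≠ c → a + 1 = n → b < n →
      (a ≠ 0 → a - 1 = b ∨ a - 1 = c) → (b ≠ 0 → b - 1 = a ∨ b - 1 = c) →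
      (b + 1 < n → b + 1 = a ∨ b + 1 = c) → c + 3 = n ∧ b = c + 1 := by
    intro a b hab hac hbc ha1 hb hpa hpb hsb
    have h1 := hpa (by omega)
    have h2 := hsb (by omega)
    by_cases hb0 : b = 0
    · clear hpa hpb hsb
      omega
    · have h3 := hpb hb0
      clear hpa hpb hsb
      omega
  by_cases ha0 : a = 0
  · have := first a b hab hac hbc ha0 hb hsa hpb hsb
    exact Or.inl (by omega)
  by_cases hb0 : b = 0
  · have := first b a hab.symm hbc hac hb0 ha hsb hpa hsa
    exact Or.inl (by omega)
  by_cases ha1 : a + 1 = n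
  · have := last a b hab hac hbc ha1 hb hpa hpb hsb
    exact Or.inr (Or.inr ⟨this.1, Or.inr (by omega)⟩)
  by_cases hb1 : b + 1 = n
  · have := last b a hab.symm hbc hac hb1 ha hpb hpa hsa
    exact Or.inr (Or.inr ⟨this.1, Or.inl (by omega)⟩)
  have h1 := hpa ha0
  have h2 := hsa (by omega)
  have h3 := hpb hb0
  have h4 := hsb (by omega)
  clear first last hpa hpb hsa hsb
  exfalso
  omega

theorem IsBrokenPath.position_end (hf : IsBrokenPath G f i) (h : IsEnd G v v' x)
    (hn : 5 ≤ Fintype.card V) (hi : i + 1 < Fintype.card V) (h1 : f i ≠ v) (h1' : f i ≠ v')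
    (h2 : f (i + 1) ≠ v) (h2' : f (i + 1) ≠ v') :
    ∃ a < Fintype.card V, ∃ b < Fintype.card V, ∃ c < Fintype.card V,
      f a = v ∧ f b = v' ∧ f c = x ∧
      (c = 1 ∧ a = 0 ∧ b = 0 ∨ c = 2 ∧ a + b = 1 ∨
        c + 2 = Fintype.card V ∧ a = c + 1 ∧ b = c + 1 ∨
        c + 3 = Fintype.card V ∧ (a = c + 1 ∧ b = c + 2 ∨ a = c + 2 ∧ b = c + 1)) := by
  obtain ⟨a, ha, rfl⟩ := hf.inj.surj v
  obtain ⟨b, hb, rfl⟩ := hf.inj.surj v'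
  obtain ⟨c, hc, rfl⟩ := hf.inj.surj x
  refine ⟨a, ha, b, hb, c, hc, rfl, rfl, rfl, ?_⟩
  have h3 := hf.position_of_two ha hb hc h.eq_of_adj
  have h4 := hf.position_of_two hb ha hc h.eq_of_adj'
  have hac : a ≠ c := by rintro rfl; exact G.irrefl h.adj
  have hbc : b ≠ c := by rintro rfl; exact G.irrefl h.adj'
  have hai : a ≠ i := by rintro rfl; exact h1 rfl
  have hbi : b ≠ i := by rintro rfl; exact h1' rfl
  have hai' : a ≠ i + 1 := by rintro rfl; exact h2 rfl
  have hbi' : b ≠ i + 1 := by rintro rfl; exact h2' rfl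
  simp only [hai, hbi, hai', hbi', ne_eq, not_false_eq_true, true_imp_iff] at h3 h4
  clear h1 h2 h1' h2' hai hbi hai' hbi' hi
  by_cases hab : a = b
  · subst hab
    omega
  · exact Or.inr (position_triangle hn hab hac hbc ha hb hc h3.1 h3.2 h4.1 h4.2)

variable [Nonempty V]

theorem MaxNontraceable.adj_of_closed (hG : MaxNontraceable G) {C : Set V}
    (hC : ∀ a b, G.Adj a b → (a ∈ C ↔ b ∈ C)) (hne : C.Nonempty) {y z : V} (hy : y ∉ C)
    (hz : z ∉ C) (hyz : y ≠ z) : G.Adj y z := by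
  by_contra h
  obtain ⟨f, i, hf, hi, rfl, rfl⟩ := hG.exists_brokenPath hyz h
  have hconst : ∀ t < Fintype.card V, (f t ∈ C ↔ f 0 ∈ C) := by
    intro t
    induction t with
    | zero => simp
    | succ t ih =>
      intro ht
      rw [← ih (by omega)]
      by_cases hti : t = i
      · subst hti
        simp [hy, hz]
      · exact (hC _ _ (hf.adj t ht hti)).symm
  obtain ⟨w, hw⟩ := hne
  obtain ⟨t, ht, rfl⟩ := hf.inj.surj w
  exact hy ((hconst i (by omega)).2 ((hconst t ht).1 hw))

theorem MaxNontraceable.adj_of_three_twins (hG : MaxNontraceable G) (hn : 6 ≤ Fintype.card V)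
    {u₁ u₂ u₃ x y z w : V} (h12 : u₁ ≠ u₂) (h13 : u₁ ≠ u₃) (h23 : u₂ ≠ u₃)
    (h1 : ∀ w, G.Adj u₁ w → w = x ∨ w = y) (h2 : ∀ w, G.Adj u₂ w → w = x ∨ w = y)
    (h3 : ∀ w, G.Adj u₃ w → w = x ∨ w = y)
    (hz : z ≠ u₁ ∧ z ≠ u₂ ∧ z ≠ u₃) (hw : w ≠ u₁ ∧ w ≠ u₂ ∧ w ≠ u₃) (hzw : z ≠ w) :
    G.Adj z w := by
  by_contra h
  obtain ⟨f, i, hf, hi, rfl, rfl⟩ := hG.exists_brokenPath hzw h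
  obtain ⟨a, ha, rfl⟩ := hf.inj.surj u₁
  obtain ⟨b, hb, rfl⟩ := hf.inj.surj u₂
  obtain ⟨c, hc, rfl⟩ := hf.inj.surj u₃
  obtain ⟨j, hj, rfl⟩ := hf.inj.surj x
  obtain ⟨k, hk, rfl⟩ := hf.inj.surj y
  have h1 := hf.position_of_two ha hj hk h1
  have h2 := hf.position_of_two hb hj hk h2
  have h3 := hf.position_of_two hc hj hk h3
  have hab : a ≠ b := by rintro rfl; exact h12 rfl
  have hac : a ≠ c := by rintro rfl; exact h13 rfl
  have hbc : b ≠ c := by rintro rfl; exact h23 rfl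
  have : a ≠ i ∧ b ≠ i ∧ c ≠ i := by
    refine ⟨?_, ?_, ?_⟩ <;> rintro rfl <;> simp at hz
  have : a ≠ i + 1 ∧ b ≠ i + 1 ∧ c ≠ i + 1 := by
    refine ⟨?_, ?_, ?_⟩ <;> rintro rfl <;> simp at hw
  simp_all only [ne_eq, not_false_eq_true, true_imp_iff]
  clear hf hz hw h hzw
  by_cases ha0 : a = 0 ∨ a + 1 = Fintype.card V
  · by_cases hb0 : b = 0 ∨ b + 1 = Fintype.card V
    · omega
    · have := h2.1 (by omega)
      have := h2.2 (by omega)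
      omega
  · have := h1.1 (by omega)
    have := h1.2 (by omega)
    omega

theorem MaxNontraceable.adj_of_two_ends (hG : MaxNontraceable G) (hn : 7 ≤ Fintype.card V)
    (h1 : IsEnd G v₁ v₁' x) (h2 : IsEnd G v₂ v₂' x) (h12 : EndsDisjoint v₁ v₁' v₂ v₂') {y z : V}
    (hy : y ≠ v₁ ∧ y ≠ v₁' ∧ y ≠ v₂ ∧ y ≠ v₂') (hz : z ≠ v₁ ∧ z ≠ v₁' ∧ z ≠ v₂ ∧ z ≠ v₂')
    (hyz : y ≠ z) : G.Adj y z := by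
  by_contra h
  obtain ⟨f, i, hf, hi, rfl, rfl⟩ := hG.exists_brokenPath hyz h
  obtain ⟨a, ha, b, hb, c, hc, rfl, rfl, rfl, hpos⟩ :=
    hf.position_end h1 (by omega) hi hy.1 hy.2.1 hz.1 hz.2.1
  obtain ⟨a', ha', b', hb', c', hc', rfl, rfl, hcc, hpos'⟩ :=
    hf.position_end h2 (by omega) hi hy.2.2.1 hy.2.2.2 hz.2.2.1 hz.2.2.2
  have := hf.inj _ hc' _ hc hcc
  have : a ≠ a' := by rintro rfl; exact h12.1 rfl
  have : a ≠ b' := by rintro rfl; exact h12.2.1 rfl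
  have : b ≠ a' := by rintro rfl; exact h12.2.2.1 rfl
  omega

theorem MaxNontraceable.adj_of_three_ends (hG : MaxNontraceable G) (hn : 7 ≤ Fintype.card V)
    (h1 : IsEnd G v₁ v₁' x₁) (h2 : IsEnd G v₂ v₂' x₂) (h3 : IsEnd G v₃ v₃' x₃)
    (h12 : EndsDisjoint v₁ v₁' v₂ v₂') (h13 : EndsDisjoint v₁ v₁' v₃ v₃')
    (h23 : EndsDisjoint v₂ v₂' v₃ v₃') {y z : V}
    (hy : y ≠ v₁ ∧ y ≠ v₁' ∧ y ≠ v₂ ∧ y ≠ v₂' ∧ y ≠ v₃ ∧ y ≠ v₃')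
    (hz : z ≠ v₁ ∧ z ≠ v₁' ∧ z ≠ v₂ ∧ z ≠ v₂' ∧ z ≠ v₃ ∧ z ≠ v₃')
    (hyz : y ≠ z) : G.Adj y z := by
  by_contra h
  obtain ⟨f, i, hf, hi, rfl, rfl⟩ := hG.exists_brokenPath hyz h
  have key : ∀ {v v' x : V}, IsEnd G v v' x → f i ≠ v → f i ≠ v' → f (i + 1) ≠ v →
      f (i + 1) ≠ v' → (f 0 = v ∨ f 0 = v') ∨
        (f (Fintype.card V - 1) = v ∨ f (Fintype.card V - 1) = v') := by
    intro v v' x hv hy1 hy2 hz1 hz2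
    obtain ⟨a, ha, b, hb, c, hc, rfl, rfl, rfl, hpos⟩ :=
      hf.position_end hv (by omega) hi hy1 hy2 hz1 hz2
    have : a = 0 ∨ b = 0 ∨ Fintype.card V - 1 = a ∨ Fintype.card V - 1 = b := by omega
    rcases this with h | h | h | h <;> simp [h]
  have k1 := key h1 hy.1 hy.2.1 hz.1 hz.2.1
  have k2 := key h2 hy.2.2.1 hy.2.2.2.1 hz.2.2.1 hz.2.2.2.1
  have k3 := key h3 hy.2.2.2.2.1 hy.2.2.2.2.2 hz.2.2.2.2.1 hz.2.2.2.2.2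
  unfold EndsDisjoint at *
  grind

end Ends

section EndPairs

variable {V : Type*} [Fintype V] {G : SimpleGraph V}
  {v v' x v₁ v₁' x₁ v₂ v₂' x₂ a u u' w y z : V}

/-- Two ends at different vertices, such that the graph induced on the remaining vertices does not
become complete by deleting a vertex. -/
structure IsEndPair (G : SimpleGraph V) (v₁ v₁' x₁ v₂ v₂' x₂ : V) : Prop where
  left : IsEnd G v₁ v₁' x₁
  right : IsEnd G v₂ v₂' x₂
  disjoint : EndsDisjoint v₁ v₁' v₂ v₂'
  ne : x₁ ≠ x₂
  left_ne : x₁ ≠ v₂ ∧ x₁ ≠ v₂'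
  right_ne : x₂ ≠ v₁ ∧ x₂ ≠ v₁'
  exists_not_adj : ∀ w, ∃ y z, EndsDisjoint v₁ v₁' y z ∧ EndsDisjoint v₂ v₂' y z ∧
    y ≠ w ∧ z ≠ w ∧ y ≠ z ∧ ¬ G.Adj y z

omit [Fintype V] in
theorem EndsDisjoint.symm (h : EndsDisjoint v₁ v₁' v₂ v₂') : EndsDisjoint v₂ v₂' v₁ v₁' :=
  ⟨h.1.symm, h.2.2.1.symm, h.2.1.symm, h.2.2.2.symm⟩

omit [Fintype V] in
theorem IsEndPair.symm (h : IsEndPair G v₁ v₁' x₁ v₂ v₂' x₂) :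
    IsEndPair G v₂ v₂' x₂ v₁ v₁' x₁ where
  left := h.right
  right := h.left
  disjoint := h.disjoint.symm
  ne := h.ne.symm
  left_ne := h.right_ne
  right_ne := h.left_ne
  exists_not_adj w := by
    obtain ⟨y, z, h1, h2, h3⟩ := h.exists_not_adj w
    exact ⟨y, z, h2, h1, h3⟩

/-- A broken path that traverses the first end, then the vertices outside both ends from `f p = x₁`
to `f q = x₂`, then the second end. -/
structure IsBrokenPath.Spans (f : ℕ → V) (i p q : ℕ) (G : SimpleGraph V)
    (v₁ v₁' x₁ v₂ v₂' x₂ : V) : Prop extends IsBrokenPath G f i where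
  hi : i + 1 < Fintype.card V
  lt : p + 5 ≤ q
  hq : q < Fintype.card V
  left : f p = x₁
  right : f q = x₂
  mem : ∀ t < Fintype.card V,
    (p ≤ t ∧ t ≤ q ↔ f t ≠ v₁ ∧ f t ≠ v₁' ∧ f t ≠ v₂ ∧ f t ≠ v₂')

theorem IsEndPair.exists_spans_of_left (hn : 10 ≤ Fintype.card V)
    (h : IsEndPair G v₁ v₁' x₁ v₂ v₂' x₂) {f : ℕ → V} {i : ℕ} (hf : IsBrokenPath G f i)
    (hi : i + 1 < Fintype.card V) (h1 : EndsDisjoint v₁ v₁' (f i) (f (i + 1)))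
    (h2 : EndsDisjoint v₂ v₂' (f i) (f (i + 1))) (h0 : f 0 = v₁ ∨ f 0 = v₁') :
    ∃ p q, IsBrokenPath.Spans f i p q G v₁ v₁' x₁ v₂ v₂' x₂ := by
  have hn0 : 0 < Fintype.card V := by omega
  obtain ⟨a, ha, b, hb, c, hc, hfa, hfb, hfc, hpos⟩ :=
    hf.position_end h.left (by omega) hi h1.1.symm h1.2.2.1.symm h1.2.1.symm h1.2.2.2.symm
  obtain ⟨a', ha', b', hb', c', hc', hfa', hfb', hfc', hpos'⟩ :=
    hf.position_end h.right (by omega) hi h2.1.symm h2.2.2.1.symm h2.2.1.symm h2.2.2.2.symm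
  have hd1 : a ≠ a' := by rintro rfl; exact h.disjoint.1 (hfa.symm.trans hfa')
  have hd2 : a ≠ b' := by rintro rfl; exact h.disjoint.2.1 (hfa.symm.trans hfb')
  have hd3 : b ≠ a' := by rintro rfl; exact h.disjoint.2.2.1 (hfb.symm.trans hfa')
  have hd4 : b ≠ b' := by rintro rfl; exact h.disjoint.2.2.2 (hfb.symm.trans hfb')
  have hz : a = 0 ∨ b = 0 := by
    rcases h0 with h0 | h0
    · exact Or.inl (hf.inj _ ha _ hn0 (hfa.trans h0.symm))
    · exact Or.inr (hf.inj _ hb _ hn0 (hfb.trans h0.symm))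
  have hpos : c = 1 ∧ a = 0 ∧ b = 0 ∨ c = 2 ∧ a + b = 1 := by omega
  have hpos' : c' + 2 = Fintype.card V ∧ a' = c' + 1 ∧ b' = c' + 1 ∨
      c' + 3 = Fintype.card V ∧ (a' = c' + 1 ∧ b' = c' + 2 ∨ a' = c' + 2 ∧ b' = c' + 1) := by
    omega
  refine ⟨c, c', hf, hi, by omega, hc', hfc, hfc', fun t ht => ?_⟩
  have e : ∀ s < Fintype.card V, (f t = f s ↔ t = s) :=
    fun s hs => ⟨hf.inj _ ht _ hs, fun h => h ▸ rfl⟩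
  rw [← hfa, ← hfb, ← hfa', ← hfb', ne_eq, ne_eq, ne_eq, ne_eq, e _ ha, e _ hb, e _ ha', e _ hb']
  clear h0 hz e hd1 hd2 hd3 hd4
  rcases hpos with h | h <;> rcases hpos' with h' | h' <;> omega

theorem IsEndPair.exists_spans [Nonempty V] (hn : 10 ≤ Fintype.card V) (hG : MaxNontraceable G)
    (h : IsEndPair G v₁ v₁' x₁ v₂ v₂' x₂)
    (h1 : EndsDisjoint v₁ v₁' y z) (h2 : EndsDisjoint v₂ v₂' y z) (hyz : y ≠ z)
    (hadj : ¬ G.Adj y z) :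
    ∃ f i p q, IsBrokenPath.Spans f i p q G v₁ v₁' x₁ v₂ v₂' x₂ ∧
      (f i = y ∧ f (i + 1) = z ∨ f i = z ∧ f (i + 1) = y) := by
  obtain ⟨f, i, hf, hi, hfy, hfz⟩ := hG.exists_brokenPath hyz hadj
  by_cases h0 : f 0 = v₁ ∨ f 0 = v₁'
  · subst hfy hfz
    obtain ⟨p, q, hpq⟩ := h.exists_spans_of_left hn hf hi h1 h2 h0
    exact ⟨f, i, p, q, hpq, Or.inl ⟨rfl, rfl⟩⟩
  · have hend : f (Fintype.card V - 1) = v₁ ∨ f (Fintype.card V - 1) = v₁' := by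
      subst hfy hfz
      obtain ⟨a, ha, b, hb, c, hc, rfl, rfl, hfc, hpos⟩ :=
        hf.position_end h.left (by omega) hi h1.1.symm h1.2.2.1.symm h1.2.1.symm h1.2.2.2.symm
      have : a ≠ 0 := by rintro rfl; exact h0 (Or.inl rfl)
      have : b ≠ 0 := by rintro rfl; exact h0 (Or.inr rfl)
      have : Fintype.card V - 1 = a ∨ Fintype.card V - 1 = b := by omega
      exact this.imp (congrArg f) (congrArg f)
    have hg := hf.reverse hi
    have hgz : f (Fintype.card V - 1 - (Fintype.card V - 1 - (i + 1))) = z := by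
      rw [← hfz]
      congr 1
      omega
    have hgy : f (Fintype.card V - 1 - (Fintype.card V - 1 - (i + 1) + 1)) = y := by
      rw [← hfy]
      congr 1
      omega
    have flip : ∀ {v v' : V}, EndsDisjoint v v' y z → EndsDisjoint v v' z y :=
      fun h => ⟨h.2.1, h.1, h.2.2.2, h.2.2.1⟩
    obtain ⟨p, q, hpq⟩ := h.exists_spans_of_left hn hg (by omega)
      (by rw [hgz, hgy]; exact flip h1) (by rw [hgz, hgy]; exact flip h2) hend
    exact ⟨_, _, p, q, hpq, Or.inr ⟨hgz, hgy⟩⟩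

theorem IsBrokenPath.Spans.exists_position {f : ℕ → V} {i p q : ℕ}
    (h : IsBrokenPath.Spans f i p q G v₁ v₁' x₁ v₂ v₂' x₂)
    (hw : w ≠ v₁ ∧ w ≠ v₁' ∧ w ≠ v₂ ∧ w ≠ v₂') :
    ∃ t < Fintype.card V, p ≤ t ∧ t ≤ q ∧ f t = w := by
  obtain ⟨t, ht, rfl⟩ := h.inj.surj w
  have := (h.mem t ht).2 hw
  exact ⟨t, ht, this.1, this.2, rfl⟩

variable [Nonempty V]

theorem IsEndPair.exists_adj_left (hn : 10 ≤ Fintype.card V) (hG : MaxNontraceable G)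
    (h : IsEndPair G v₁ v₁' x₁ v₂ v₂' x₂) :
    ∃ w, (w ≠ v₁ ∧ w ≠ v₁' ∧ w ≠ v₂ ∧ w ≠ v₂') ∧ w ≠ x₂ ∧ G.Adj x₁ w := by
  obtain ⟨y, z, h1, h2, hy, hz, hyz, hadj⟩ := h.exists_not_adj x₁
  obtain ⟨f, i, p, q, hf, hfi⟩ := h.exists_spans hn hG h1 h2 hyz hadj
  have hlt := hf.lt
  have hq := hf.hq
  have hpi : p ≠ i := by
    rintro rfl
    have := hf.left
    grind
  refine ⟨f (p + 1), (hf.mem _ (by omega)).1 (by omega), ?_, ?_⟩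
  · rw [← hf.right]
    intro h
    have := hf.inj _ (by omega) _ hq h
    omega
  · rw [← hf.left]
    exact hf.adj p (by omega) hpi

theorem IsEndPair.not_degree_two (hn : 10 ≤ Fintype.card V) (hG : MaxNontraceable G)
    (h : IsEndPair G v₁ v₁' x₁ v₂ v₂' x₂) (hu : u ≠ v₁ ∧ u ≠ v₁' ∧ u ≠ v₂ ∧ u ≠ v₂')
    (h1 : u ≠ x₁) (h2 : u ≠ x₂) (hadj : ∀ w, G.Adj u w → w = x₁ ∨ w = x₂) : False := by
  obtain ⟨y, z, h3, h4, hy, hz, hyz, hnadj⟩ := h.exists_not_adj u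
  obtain ⟨f, i, p, q, hf, hfi⟩ := h.exists_spans hn hG h3 h4 hyz hnadj
  obtain ⟨t, ht, hpt, htq, rfl⟩ := hf.exists_position hu
  have hlt := hf.lt
  have hq := hf.hq
  rw [← hf.left, ← hf.right] at hadj
  have hpos := hf.position_of_two ht (by omega) hq hadj
  have : t ≠ i ∧ t ≠ i + 1 := by
    constructor <;> rintro rfl <;> grind
  have : t ≠ p := by rintro rfl; exact h1 hf.left
  have : t ≠ q := by rintro rfl; exact h2 hf.right
  omega

theorem IsEndPair.not_degree_two_of_adj (hn : 10 ≤ Fintype.card V) (hG : MaxNontraceable G)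
    (h : IsEndPair G v₁ v₁' x₁ v₂ v₂' x₂) (hu : u ≠ v₁ ∧ u ≠ v₁' ∧ u ≠ v₂ ∧ u ≠ v₂')
    (h1 : u ≠ x₁) (h2 : u ≠ x₂) (hw : w ≠ x₂) (hu' : ∀ z, G.Adj u z → z = x₁ ∨ z = w)
    (hx : ∀ z, G.Adj x₁ z → z = v₁ ∨ z = v₁' ∨ z = x₂ ∨ z = u ∨ z = w) : False := by
  have hnadj : ¬ G.Adj u x₂ := fun hadj => (hu' _ hadj).elim h.ne.symm hw.symm
  obtain ⟨f, i, p, q, hf, hfi⟩ := h.exists_spans hn hG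
    ⟨hu.1.symm, h.right_ne.1.symm, hu.2.1.symm, h.right_ne.2.symm⟩
    ⟨hu.2.2.1.symm, h.right.adj.ne, hu.2.2.2.symm, h.right.adj'.ne⟩ h2 hnadj
  obtain ⟨t, ht, hpt, htq, rfl⟩ := hf.exists_position hu
  have hlt := hf.lt
  have hq := hf.hq
  have hi := hf.hi
  have htq' : t ≠ q := by rintro rfl; exact h2 hf.right
  rw [← hf.right] at hfi hx
  rw [← hf.left] at hx hu'
  have hi' : i = t ∧ t + 1 = q := by
    rcases hfi with ⟨h3, h4⟩ | ⟨h3, h4⟩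
    · have := hf.inj _ (by omega) _ ht h3
      have := hf.inj _ (by omega) _ hq h4
      omega
    · have := hf.inj _ (by omega) _ hq h3
      have := hf.inj _ (by omega) _ ht h4
      omega
  have hprev : f (t - 1) = w := by
    refine (hu' _ (hf.adj_pred ht (by omega) (by omega))).resolve_left fun h => ?_
    have := hf.inj _ (by omega) _ (by omega) h
    omega
  have hmem := (hf.mem (p + 1) (by omega)).1 (by omega)
  rw [← hprev] at hx
  rcases hx _ (hf.adj p (by omega) (by omega)) with h | h | h | h | h
  · exact hmem.1 h
  · exact hmem.2.1 h
  all_goals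
    have := hf.inj _ (by omega) _ (by omega) h
    omega

omit [Nonempty V] in
theorem IsBrokenPath.Spans.succ_eq {f : ℕ → V} {i p q : ℕ}
    (hf : IsBrokenPath.Spans f i p q G v₁ v₁' x₁ v₂ v₂' x₂)
    (hx : ∀ z, G.Adj x₁ z → z = v₁ ∨ z = v₁' ∨ z = x₂ ∨ z = a) (hi : p ≠ i) :
    f (p + 1) = a := by
  have hlt := hf.lt
  have hq := hf.hq
  have hmem := (hf.mem (p + 1) (by omega)).1 (by omega)
  rw [← hf.left, ← hf.right] at hx
  rcases hx _ (hf.adj p (by omega) (by omega)) with h | h | h | h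
  · exact absurd h hmem.1
  · exact absurd h hmem.2.1
  · have := hf.inj _ (by omega) _ (by omega) h
    omega
  · exact h

theorem IsEndPair.adj_right (hn : 10 ≤ Fintype.card V) (hG : MaxNontraceable G)
    (h : IsEndPair G v₁ v₁' x₁ v₂ v₂' x₂) (ha : a ≠ v₁ ∧ a ≠ v₁' ∧ a ≠ v₂ ∧ a ≠ v₂')
    (h1 : a ≠ x₁) (h2 : a ≠ x₂)
    (hx : ∀ z, G.Adj x₁ z → z = v₁ ∨ z = v₁' ∨ z = x₂ ∨ z = a) : G.Adj a x₂ := by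
  by_contra hnadj
  obtain ⟨f, i, p, q, hf, hfi⟩ := h.exists_spans hn hG
    ⟨ha.1.symm, h.right_ne.1.symm, ha.2.1.symm, h.right_ne.2.symm⟩
    ⟨ha.2.2.1.symm, h.right.adj.ne, ha.2.2.2.symm, h.right.adj'.ne⟩ h2 hnadj
  have hlt := hf.lt
  have hq := hf.hq
  have hi := hf.hi
  have hne := h.ne
  have hpi : p ≠ i := by
    rintro rfl
    have := hf.left
    grind
  have hpa := hf.succ_eq hx hpi
  have h3 := hf.inj (p + 1) (by omega)
  have h4 := hf.inj q hq
  have h5 := hf.right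
  rcases hfi with ⟨h6, h7⟩ | ⟨h6, h7⟩
  · have := h3 i (by omega) (hpa.trans h6.symm)
    have := h4 (i + 1) (by omega) (h5.trans h7.symm)
    omega
  · have := h3 (i + 1) (by omega) (hpa.trans h7.symm)
    have := h4 i (by omega) (h5.trans h6.symm)
    omega

theorem IsEndPair.exists_adj_right (hn : 10 ≤ Fintype.card V) (hG : MaxNontraceable G)
    (h : IsEndPair G v₁ v₁' x₁ v₂ v₂' x₂)
    (hx : ∀ z, G.Adj x₁ z → z = v₁ ∨ z = v₁' ∨ z = x₂ ∨ z = a)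
    (h1 : EndsDisjoint v₁ v₁' y z) (h2 : EndsDisjoint v₂ v₂' y z) (h12 : EndsDisjoint x₁ x₂ y z)
    (hyz : y ≠ z) (hadj : ¬ G.Adj y z) :
    ∃ s, (s ≠ v₁ ∧ s ≠ v₁' ∧ s ≠ v₂ ∧ s ≠ v₂') ∧ s ≠ x₁ ∧ s ≠ a ∧ G.Adj x₂ s := by
  obtain ⟨f, i, p, q, hf, hfi⟩ := h.exists_spans hn hG h1 h2 hyz hadj
  have hlt := hf.lt
  have hq := hf.hq
  have hleft := hf.left
  have hright := hf.right
  have hpi : p ≠ i := by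
    rintro rfl
    unfold EndsDisjoint at h12
    grind
  have hqi : q ≠ i + 1 := by
    rintro rfl
    unfold EndsDisjoint at h12
    grind
  refine ⟨f (q - 1), (hf.mem _ (by omega)).1 (by omega), ?_, ?_, ?_⟩
  · rw [← hleft]
    intro h
    have := hf.inj _ (by omega) _ (by omega) h
    omega
  · rw [← hf.succ_eq hx hpi]
    intro h
    have := hf.inj _ (by omega) _ (by omega) h
    omega
  · rw [← hright]
    exact hf.adj_pred hq (by omega) hqi

theorem IsEndPair.not_degree_three (hn : 10 ≤ Fintype.card V) (hG : MaxNontraceable G)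
    (h : IsEndPair G v₁ v₁' x₁ v₂ v₂' x₂) (ha : a ≠ v₁ ∧ a ≠ v₁' ∧ a ≠ v₂ ∧ a ≠ v₂')
    (h1 : G.Adj x₁ a) (h2 : G.Adj a x₂) (hs : y ≠ v₁ ∧ y ≠ v₁' ∧ y ≠ v₂ ∧ y ≠ v₂')
    (hs1 : y ≠ x₁) (hsa : y ≠ a) (hs2 : G.Adj x₂ y)
    (hx : ∀ z, G.Adj x₁ z → z = v₁ ∨ z = v₁' ∨ z = x₂ ∨ z = a)
    (ha' : ∀ z, G.Adj a z → z = x₁ ∨ z = x₂ ∨ z = w) : False := by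
  have hnadj : ¬ G.Adj x₁ y := fun hadj => by
    have := hs2.ne'
    grind
  obtain ⟨f, i, p, q, hf, hfi⟩ := h.exists_spans hn hG
    ⟨h.left.adj.ne, hs.1.symm, h.left.adj'.ne, hs.2.1.symm⟩
    ⟨h.left_ne.1.symm, hs.2.2.1.symm, h.left_ne.2.symm, hs.2.2.2.symm⟩ hs1.symm hnadj
  obtain ⟨b, hb, hpb, hbq, rfl⟩ := hf.exists_position ha
  obtain ⟨t, ht, hpt, htq, rfl⟩ := hf.exists_position hs
  obtain ⟨c, hc, rfl⟩ := hf.inj.surj w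
  have hlt := hf.lt
  have hq := hf.hq
  have hi := hf.hi
  rw [← hf.left] at ha' h1 hfi hs1
  rw [← hf.right] at ha' h2 hs2
  have hpos := hf.position_of_three hb (by omega) hq hc ha'
  have htp : t ≠ p := by rintro rfl; exact hs1 rfl
  have htb : t ≠ b := by rintro rfl; exact hsa rfl
  have hbp : b ≠ p := by rintro rfl; exact G.irrefl h1
  have hbq' : b ≠ q := by rintro rfl; exact G.irrefl h2
  have hit : i = p ∧ t = p + 1 := by
    rcases hfi with ⟨h3, h4⟩ | ⟨h3, h4⟩
    · have := hf.inj _ (by omega) _ (by omega) h3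
      have := hf.inj _ (by omega) _ ht h4
      omega
    · have := hf.inj _ (by omega) _ ht h3
      have := hf.inj _ (by omega) _ (by omega) h4
      omega
  have hbq : b + 1 = q := by omega
  refine hG.not_listing (hf.inj.comp
    (σ := fun s => if p < s ∧ s < q then p + q - s else s) ?_ ?_) fun s hs => ?_
  · grind
  · grind
  · have h3 := hf.adj (p + q - (s + 1))
    have h4 := hf.adj s hs
    have h5 := hs2.symm
    simp only [Function.comp]
    by_cases hsp : s = p
    · subst hsp
      rw [if_neg (by omega), if_pos (by omega), show s + q - (s + 1) = b by omega]
      exact h1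
    · by_cases hsq : s + 1 = q
      · rw [if_pos (by omega), if_neg (by omega), hsq, show p + q - s = t by omega]
        exact h5
      · by_cases hsm : p < s ∧ s < q
        · rw [if_pos (by omega), if_pos (by omega)]
          rw [show p + q - (s + 1) + 1 = p + q - s by omega] at h3
          exact (h3 (by omega) (by omega)).symm
        · rw [if_neg (by omega), if_neg (by omega)]
          exact h4 (by omega)

theorem IsEndPair.not_twins (hn : 10 ≤ Fintype.card V) (hG : MaxNontraceable G)
    (h : IsEndPair G v₁ v₁' x₁ v₂ v₂' x₂)
    (hu : u ≠ v₁ ∧ u ≠ v₁' ∧ u ≠ v₂ ∧ u ≠ v₂') (hu' : u' ≠ v₁ ∧ u' ≠ v₁' ∧ u' ≠ v₂ ∧ u' ≠ v₂')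
    (h1 : u ≠ x₁) (h1' : u' ≠ x₁) (hne : u ≠ u') (hnadj : ¬ G.Adj u u')
    (hx : ∀ z, G.Adj x₁ z → z = v₁ ∨ z = v₁' ∨ z = x₂ ∨ z = a)
    (h2 : ∀ z, G.Adj u z → z = a ∨ z = x₂) (h2' : ∀ z, G.Adj u' z → z = a ∨ z = x₂) : False := by
  obtain ⟨f, i, p, q, hf, hfi⟩ := h.exists_spans hn hG
    ⟨hu.1.symm, hu'.1.symm, hu.2.1.symm, hu'.2.1.symm⟩
    ⟨hu.2.2.1.symm, hu'.2.2.1.symm, hu.2.2.2.symm, hu'.2.2.2.symm⟩ hne hnadj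
  have hlt := hf.lt
  have hq := hf.hq
  have hi := hf.hi
  have hpi : p ≠ i := by
    rintro rfl
    have := hf.left
    grind
  have hpi' : p ≠ i + 1 := by
    rintro rfl
    have := hf.left
    grind
  obtain ⟨h3, h4, h5, h6⟩ : (∀ z, G.Adj (f i) z → z = a ∨ z = x₂) ∧
      (∀ z, G.Adj (f (i + 1)) z → z = a ∨ z = x₂) ∧
      (f i ≠ v₁ ∧ f i ≠ v₁' ∧ f i ≠ v₂ ∧ f i ≠ v₂') ∧
      (f (i + 1) ≠ v₁ ∧ f (i + 1) ≠ v₁' ∧ f (i + 1) ≠ v₂ ∧ f (i + 1) ≠ v₂') := by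
    rcases hfi with ⟨rfl, rfl⟩ | ⟨rfl, rfl⟩
    · exact ⟨h2, h2', hu, hu'⟩
    · exact ⟨h2', h2, hu', hu⟩
  rw [← hf.succ_eq hx hpi, ← hf.right] at h3 h4
  have hm := (hf.mem i (by omega)).2 h5
  have hm' := (hf.mem (i + 1) (by omega)).2 h6
  have hpos := hf.position_of_two (by omega) (by omega) hq h3
  have hpos' := hf.position_of_two hi (by omega) hq h4
  clear hfi
  omega

end EndPairs

section Sparse

open scoped Classical
open Finset

variable {V : Type*} [Fintype V] {G : SimpleGraph V}
  {v v' x v₁ v₁' x₁ v₂ v₂' x₂ v₃ v₃' x₃ a u w y z : V}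

/-- A maximal nontraceable graph of order at least ten with fewer than `(3 n - 2) / 2` edges. -/
structure IsSparseMNT (G : SimpleGraph V) : Prop where
  mnt : MaxNontraceable G
  card : 10 ≤ Fintype.card V
  few : 2 * Nat.card G.edgeSet + 3 ≤ 3 * Fintype.card V

theorem IsSparseMNT.nonempty (hG : IsSparseMNT G) : Nonempty V :=
  Fintype.card_pos_iff.1 (by have := hG.card; omega)

theorem IsSparseMNT.sum_degree_le (hG : IsSparseMNT G) :
    ∑ w, G.degree w + 3 ≤ 3 * Fintype.card V := by
  have := hG.few
  rw [Nat.card_eq_fintype_card, ← G.edgeFinset_card] at this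
  rw [G.sum_degrees_eq_twice_card_edges]
  exact this

theorem sum_degree_ge_of_clique_compl {C : Finset V}
    (hC : ∀ y z, y ∉ C → z ∉ C → y ≠ z → G.Adj y z) :
    #Cᶜ * (#Cᶜ - 1) + ∑ u ∈ C, (G.degree u + #{w ∈ Cᶜ | G.Adj u w}) ≤ ∑ w, G.degree w := by
  have h1 : ∑ u ∈ C, #{w ∈ Cᶜ | G.Adj u w} = ∑ w ∈ Cᶜ, #{u ∈ C | G.Adj u w} :=
    sum_card_bipartiteAbove_eq_sum_card_bipartiteBelow G.Adj
  have h2 : ∀ w ∈ Cᶜ, (#Cᶜ - 1) + #{u ∈ C | G.Adj u w} ≤ G.degree w := by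
    intro w hw
    rw [← card_erase_of_mem hw, ← card_union_of_disjoint, ← G.card_neighborFinset_eq_degree]
    · refine card_le_card fun u hu => ?_
      rw [mem_neighborFinset]
      rcases mem_union.1 hu with h | h
      · rw [mem_erase, mem_compl] at h
        exact hC _ _ (mem_compl.1 hw) h.2 h.1.symm
      · exact (mem_filter.1 h).2.symm
    · rw [Finset.disjoint_left]
      intro u hu hu'
      exact mem_compl.1 (mem_of_mem_erase hu) (mem_filter.1 hu').1
  have h3 := sum_le_sum h2
  rw [sum_add_distrib, sum_const, smul_eq_mul] at h3
  have h4 := sum_add_sum_compl C fun w => G.degree w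
  rw [sum_add_distrib, h1]
  omega

theorem IsSparseMNT.exists_not_adj (hG : IsSparseMNT G) (C : Finset V)
    (hC : #C ≤ 4 ∨ #C = 5 ∧ 8 ≤ ∑ u ∈ C, G.degree u ∨
      #C = 6 ∧ ∀ u ∈ C, 2 ≤ G.degree u ∧ ∃ w ∉ C, G.Adj u w) :
    ∃ y z, y ∉ C ∧ z ∉ C ∧ y ≠ z ∧ ¬ G.Adj y z := by
  by_contra! hadj
  have h1 := sum_degree_ge_of_clique_compl hadj
  have h2 := hG.sum_degree_le
  have h3 := hG.card
  have h4 := card_add_card_compl C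
  generalize #Cᶜ = m at *
  rcases hC with hC | ⟨hC, hsum⟩ | ⟨hC, hdeg⟩
  · obtain ⟨m, rfl⟩ : ∃ k, m = k + 6 := ⟨m - 6, by omega⟩
    rw [show m + 6 - 1 = m + 5 by omega] at h1
    have : 30 + 11 * m ≤ (m + 6) * (m + 5) := by nlinarith
    omega
  · rw [sum_add_distrib] at h1
    obtain ⟨m, rfl⟩ : ∃ k, m = k + 5 := ⟨m - 5, by omega⟩
    rw [show m + 5 - 1 = m + 4 by omega] at h1
    have : 20 + 9 * m ≤ (m + 5) * (m + 4) := by nlinarith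
    omega
  · have h5 : ∑ u ∈ C, 3 ≤ ∑ u ∈ C, (G.degree u + #{w ∈ Cᶜ | G.Adj u w}) := by
      refine sum_le_sum fun u hu => ?_
      obtain ⟨h6, w, hw, huw⟩ := hdeg u hu
      have : 0 < #{w ∈ Cᶜ | G.Adj u w} :=
        card_pos.2 ⟨w, mem_filter.2 ⟨mem_compl.2 hw, huw⟩⟩
      omega
    rw [sum_const, hC, smul_eq_mul] at h5
    obtain ⟨m, rfl⟩ : ∃ k, m = k + 4 := ⟨m - 4, by omega⟩
    rw [show m + 4 - 1 = m + 3 by omega] at h1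
    nlinarith

theorem IsSparseMNT.not_closed (hG : IsSparseMNT G) {C : Finset V} (hC : #C ≤ 4)
    (hne : C.Nonempty) (h : ∀ a ∈ C, ∀ b, G.Adj a b → b ∈ C) : False := by
  have := hG.nonempty
  obtain ⟨y, z, hy, hz, hyz, hadj⟩ := hG.exists_not_adj C (Or.inl hC)
  refine hadj (hG.mnt.adj_of_closed (C := (C : Set V)) (fun a b hab => ?_) hne hy hz hyz)
  exact ⟨fun ha => h a ha b hab, fun hb => h b hb a hab.symm⟩

theorem two_le_degree (hxy : x ≠ y) (hx : G.Adj v x) (hy : G.Adj v y) : 2 ≤ G.degree v := by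
  rw [← G.card_neighborFinset_eq_degree, ← card_pair hxy]
  exact card_le_card (by grind [mem_neighborFinset])

theorem three_le_degree (hxy : x ≠ y) (hxz : x ≠ z) (hyz : y ≠ z)
    (hx : G.Adj v x) (hy : G.Adj v y) (hz : G.Adj v z) : 3 ≤ G.degree v := by
  rw [← G.card_neighborFinset_eq_degree, ← card_eq_three.2 ⟨x, y, z, hxy, hxz, hyz, rfl⟩]
  exact card_le_card (by grind [mem_neighborFinset])

theorem IsEnd.degree_le (h : IsEnd G v v' x) : G.degree v ≤ 2 := by
  rw [← G.card_neighborFinset_eq_degree]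
  exact (card_le_card fun w hw => by
    have := h.eq_of_adj w ((G.mem_neighborFinset _ _).1 hw)
    simpa using this).trans (card_le_two (a := v') (b := x))

omit [Fintype V] in
theorem IsEnd.symm (h : IsEnd G v v' x) : IsEnd G v' v x where
  adj := h.adj'
  adj' := h.adj
  eq_or_adj := h.eq_or_adj.imp Eq.symm SimpleGraph.Adj.symm
  eq_of_adj := h.eq_of_adj'
  eq_of_adj' := h.eq_of_adj

theorem IsEnd.degree_eq_two (h : IsEnd G v v' x) (hv : v ≠ v') : G.degree v = 2 :=
  h.degree_le.antisymm (two_le_degree h.adj'.ne (h.eq_or_adj.resolve_left hv) h.adj)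

theorem IsEnd.degree_eq_one (h : IsEnd G v v x) : G.degree v = 1 := by
  rw [degree_eq_one_iff_existsUnique_adj]
  exact ⟨x, h.adj, fun w hw => (h.eq_of_adj w hw).resolve_left hw.ne'⟩

theorem IsSparseMNT.three_le_degree_of_isEnd (hG : IsSparseMNT G) (h : IsEnd G v v' x) :
    3 ≤ G.degree x := by
  have := hG.nonempty
  obtain ⟨w, hw, hwv, hwv'⟩ : ∃ w, G.Adj x w ∧ w ≠ v ∧ w ≠ v' := by
    by_contra! hadj
    refine hG.not_closed (C := {v, v', x}) (card_le_three.trans (by norm_num)) (by simp) ?_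
    have h1 := h.eq_of_adj
    have h2 := h.eq_of_adj'
    grind
  by_cases hv : v = v'
  · subst hv
    by_contra hx
    have h2 := two_le_degree hwv hw h.adj.symm
    have h3 : ∀ z, G.Adj x z → z = v ∨ z = w := by
      intro z hz
      by_contra! hz'
      exact hx (three_le_degree hz'.1 hz'.2 hwv.symm hz h.adj.symm hw)
    have := h.eq_of_adj w (hG.mnt.adj_of_degree_two hwv.symm h.adj.symm hw h3)
    have := hw.ne
    grind
  · exact three_le_degree hv hwv.symm hwv'.symm h.adj.symm h.adj'.symm hw

theorem IsSparseMNT.ne_of_isEnd (hG : IsSparseMNT G) (h₁ : IsEnd G v₁ v₁' x₁)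
    (h₂ : IsEnd G v₂ v₂' x₂) : x₁ ≠ v₂ := by
  rintro rfl
  have := hG.three_le_degree_of_isEnd h₁
  have := h₂.degree_le
  omega

theorem IsSparseMNT.eq_or_endsDisjoint (hG : IsSparseMNT G) (h₁ : IsEnd G v₁ v₁' x₁)
    (h₂ : IsEnd G v₂ v₂' x₂) : (v₂ = v₁ ∨ v₂ = v₁') ∨ EndsDisjoint v₁ v₁' v₂ v₂' := by
  have h3 := hG.ne_of_isEnd h₁ h₂
  have h4 := h₂.eq_or_adj
  have h5 := h₁.eq_of_adj v₂
  have h6 := h₁.eq_of_adj' v₂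
  have := @SimpleGraph.Adj.symm V G
  unfold EndsDisjoint
  grind

theorem IsSparseMNT.ne_of_endsDisjoint (hG : IsSparseMNT G) (h₁ : IsEnd G v₁ v₁' x₁)
    (h₂ : IsEnd G v₂ v₂' x₂) (h₁₂ : EndsDisjoint v₁ v₁' v₂ v₂') : x₁ ≠ x₂ := by
  rintro rfl
  have := hG.nonempty
  obtain ⟨y, z, hy, hz, hyz, hadj⟩ := hG.exists_not_adj {v₁, v₁', v₂, v₂'} (Or.inl card_le_four)
  simp only [mem_insert, mem_singleton, not_or] at hy hz
  exact hadj (hG.mnt.adj_of_two_ends (by have := hG.card; omega) h₁ h₂ h₁₂ hy hz hyz)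

theorem IsSparseMNT.isEndPair (hG : IsSparseMNT G) (h₁ : IsEnd G v₁ v₁' x₁)
    (h₂ : IsEnd G v₂ v₂' x₂) (h₁₂ : EndsDisjoint v₁ v₁' v₂ v₂') :
    IsEndPair G v₁ v₁' x₁ v₂ v₂' x₂ where
  left := h₁
  right := h₂
  disjoint := h₁₂
  ne := hG.ne_of_endsDisjoint h₁ h₂ h₁₂
  left_ne := ⟨hG.ne_of_isEnd h₁ h₂, hG.ne_of_isEnd h₁ h₂.symm⟩
  right_ne := ⟨hG.ne_of_isEnd h₂ h₁, hG.ne_of_isEnd h₂ h₁.symm⟩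
  exists_not_adj w := by
    suffices ∃ y z, y ∉ ({w, v₁, v₁', v₂, v₂'} : Finset V) ∧
        z ∉ ({w, v₁, v₁', v₂, v₂'} : Finset V) ∧ y ≠ z ∧ ¬ G.Adj y z by
      simp only [mem_insert, mem_singleton, not_or] at this
      unfold EndsDisjoint
      grind
    apply hG.exists_not_adj
    by_cases hv₁ : v₁ = v₁'
    · subst hv₁
      exact Or.inl (by simpa using card_le_four)
    by_cases hv₂ : v₂ = v₂'
    · subst hv₂
      exact Or.inl (by simpa using card_le_four)
    have h3 := h₁.degree_eq_two hv₁
    have h4 := h₁.symm.degree_eq_two (Ne.symm hv₁)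
    have h5 := h₂.degree_eq_two hv₂
    have h6 := h₂.symm.degree_eq_two (Ne.symm hv₂)
    obtain ⟨h7, h8, h9, h10⟩ := h₁₂
    have h11 : ∑ u ∈ ({v₁, v₁', v₂, v₂'} : Finset V), G.degree u = 8 := by
      rw [sum_insert (by grind), sum_insert (by grind), sum_pair hv₂]
      omega
    by_cases hw : w ∈ ({v₁, v₁', v₂, v₂'} : Finset V)
    · rw [insert_eq_of_mem hw]
      exact Or.inl card_le_four
    · refine Or.inr (Or.inl ⟨?_, ?_⟩)
      · rw [card_insert_of_notMem hw, card_insert_of_notMem (by grind),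
          card_insert_of_notMem (by grind), card_pair hv₂]
      · rw [sum_insert hw]
        omega

theorem IsSparseMNT.not_three_ends (hG : IsSparseMNT G) (h₁ : IsEnd G v₁ v₁' x₁)
    (h₂ : IsEnd G v₂ v₂' x₂) (h₃ : IsEnd G v₃ v₃' x₃) (h₁₂ : EndsDisjoint v₁ v₁' v₂ v₂')
    (h₁₃ : EndsDisjoint v₁ v₁' v₃ v₃') (h₂₃ : EndsDisjoint v₂ v₂' v₃ v₃') : False := by
  have := hG.nonempty
  suffices ∃ y z, (y ≠ v₁ ∧ y ≠ v₁' ∧ y ≠ v₂ ∧ y ≠ v₂' ∧ y ≠ v₃ ∧ y ≠ v₃') ∧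
      (z ≠ v₁ ∧ z ≠ v₁' ∧ z ≠ v₂ ∧ z ≠ v₂' ∧ z ≠ v₃ ∧ z ≠ v₃') ∧ y ≠ z ∧ ¬ G.Adj y z by
    obtain ⟨y, z, hy, hz, hyz, hadj⟩ := this
    exact hadj (hG.mnt.adj_of_three_ends (by have := hG.card; omega) h₁ h₂ h₃ h₁₂ h₁₃ h₂₃
      hy hz hyz)
  by_cases hv₁ : v₁ = v₁'
  · obtain ⟨y, z, h⟩ := (hG.isEndPair h₂ h₃ h₂₃).exists_not_adj v₁
    unfold EndsDisjoint at h
    exact ⟨y, z, by grind⟩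
  by_cases hv₂ : v₂ = v₂'
  · obtain ⟨y, z, h⟩ := (hG.isEndPair h₁ h₃ h₁₃).exists_not_adj v₂
    unfold EndsDisjoint at h
    exact ⟨y, z, by grind⟩
  by_cases hv₃ : v₃ = v₃'
  · obtain ⟨y, z, h⟩ := (hG.isEndPair h₁ h₂ h₁₂).exists_not_adj v₃
    unfold EndsDisjoint at h
    exact ⟨y, z, by grind⟩
  obtain ⟨y, z, hy, hz, h⟩ := hG.exists_not_adj {v₁, v₁', v₂, v₂', v₃, v₃'} <| by
    refine Or.inr (Or.inr ⟨?_, ?_⟩)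
    · unfold EndsDisjoint at h₁₂ h₁₃ h₂₃
      rw [card_insert_of_notMem (by grind), card_insert_of_notMem (by grind),
        card_insert_of_notMem (by grind), card_insert_of_notMem (by grind), card_pair hv₃]
    · have key : ∀ {v v' x}, IsEnd G v v' x → v ≠ v' →
          2 ≤ G.degree v ∧ ∃ w ∉ ({v₁, v₁', v₂, v₂', v₃, v₃'} : Finset V), G.Adj v w := by
        intro v v' x h hv
        refine ⟨(h.degree_eq_two hv).ge, x, ?_, h.adj⟩
        simp only [mem_insert, mem_singleton, not_or]
        exact ⟨hG.ne_of_isEnd h h₁, hG.ne_of_isEnd h h₁.symm, hG.ne_of_isEnd h h₂,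
          hG.ne_of_isEnd h h₂.symm, hG.ne_of_isEnd h h₃, hG.ne_of_isEnd h h₃.symm⟩
      intro u hu
      rw [mem_insert, mem_insert, mem_insert, mem_insert, mem_insert, mem_singleton] at hu
      rcases hu with rfl | rfl | rfl | rfl | rfl | rfl
      exacts [key h₁ hv₁, key h₁.symm (Ne.symm hv₁), key h₂ hv₂, key h₂.symm (Ne.symm hv₂),
        key h₃ hv₃, key h₃.symm (Ne.symm hv₃)]
  simp only [mem_insert, mem_singleton, not_or] at hy hz
  exact ⟨y, z, hy, hz, h⟩

end Sparse

section Discharging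

open scoped Classical
open Finset

variable {V : Type*} [Fintype V] {G : SimpleGraph V}
  {v v' x v₁ v₁' x₁ v₂ v₂' x₂ a u u' w y z : V}

theorem IsEndPair.adj [Nonempty V] (hn : 10 ≤ Fintype.card V) (hG : MaxNontraceable G)
    (h : IsEndPair G v₁ v₁' x₁ v₂ v₂' x₂) : G.Adj x₁ x₂ := by
  by_contra hadj
  obtain ⟨f, i, p, q, hf, hfi⟩ := h.exists_spans hn hG
    ⟨h.left.adj.ne, h.right_ne.1.symm, h.left.adj'.ne, h.right_ne.2.symm⟩
    ⟨h.left_ne.1.symm, h.right.adj.ne, h.left_ne.2.symm, h.right.adj'.ne⟩ h.ne hadj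
  have hlt := hf.lt
  have hq := hf.hq
  have hi := hf.hi
  rw [← hf.left, ← hf.right] at hfi
  rcases hfi with ⟨h1, h2⟩ | ⟨h1, h2⟩
  · have := hf.inj _ (by omega) _ (by omega) h1
    have := hf.inj _ (by omega) _ (by omega) h2
    omega
  · have := hf.inj _ (by omega) _ (by omega) h1
    have := hf.inj _ (by omega) _ (by omega) h2
    omega

/-- A vertex of degree two both of whose neighbours have degree at least four. -/
def IsMid (G : SimpleGraph V) (u : V) : Prop :=
  ∃ x y, x ≠ y ∧ G.Adj u x ∧ G.Adj u y ∧ G.Adj x y ∧ (∀ w, G.Adj u w → w = x ∨ w = y) ∧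
    4 ≤ G.degree x ∧ 4 ≤ G.degree y

theorem IsMid.degree (h : IsMid G u) : G.degree u = 2 := by
  obtain ⟨x, y, hxy, hx, hy, -, hu, -⟩ := h
  rw [← G.card_neighborFinset_eq_degree, card_eq_two]
  exact ⟨x, y, hxy, by ext w; grind [mem_neighborFinset]⟩

theorem IsMid.exists_adj (h : IsMid G u) (hw : G.Adj w u) :
    ∃ y, y ≠ w ∧ G.Adj u y ∧ G.Adj w y ∧ (∀ z, G.Adj u z → z = w ∨ z = y) ∧ 4 ≤ G.degree y := by
  obtain ⟨x, y, hxy, hx, hy, hadj, hu, h1, h2⟩ := h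
  rcases hu w hw.symm with rfl | rfl
  · exact ⟨y, hxy.symm, hy, hadj, hu, h2⟩
  · exact ⟨x, hxy, hx, hadj.symm, fun z hz => (hu z hz).symm, h1⟩

theorem IsMid.four_le_degree (h : IsMid G u) (hw : G.Adj u w) : 4 ≤ G.degree w := by
  obtain ⟨x, y, -, -, -, -, hu, h1, h2⟩ := h
  rcases hu w hw with rfl | rfl <;> assumption

theorem not_isMid_of_three_le (h : 3 ≤ G.degree u) : ¬ IsMid G u := fun hu => by
  have := hu.degree
  omega

theorem IsMid.not_isMid_of_adj (h : IsMid G u) (hw : G.Adj u w) : ¬ IsMid G w :=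
  not_isMid_of_three_le (by have := h.four_le_degree hw; omega)

theorem IsEnd.not_isMid (h : IsEnd G v v' x) : ¬ IsMid G v := by
  intro hv
  have h1 := hv.degree
  rcases eq_or_ne v v' with rfl | hne
  · have := h.degree_eq_one
    omega
  · have := hv.four_le_degree (h.eq_or_adj.resolve_left hne)
    have := h.symm.degree_le
    omega

theorem IsSparseMNT.isEnd_or_isMid (hG : IsSparseMNT G) (hu : G.degree u ≤ 2) :
    (∃ v' x, IsEnd G u v' x) ∨ IsMid G u := by
  have := hG.nonempty
  obtain ⟨x, hx⟩ : ∃ x, G.Adj u x := by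
    by_contra! h
    exact hG.not_closed (C := {u}) (by simp) (by simp) (by grind)
  by_cases hy : ∃ y, G.Adj u y ∧ y ≠ x
  swap
  · push Not at hy
    exact Or.inl ⟨u, x, hx, hx, Or.inl rfl, fun w hw => Or.inr (hy w hw),
      fun w hw => Or.inr (hy w hw)⟩
  obtain ⟨y, hy, hyx⟩ := hy
  have hnbr : ∀ w, G.Adj u w → w = x ∨ w = y := by
    intro w hw
    by_contra! h
    have := three_le_degree hyx.symm h.1.symm h.2.symm hx hy hw
    omega
  have hadj := hG.mnt.adj_of_degree_two hyx.symm hx hy hnbr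
  have key : ∀ {x y}, y ≠ x → G.Adj u x → G.Adj u y → (∀ w, G.Adj u w → w = x ∨ w = y) →
      G.Adj x y → IsEnd G u x y ∨ 4 ≤ G.degree x := by
    intro x y hyx hx hy hnbr hadj
    by_cases hz : ∃ z, G.Adj x z ∧ z ≠ u ∧ z ≠ y
    · obtain ⟨z, hz, hzu, hzy⟩ := hz
      by_cases ht : ∃ t, G.Adj x t ∧ t ≠ u ∧ t ≠ y ∧ t ≠ z
      · obtain ⟨t, ht, htu, hty, htz⟩ := ht
        right
        rw [← G.card_neighborFinset_eq_degree]
        calc 4 = #{u, y, z, t} := by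
              rw [card_insert_of_notMem (by have := hy.ne; grind),
                card_insert_of_notMem (by grind), card_pair htz.symm]
          _ ≤ _ := card_le_card (by have := hx.symm; grind [mem_neighborFinset])
      · push Not at ht
        exact (hG.mnt.not_degree_three_of_degree_two hyx.symm hzu hzy hx hy hz hnbr
          (by grind)).elim
    · push Not at hz
      exact Or.inl ⟨hy, hadj, Or.inr hx, hnbr, by grind⟩
  rcases key hyx hx hy hnbr hadj with h | h1
  · exact Or.inl ⟨_, _, h⟩
  rcases key hyx.symm hy hx (fun w hw => (hnbr w hw).symm) hadj.symm with h | h2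
  · exact Or.inl ⟨_, _, h⟩
  exact Or.inr ⟨x, y, hyx.symm, hx, hy, hadj, hnbr, h1, h2⟩

/-- The neighbours of `w` that are not vertices of degree two as in `IsMid`. -/
noncomputable def heavyNeighbors (G : SimpleGraph V) (w : V) : Finset V :=
  {u ∈ G.neighborFinset w | ¬ IsMid G u}

theorem mem_heavyNeighbors : u ∈ heavyNeighbors G w ↔ G.Adj w u ∧ ¬ IsMid G u := by
  simp [heavyNeighbors]

theorem card_heavyNeighbors_le : #(heavyNeighbors G w) ≤ G.degree w :=
  card_le_card (filter_subset _ _)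

/-- Up to a constant, the charge of a vertex in the discharging argument. -/
noncomputable def charge (G : SimpleGraph V) (w : V) : ℤ :=
  G.degree w + #(heavyNeighbors G w) + (if IsMid G w then 2 else 0) - 6

theorem charge_of_not_isMid (h : ¬ IsMid G w) :
    charge G w = G.degree w + #(heavyNeighbors G w) - 6 := by
  simp [charge, h]

theorem sum_charge : ∑ w, charge G w = 2 * ∑ w, (G.degree w : ℤ) - 6 * Fintype.card V := by
  have h1 : ∑ w, #(heavyNeighbors G w) = ∑ u with ¬ IsMid G u, G.degree u := by
    have h := sum_card_bipartiteAbove_eq_sum_card_bipartiteBelow (s := univ)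
      (t := ({u | ¬ IsMid G u} : Finset V)) G.Adj
    convert h using 3 with w _ w hw
    · ext u
      simp [mem_heavyNeighbors, bipartiteAbove, and_comm]
    · rw [← G.card_neighborFinset_eq_degree]
      congr 1
      ext u
      simp [bipartiteBelow, G.adj_comm]
  have h2 : ∑ u with IsMid G u, G.degree u = ∑ w, if IsMid G w then 2 else 0 := by
    rw [← sum_filter]
    exact sum_congr rfl fun u hu => (mem_filter.1 hu).2.degree
  have h3 := sum_filter_add_sum_filter_not univ (IsMid G) fun u => G.degree u
  rw [← h1, h2] at h3
  have h4 : ∑ w, (if IsMid G w then 2 else 0 : ℤ) + ∑ w, (#(heavyNeighbors G w) : ℤ)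
      = ∑ w, (G.degree w : ℤ) := by exact_mod_cast h3
  simp only [charge, sum_sub_distrib, sum_add_distrib, sum_const, card_univ, nsmul_eq_mul]
  linarith

theorem IsSparseMNT.sum_charge_le (hG : IsSparseMNT G) : ∑ w, charge G w ≤ -6 := by
  have h : ∑ w, (G.degree w : ℤ) + 3 ≤ 3 * Fintype.card V := by exact_mod_cast hG.sum_degree_le
  rw [sum_charge]
  linarith

theorem IsSparseMNT.charge_nonneg (hG : IsSparseMNT G) (hw : ∀ v' x, ¬ IsEnd G w v' x) :
    0 ≤ charge G w := by
  have := hG.nonempty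
  by_cases hmid : IsMid G w
  · have h : heavyNeighbors G w = G.neighborFinset w :=
      filter_true_of_mem fun u hu => hmid.not_isMid_of_adj ((G.mem_neighborFinset _ _).1 hu)
    rw [charge, if_pos hmid, h, G.card_neighborFinset_eq_degree, hmid.degree]
    norm_num
  rw [charge_of_not_isMid hmid]
  have hdeg : 3 ≤ G.degree w := by
    by_contra! h
    rcases hG.isEnd_or_isMid (u := w) (by omega) with ⟨v', x, h⟩ | h
    · exact hw _ _ h
    · exact hmid h
  suffices 6 ≤ G.degree w + #(heavyNeighbors G w) by
    have : (6 : ℤ) ≤ G.degree w + #(heavyNeighbors G w) := by exact_mod_cast this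
    linarith
  by_cases hk : ∃ u, G.Adj w u ∧ IsMid G u
  swap
  · push Not at hk
    have h : heavyNeighbors G w = G.neighborFinset w :=
      filter_true_of_mem fun u hu => hk u ((G.mem_neighborFinset _ _).1 hu)
    rw [h, G.card_neighborFinset_eq_degree]
    omega
  obtain ⟨u, hu, humid⟩ := hk
  have h4 := humid.four_le_degree hu.symm
  obtain ⟨y, hyw, huy, hwy, hy, hdy⟩ := humid.exists_adj hu
  have hmem : y ∈ heavyNeighbors G w :=
    mem_heavyNeighbors.2 ⟨hwy, not_isMid_of_three_le (by omega)⟩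
  have h1 : 1 ≤ #(heavyNeighbors G w) := card_pos.2 ⟨y, hmem⟩
  by_contra! hlt
  obtain ⟨b, hb⟩ : ∃ b, heavyNeighbors G w = {b} := card_eq_one.1 (by omega)
  have hyb : y = b := by simpa [hb] using hmem
  subst hyb
  have h5 : 2 < #(G.neighborFinset w \ {y}) := by
    rw [card_sdiff_of_subset (by simpa using hwy), card_singleton, G.card_neighborFinset_eq_degree]
    omega
  obtain ⟨u₁, u₂, u₃, h₁, h₂, h₃, h₁₂, h₁₃, h₂₃⟩ := two_lt_card_iff.1 h5
  have key : ∀ u ∈ G.neighborFinset w \ {y}, ∀ z, G.Adj u z → z = w ∨ z = y := by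
    intro u hu
    rw [mem_sdiff, mem_neighborFinset, mem_singleton] at hu
    have humid : IsMid G u := by
      by_contra h
      exact hu.2 (by simpa [hb] using mem_heavyNeighbors.2 ⟨hu.1, h⟩)
    obtain ⟨t, htw, hut, hwt, ht, hdt⟩ := humid.exists_adj hu.1
    have : t ∈ heavyNeighbors G w :=
      mem_heavyNeighbors.2 ⟨hwt, not_isMid_of_three_le (by omega)⟩
    rw [hb, mem_singleton] at this
    exact this ▸ ht
  obtain ⟨s, t, hs, ht, hst, hadj⟩ := hG.exists_not_adj {u₁, u₂, u₃}
    (Or.inl (card_le_three.trans (by norm_num)))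
  simp only [mem_insert, mem_singleton, not_or] at hs ht
  exact hadj (hG.mnt.adj_of_three_twins (by have := hG.card; omega) h₁₂ h₁₃ h₂₃ (key _ h₁)
    (key _ h₂) (key _ h₃) hs ht hst)

theorem IsEnd.charge_ge (h : IsEnd G v v' x) : -4 ≤ ∑ u ∈ {v, v'}, charge G u := by
  have key : ∀ {v v' x}, IsEnd G v v' x → charge G v = 2 * G.degree v - 6 := by
    intro v v' x h
    have h1 : heavyNeighbors G v = G.neighborFinset v := filter_true_of_mem fun u hu hmid => by
      have := hmid.four_le_degree ((G.mem_neighborFinset _ _).1 hu).symm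
      have := h.degree_le
      omega
    rw [charge_of_not_isMid h.not_isMid, h1, G.card_neighborFinset_eq_degree]
    ring
  rcases eq_or_ne v v' with rfl | hne
  · rw [pair_eq_singleton, sum_singleton, key h, h.degree_eq_one]
    norm_num
  · rw [sum_pair hne, key h, key h.symm, h.degree_eq_two hne, h.symm.degree_eq_two hne.symm]
    norm_num

theorem IsSparseMNT.sum_charge_ge (hG : IsSparseMNT G) (T : Finset V)
    (hT : ∀ v v' x, IsEnd G v v' x → v ∈ T) : ∑ w ∈ T, charge G w ≤ ∑ w, charge G w :=
  sum_le_sum_of_subset_of_nonneg (subset_univ T) fun w _ hw =>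
    hG.charge_nonneg fun v' x h => hw (hT w v' x h)

theorem IsSparseMNT.exists_heavy_left (hG : IsSparseMNT G)
    (h : IsEndPair G v₁ v₁' x₁ v₂ v₂' x₂) :
    ∃ a, (a ≠ v₁ ∧ a ≠ v₁' ∧ a ≠ v₂ ∧ a ≠ v₂') ∧ a ≠ x₂ ∧ a ∈ heavyNeighbors G x₁ := by
  have := hG.nonempty
  obtain ⟨w, hw, hwx, hadj⟩ := h.exists_adj_left hG.card hG.mnt
  by_cases hmid : IsMid G w
  · obtain ⟨y, hyx, hwy, hxy, hy, hdy⟩ := hmid.exists_adj hadj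
    refine ⟨y, ⟨?_, ?_, ?_, ?_⟩, ?_, mem_heavyNeighbors.2
      ⟨hxy, not_isMid_of_three_le (by omega)⟩⟩
    · rintro rfl
      have := h.left.degree_le
      omega
    · rintro rfl
      have := h.left.symm.degree_le
      omega
    · rintro rfl
      have := h.right.degree_le
      omega
    · rintro rfl
      have := h.right.symm.degree_le
      omega
    · rintro rfl
      exact h.not_degree_two hG.card hG.mnt hw hadj.ne' hwx hy
  · exact ⟨w, hw, hwx, mem_heavyNeighbors.2 ⟨hadj, hmid⟩⟩

theorem IsSparseMNT.charge_left (hG : IsSparseMNT G) (h : IsEndPair G v₁ v₁' x₁ v₂ v₂' x₂) :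
    2 ≤ charge G x₁ ∨ v₁ = v₁' ∧ ∃ a, (a ≠ v₁ ∧ a ≠ v₁' ∧ a ≠ v₂ ∧ a ≠ v₂') ∧ a ≠ x₂ ∧
      G.Adj x₁ a ∧ ∀ z, G.Adj x₁ z → z = v₁ ∨ z = v₁' ∨ z = x₂ ∨ z = a := by
  have := hG.nonempty
  obtain ⟨a, ha, hax, hmem⟩ := hG.exists_heavy_left h
  have hdx₁ := hG.three_le_degree_of_isEnd h.left
  have hdx₂ := hG.three_le_degree_of_isEnd h.right
  have hsub : {v₁, v₁', x₂, a} ⊆ heavyNeighbors G x₁ := by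
    have h1 := mem_heavyNeighbors.2 ⟨h.left.adj.symm, h.left.not_isMid⟩
    have h2 := mem_heavyNeighbors.2 ⟨h.left.adj'.symm, h.left.symm.not_isMid⟩
    have h3 := mem_heavyNeighbors.2 ⟨h.adj hG.card hG.mnt, not_isMid_of_three_le hdx₂⟩
    grind
  have hcard := card_le_card hsub
  have hle := card_heavyNeighbors_le (G := G) (w := x₁)
  have hxv := h.right_ne
  by_contra! hcon
  rw [charge_of_not_isMid (not_isMid_of_three_le hdx₁)] at hcon
  obtain ⟨hlt, hcon⟩ := hcon
  have hlt : G.degree x₁ + #(heavyNeighbors G x₁) < 8 := by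
    have : (G.degree x₁ + #(heavyNeighbors G x₁) : ℤ) < 8 := by linarith
    exact_mod_cast this
  have hv : v₁ = v₁' := by
    by_contra hv
    rw [card_insert_of_notMem (by grind), card_insert_of_notMem (by grind),
      card_pair hax.symm] at hcard
    omega
  subst hv
  rw [insert_eq_of_mem (by simp), card_insert_of_notMem (by grind), card_pair hax.symm] at hcard
  obtain ⟨u, hadj, hu⟩ := hcon rfl a ha hax (mem_heavyNeighbors.1 hmem).1
  have heq : {v₁, x₂, a} = heavyNeighbors G x₁ := by
    refine eq_of_subset_of_card_le (by simpa using hsub) ?_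
    rw [card_insert_of_notMem (by grind), card_pair hax.symm]
    omega
  have hnbr : insert u (heavyNeighbors G x₁) = G.neighborFinset x₁ := by
    refine eq_of_subset_of_card_le ?_ ?_
    · intro w hw
      rw [mem_neighborFinset]
      rcases mem_insert.1 hw with rfl | hw
      · exact hadj
      · exact (mem_heavyNeighbors.1 hw).1
    · rw [card_insert_of_notMem (by grind), G.card_neighborFinset_eq_degree]
      omega
  have humid : IsMid G u := by
    by_contra hmid
    have := mem_heavyNeighbors.2 ⟨hadj, hmid⟩
    grind
  have houtside : u ≠ v₁ ∧ u ≠ v₁ ∧ u ≠ v₂ ∧ u ≠ v₂' :=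
    ⟨hu.1, hu.1, fun h' => h.right.not_isMid (h' ▸ humid),
      fun h' => h.right.symm.not_isMid (h' ▸ humid)⟩
  obtain ⟨y, hyx, huy, hxy, hy, hdy⟩ := humid.exists_adj hadj
  have hymem := mem_heavyNeighbors.2 ⟨hxy, not_isMid_of_three_le (by omega)⟩
  rw [← heq, mem_insert, mem_insert, mem_singleton] at hymem
  rcases hymem with rfl | rfl | rfl
  · have := h.left.degree_le
    omega
  · exact h.not_degree_two hG.card hG.mnt houtside hadj.ne' hu.2.2.1 hy
  · refine h.not_degree_two_of_adj hG.card hG.mnt houtside hadj.ne' hu.2.2.1 hax hy fun z hz => ?_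
    rw [← mem_neighborFinset, ← hnbr, ← heq] at hz
    grind

theorem IsSparseMNT.charge_of_small_left (hG : IsSparseMNT G)
    (h : IsEndPair G v₁ v₁' x₁ v₂ v₂' x₂) (hv : v₁ = v₁')
    (ha : a ≠ v₁ ∧ a ≠ v₁' ∧ a ≠ v₂ ∧ a ≠ v₂') (hax : a ≠ x₂) (hadj : G.Adj x₁ a)
    (hx : ∀ z, G.Adj x₁ z → z = v₁ ∨ z = v₁' ∨ z = x₂ ∨ z = a) :
    2 ≤ charge G x₂ ∧ 1 ≤ charge G a := by
  have := hG.nonempty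
  have hdx₁ := hG.three_le_degree_of_isEnd h.left
  have hdx₂ := hG.three_le_degree_of_isEnd h.right
  have hax₂ := h.adj_right hG.card hG.mnt ha hadj.ne' hax hx
  have hl := h.left_ne
  have hr := h.right_ne
  have hd := h.disjoint
  have hvx₁ := h.left.adj.ne
  have hvx₂ := h.right.adj.ne
  have hvx₂' := h.right.adj'.ne
  have hne := h.ne
  unfold EndsDisjoint at hd
  obtain ⟨y, z, hy, hz, hyz, hnadj⟩ := hG.exists_not_adj {x₁, x₂, v₁, v₂, v₂'} <| by
    by_cases hv₂ : v₂ = v₂'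
    · subst hv₂
      exact Or.inl (by simpa using card_le_four)
    · refine Or.inr (Or.inl ⟨?_, ?_⟩)
      · rw [card_insert_of_notMem (by grind), card_insert_of_notMem (by grind),
          card_insert_of_notMem (by grind), card_pair hv₂]
      · rw [sum_insert (by grind), sum_insert (by grind), sum_insert (by grind), sum_pair hv₂,
          h.right.degree_eq_two hv₂]
        omega
  simp only [mem_insert, mem_singleton, not_or] at hy hz
  obtain ⟨s, hs, hsx, hsa, hxs⟩ := h.exists_adj_right hG.card hG.mnt hx (y := y) (z := z)
    (by unfold EndsDisjoint; grind) (by unfold EndsDisjoint; grind)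
    (by unfold EndsDisjoint; grind) hyz hnadj
  refine ⟨(hG.charge_left h.symm).resolve_right ?_, ?_⟩
  · rintro ⟨-, b, -, -, -, hb⟩
    have h1 := hb a hax₂.symm
    have h2 := hb s hxs
    have := hadj.ne'
    grind
  have h4 : 4 ≤ G.degree a := by
    by_contra! hlt
    obtain ⟨w, hw⟩ : ∃ w, ∀ z, G.Adj a z → z = x₁ ∨ z = x₂ ∨ z = w := by
      by_cases hw : ∃ w, G.Adj a w ∧ w ≠ x₁ ∧ w ≠ x₂
      · obtain ⟨w, haw, hw₁, hw₂⟩ := hw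
        refine ⟨w, fun z hz => ?_⟩
        by_contra! hz'
        have : #{x₁, x₂, w, z} ≤ #(G.neighborFinset a) := card_le_card (by
          have := hadj.symm
          grind [mem_neighborFinset])
        rw [card_insert_of_notMem (by grind), card_insert_of_notMem (by grind),
          card_pair hz'.2.2.symm, G.card_neighborFinset_eq_degree] at this
        omega
      · exact ⟨x₁, by grind⟩
    exact h.not_degree_three hG.card hG.mnt ha hadj hax₂ hs hsx hsa hxs hx hw
  have hmid : ¬ IsMid G a := not_isMid_of_three_le (by omega)
  suffices 3 ≤ #(heavyNeighbors G a) by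
    rw [charge_of_not_isMid hmid]
    have h3 : (3 : ℤ) ≤ #(heavyNeighbors G a) := by exact_mod_cast this
    have h4 : (4 : ℤ) ≤ G.degree a := by exact_mod_cast h4
    linarith
  by_contra! hlt
  have heq : {x₁, x₂} = heavyNeighbors G a := by
    refine eq_of_subset_of_card_le ?_ ?_
    · have h1 := mem_heavyNeighbors.2 ⟨hadj.symm, not_isMid_of_three_le hdx₁⟩
      have h2 := mem_heavyNeighbors.2 ⟨hax₂, not_isMid_of_three_le hdx₂⟩
      grind
    · rw [card_pair hne]
      omega
  have key : ∀ u ∈ G.neighborFinset a \ {x₁, x₂}, IsMid G u ∧ u ≠ x₁ ∧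
      (u ≠ v₁ ∧ u ≠ v₁' ∧ u ≠ v₂ ∧ u ≠ v₂') ∧ ∀ z, G.Adj u z → z = a ∨ z = x₂ := by
    intro u hu
    rw [mem_sdiff, mem_neighborFinset] at hu
    have humid : IsMid G u := by
      by_contra hmid
      exact hu.2 (heq ▸ mem_heavyNeighbors.2 ⟨hu.1, hmid⟩)
    have houtside : u ≠ v₁ ∧ u ≠ v₁' ∧ u ≠ v₂ ∧ u ≠ v₂' :=
      ⟨fun h' => h.left.not_isMid (h' ▸ humid), fun h' => h.left.symm.not_isMid (h' ▸ humid),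
        fun h' => h.right.not_isMid (h' ▸ humid), fun h' => h.right.symm.not_isMid (h' ▸ humid)⟩
    obtain ⟨y, -, huy, hay, hyu, hdy⟩ := humid.exists_adj hu.1
    have hymem := mem_heavyNeighbors.2 ⟨hay, not_isMid_of_three_le (by omega)⟩
    rw [← heq, mem_insert, mem_singleton] at hymem
    have hux₂ : u ≠ x₂ := by grind
    have hua := hu.1.ne'
    have hyx₂ : y = x₂ := by
      refine hymem.resolve_left ?_
      rintro rfl
      have := hx u huy.symm
      grind
    subst hyx₂
    exact ⟨humid, by grind, houtside, hyu⟩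
  have h2 : 1 < #(G.neighborFinset a \ {x₁, x₂}) := by
    rw [card_sdiff_of_subset (by have := hadj.symm; grind [mem_neighborFinset]), card_pair hne,
      G.card_neighborFinset_eq_degree]
    omega
  obtain ⟨u, hu, u', hu', huu'⟩ := one_lt_card.1 h2
  obtain ⟨hmid, h5, h6, h7⟩ := key u hu
  obtain ⟨hmid', h5', h6', h7'⟩ := key u' hu'
  exact h.not_twins hG.card hG.mnt h6 h6' h5 h5' huu' (fun h' => hmid.not_isMid_of_adj h' hmid')
    hx h7 h7'

theorem IsSparseMNT.exists_charge_ge (hG : IsSparseMNT G)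
    (h : IsEndPair G v₁ v₁' x₁ v₂ v₂' x₂) :
    ∃ S : Finset V, Disjoint {v₁, v₁', v₂, v₂'} S ∧ 3 ≤ ∑ u ∈ S, charge G u := by
  have hdisj : ∀ {S : Finset V}, (∀ u ∈ S, u ≠ v₁ ∧ u ≠ v₁' ∧ u ≠ v₂ ∧ u ≠ v₂') →
      Disjoint {v₁, v₁', v₂, v₂'} S := fun hS =>
    Finset.disjoint_right.2 fun u hu => by simpa using hS u hu
  have hl := h.left_ne
  have hr := h.right_ne
  have hvx₁ := h.left.adj.ne
  have hvx₁' := h.left.adj'.ne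
  have hvx₂ := h.right.adj.ne
  have hvx₂' := h.right.adj'.ne
  rcases hG.charge_left h with h1 | ⟨hv, a, ha, hax, hadj, hx⟩
  · rcases hG.charge_left h.symm with h2 | ⟨hv, a, ha, hax, hadj, hx⟩
    · refine ⟨{x₁, x₂}, hdisj (by grind), ?_⟩
      rw [sum_pair h.ne]
      linarith
    · have ha' := hG.charge_of_small_left h.symm hv ha hax hadj hx
      refine ⟨{x₁, a}, hdisj (by grind), ?_⟩
      rw [sum_pair hax.symm]
      linarith
  · have ha' := hG.charge_of_small_left h hv ha hax hadj hx
    refine ⟨{x₂, a}, hdisj (by grind), ?_⟩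
    rw [sum_pair hax.symm]
    linarith

theorem not_isSparseMNT : ¬ IsSparseMNT G := by
  intro hG
  have hsum := hG.sum_charge_le
  by_cases h₁ : ∃ v₁ v₁' x₁, IsEnd G v₁ v₁' x₁
  swap
  · have := sum_nonneg fun w (_ : w ∈ univ) =>
      hG.charge_nonneg (w := w) fun v' x h => h₁ ⟨w, v', x, h⟩
    linarith
  obtain ⟨v₁, v₁', x₁, h₁⟩ := h₁
  by_cases h₂ : ∃ v₂ v₂' x₂, IsEnd G v₂ v₂' x₂ ∧ EndsDisjoint v₁ v₁' v₂ v₂'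
  swap
  · have h := hG.sum_charge_ge {v₁, v₁'} fun v v' x h => by
      rw [mem_insert, mem_singleton]
      exact (hG.eq_or_endsDisjoint h₁ h).resolve_right fun hd => h₂ ⟨v, v', x, h, hd⟩
    have := h₁.charge_ge
    linarith
  obtain ⟨v₂, v₂', x₂, h₂, h₁₂⟩ := h₂
  obtain ⟨S, hS, h3⟩ := hG.exists_charge_ge (hG.isEndPair h₁ h₂ h₁₂)
  have h := hG.sum_charge_ge ({v₁, v₁', v₂, v₂'} ∪ S) fun v v' x h => by
    rcases hG.eq_or_endsDisjoint h₁ h with h4 | h4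
    · grind
    rcases hG.eq_or_endsDisjoint h₂ h with h5 | h5
    · grind
    exact (hG.not_three_ends h₁ h₂ h h₁₂ h4 h5).elim
  have hunion : ({v₁, v₁', v₂, v₂'} : Finset V) = {v₁, v₁'} ∪ {v₂, v₂'} := by grind
  rw [sum_union hS, hunion, sum_union (by
    rw [Finset.disjoint_left]
    unfold EndsDisjoint at h₁₂
    grind)] at h
  have := h₁.charge_ge
  have := h₂.charge_ge
  linarith

end Discharging

/-- Every MNT graph of order n ≥ 10 has at least (3n − 2)/2 edges. -/
theorem stmt_9 {V : Type*} [Fintype V] (G : SimpleGraph V)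
    (hG : MaxNontraceable G) (hn : 10 ≤ Fintype.card V) :
    3 * Fintype.card V - 2 ≤ 2 * Nat.card G.edgeSet := by
  by_contra hlt
  exact not_isSparseMNT ⟨hG, hn, by omega⟩
end

section
/- Every maximal nontraceable graph of order 8 has at least 10 edges, and there exists a maximal nontraceable graph of order 8 with exactly 10 edges. -/
open SimpleGraph

section Paths

variable {V W : Type*} {G : SimpleGraph V}

theorem traceable_iff_exists_list :
    Traceable G ↔ ∃ l : List V, l ≠ [] ∧ l.IsChain G.Adj ∧ l.Nodup ∧ ∀ w, w ∈ l := by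
  constructor
  · rintro ⟨u, v, p, hp, h⟩
    exact ⟨p.support, by simp, p.isChain_adj_support, hp.support_nodup, h⟩
  · rintro ⟨l, hne, hc, hn, h⟩
    refine ⟨_, _, Walk.ofSupport l hne hc, ?_, ?_⟩
    · rw [Walk.isPath_def, Walk.support_ofSupport]
      exact hn
    · simpa [Walk.support_ofSupport] using h

theorem Traceable.mono {H : SimpleGraph V} (hGH : G ≤ H) (h : Traceable G) : Traceable H := by
  rw [traceable_iff_exists_list] at h ⊢
  obtain ⟨l, hne, hc, hl⟩ := h
  exact ⟨l, hne, hc.imp fun _ _ => @hGH _ _, hl⟩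

theorem Traceable.map_iso {H : SimpleGraph W} (e : G ≃g H) (h : Traceable G) : Traceable H := by
  obtain ⟨u, v, p, hp, h⟩ := h
  refine ⟨_, _, p.map e.toHom, hp.map e.injective, fun w => ?_⟩
  rw [Walk.support_map, List.mem_map]
  exact ⟨e.symm w, h _, e.apply_symm_apply w⟩

theorem MaxNontraceable.map_iso {H : SimpleGraph W} (e : G ≃g H) (h : MaxNontraceable G) :
    MaxNontraceable H := by
  refine ⟨fun hH => h.1 (hH.map_iso e.symm), fun u v huv hadj => ?_⟩
  refine (h.2 (e.symm u) (e.symm v) (by simpa using huv)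
    (by rwa [e.symm.map_adj_iff])).map_iso (H := H ⊔ edge u v) ⟨e.toEquiv, fun {a b} => ?_⟩
  have (x : V) (y : W) : x = e.symm y ↔ e x = y := e.toEquiv.eq_symm_apply
  simp only [sup_adj, edge_adj, RelIso.coe_fn_toEquiv, e.map_adj_iff, this, ne_eq,
    EmbeddingLike.apply_eq_iff_eq]

theorem isChain_of_isChain_sup_edge {a b : V} {l : List V} (h : l.IsChain (G ⊔ edge a b).Adj)
    (ha : a ∉ l) : l.IsChain G.Adj := by
  refine h.imp_of_mem_imp fun x y hx hy hxy => ?_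
  rw [sup_adj, edge_adj] at hxy
  grind

theorem isChain_reverse_adj {l : List V} : l.reverse.IsChain G.Adj ↔ l.IsChain G.Adj := by
  simp only [List.isChain_reverse, G.adj_comm]

/-- A path in `G + ab` that starts at a vertex with neighbourhood `{a, b}` can be rerouted to
avoid `ab`. -/
theorem exists_isChain_perm_of_start {a b v : V} {t : List V} (hva : G.Adj v a) (hvb : G.Adj v b)
    (hnbr : ∀ w, G.Adj v w → w = a ∨ w = b) (hc : (v :: t).IsChain (G ⊔ edge a b).Adj)
    (hn : (v :: t).Nodup) : ∃ l : List V, l.IsChain G.Adj ∧ l.Perm (v :: t) := by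
  match t with
  | [] => exact ⟨[v], by simp, List.Perm.refl _⟩
  | [x] =>
    refine ⟨[v, x], ?_, List.Perm.refl _⟩
    have := hva.ne; have := hvb.ne
    simp only [List.isChain_cons_cons, sup_adj, edge_adj] at hc ⊢
    grind
  | x :: y :: t =>
    have := hva.ne; have := hvb.ne
    simp only [List.isChain_cons_cons] at hc
    obtain ⟨hvx, hxy, ht⟩ := hc
    rw [sup_adj, edge_adj] at hvx
    replace hvx : G.Adj v x := by grind
    have ht' : (y :: t).IsChain G.Adj := by
      rcases hnbr x hvx with rfl | rfl
      · exact isChain_of_isChain_sup_edge ht (by grind)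
      · rw [edge_comm] at ht
        exact isChain_of_isChain_sup_edge ht (by grind)
    by_cases h : G.Adj x y
    · exact ⟨v :: x :: y :: t, by simp [hvx, h, ht'], List.Perm.refl _⟩
    · refine ⟨x :: v :: y :: t, ?_, List.Perm.swap _ _ _⟩
      rw [sup_adj, edge_adj] at hxy
      have : G.Adj v y := by grind
      simp [hvx.symm, this, ht']

/-- In a maximal nontraceable graph, the neighbours of a vertex of degree two are adjacent. -/
theorem MaxNontraceable.adj_of_degree_two_s10 (hG : MaxNontraceable G) {a b v : V} (hab : a ≠ b)
    (hva : G.Adj v a) (hvb : G.Adj v b) (hnbr : ∀ w, G.Adj v w → w = a ∨ w = b) :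
    G.Adj a b := by
  by_contra hadj
  apply hG.1
  have := hva.ne; have := hvb.ne
  obtain ⟨l, -, hc, hn, hl⟩ := traceable_iff_exists_list.1 (hG.2 a b hab hadj)
  suffices ∃ l' : List V, l'.IsChain G.Adj ∧ l'.Perm l by
    obtain ⟨l', hc', hp⟩ := this
    refine traceable_iff_exists_list.2
      ⟨l', ?_, hc', hp.nodup_iff.2 hn, fun w => hp.mem_iff.2 (hl w)⟩
    rintro rfl
    simpa [hp.symm.eq_nil] using hl v
  obtain ⟨s, t, rfl⟩ := List.append_of_mem (hl v)
  rcases s.eq_nil_or_concat' with rfl | ⟨s, x, rfl⟩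
  · exact exists_isChain_perm_of_start hva hvb hnbr hc hn
  rcases t with _ | ⟨y, t⟩
  · rw [← isChain_reverse_adj] at hc
    rw [← List.nodup_reverse] at hn
    simp only [List.reverse_append, List.reverse_cons, List.reverse_nil, List.nil_append,
      List.cons_append] at hc hn
    obtain ⟨l', hc', hp⟩ := exists_isChain_perm_of_start hva hvb hnbr hc hn
    exact ⟨l', hc', hp.trans (by simpa using List.reverse_perm (s ++ [x] ++ [v]))⟩
  · refine ⟨_, ?_, List.Perm.refl _⟩
    have hc' := hc
    rw [List.append_assoc, List.singleton_append, List.isChain_append_cons_cons,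
      List.isChain_cons_cons] at hc'
    obtain ⟨h1, h2, h3, h4⟩ := hc'
    rw [sup_adj, edge_adj] at h2 h3
    have hx : G.Adj v x := by have := G.adj_comm v x; grind
    have hy : G.Adj v y := by grind
    rw [List.append_assoc, List.singleton_append, List.isChain_append_cons_cons,
      List.isChain_cons_cons]
    have hxy : x ≠ y := by grind
    refine ⟨?_, hx.symm, hy, ?_⟩
    · rcases hnbr y hy with rfl | rfl
      · exact isChain_of_isChain_sup_edge h1 (by grind)
      · rw [edge_comm] at h1
        exact isChain_of_isChain_sup_edge h1 (by grind)
    · rcases hnbr x hx with rfl | rfl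
      · exact isChain_of_isChain_sup_edge h4 (by grind)
      · rw [edge_comm] at h4
        exact isChain_of_isChain_sup_edge h4 (by grind)

/-- In a traceable graph, some Hamiltonian path starts at any given vertex with at most one
neighbour. -/
theorem Traceable.exists_isChain_cons (h : Traceable G) {v : V}
    (hv : ∀ a b, G.Adj v a → G.Adj v b → a = b) :
    ∃ t, (v :: t).IsChain G.Adj ∧ (v :: t).Nodup ∧ ∀ w, w ∈ v :: t := by
  obtain ⟨l, -, hc, hn, hl⟩ := traceable_iff_exists_list.1 h
  obtain ⟨s, t, rfl⟩ := List.append_of_mem (hl v)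
  rcases s.eq_nil_or_concat' with rfl | ⟨s, x, rfl⟩
  · exact ⟨t, hc, hn, hl⟩
  rcases t with _ | ⟨y, t⟩
  · refine ⟨(s ++ [x]).reverse, ?_, ?_, ?_⟩
    · rw [← isChain_reverse_adj] at hc
      simpa using hc
    · rw [← List.nodup_reverse] at hn
      simpa using hn
    · intro w
      have := hl w
      simp only [List.mem_append, List.mem_cons, List.mem_reverse] at this ⊢
      tauto
  · rw [List.append_assoc, List.singleton_append, List.isChain_append_cons_cons,
      List.isChain_cons_cons] at hc
    have := hv x y hc.2.1.symm hc.2.2.1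
    grind

end Paths

namespace TraceSearch

/-- Application that makes the kernel evaluate the argument first. -/
def force (f : ℕ → Bool) : ℕ → Bool
  | 0 => f 0
  | n + 1 => f (Nat.succ n)

/-- The `k`-th binary digit of `g`. -/
def bit (g k : ℕ) : Bool := Nat.beq (Nat.land (Nat.shiftRight g k) 1) 1

/-- Does some vertex satisfy `p`? -/
def anyVertex (p : Fin 8 → Bool) : Bool :=
  p ⟨0, by decide⟩ || (p ⟨1, by decide⟩ || (p ⟨2, by decide⟩ || (p ⟨3, by decide⟩ ||
    (p ⟨4, by decide⟩ || (p ⟨5, by decide⟩ || (p ⟨6, by decide⟩ || p ⟨7, by decide⟩))))))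

/-- Do all vertices satisfy `p`? -/
def allVertices (p : Fin 8 → Bool) : Bool := !anyVertex fun v => !p v

/-- Adjacency in the graph whose adjacency matrix has the binary digits of `g` as entries. -/
def maskAdj (g : ℕ) (i j : Fin 8) : Bool := bit g (Nat.add (Nat.mul 8 i.val) j.val)

/-- Add the edge `ij` to the adjacency matrix `g`. -/
def addEdge (g : ℕ) (i j : Fin 8) : ℕ :=
  Nat.lor (Nat.lor g (Nat.pow 2 (Nat.add (Nat.mul 8 i.val) j.val)))
    (Nat.pow 2 (Nat.add (Nat.mul 8 j.val) i.val))

/-- Can a path ending at `v` be extended to one that visits `k` more vertices, all in `rem`? -/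
def extendable (g : ℕ) : ℕ → ℕ → Fin 8 → Bool
  | 0, _, _ => true
  | k + 1, rem, v => force (fun c => !Nat.beq c 0 && anyVertex fun w =>
      bit c w.val && force (fun r => extendable g k r w) (Nat.xor rem (Nat.pow 2 w.val)))
      (Nat.land (Nat.shiftRight g (Nat.mul 8 v.val)) rem)

/-- Do all neighbours of `v` coincide? -/
def isLeaf (g : ℕ) (v : Fin 8) : Bool :=
  force (fun r => Nat.beq r 0 || Nat.beq r (Nat.pow 2 (Nat.log2 r)))
    (Nat.land (Nat.shiftRight g (Nat.mul 8 v.val)) 255)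

/-- Does some Hamiltonian path start at `v`? -/
def startsPath (g : ℕ) (v : Fin 8) : Bool := extendable g 7 (Nat.xor 255 (Nat.pow 2 v.val)) v

/-- Search for a Hamiltonian path; the first conjunct is there for speed. -/
def hamiltonian (g : ℕ) : Bool :=
  force (fun g => (allVertices fun v => !isLeaf g v || startsPath g v) &&
    anyVertex (startsPath g)) g

/-- Look for a vertex `v` with exactly two neighbours, which are not adjacent, and apply `next` to
all one-edge extensions that repair this. The first test on `v` is there for speed. -/
def refuteDegreeTwo (next : ℕ → Bool) (g : ℕ) : Bool :=
  anyVertex fun v => force (fun r => force (fun x => Nat.ble 1 x &&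
      Nat.beq x (Nat.pow 2 (Nat.log2 x))) (Nat.xor r (Nat.pow 2 (Nat.log2 r))))
      (Nat.land (Nat.shiftRight g (Nat.mul 8 v.val)) 255) &&
    anyVertex fun a => maskAdj g v a && anyVertex fun b =>
    !Nat.ble b.val a.val && (maskAdj g v b && (!maskAdj g a b &&
      ((allVertices fun w => !maskAdj g v w || (Nat.beq w.val a.val || Nat.beq w.val b.val)) &&
        (next (addEdge g a b) && allVertices fun w =>
          Nat.beq w.val v.val || (maskAdj g v w || next (addEdge g v w))))))

/-- Look for a nonedge whose addition does not create a Hamiltonian path, and apply `next` to all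
one-edge extensions. -/
def refuteNonedge (next : ℕ → Bool) (g : ℕ) : Bool :=
  (anyVertex fun u => anyVertex fun v => !Nat.ble u.val v.val &&
    (!maskAdj g u v && !hamiltonian (addEdge g u v))) &&
  allVertices fun u => allVertices fun v => Nat.ble u.val v.val ||
    (maskAdj g u v || next (addEdge g u v))

/-- Certify that no maximal nontraceable graph arises from `g` by adding at most `b` edges. -/
def refute : ℕ → ℕ → Bool
  | 0, g => refuteDegreeTwo (fun _ => true) g || (hamiltonian g || refuteNonedge (fun _ => true) g)
  | b + 1, g => hamiltonian g ||
      (refuteDegreeTwo (force (refute b)) g || refuteNonedge (force (refute b)) g)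

/-- The path `0, 1, …, 7` with the edge between `k` and `k + 1` removed. -/
def brokenPath (k : Fin 7) : ℕ :=
  (List.finRange 7).foldl (fun g i => if i = k then g else addEdge g i.castSucc i.succ) 0

theorem bit_eq_testBit (g k : ℕ) : bit g k = g.testBit k := by
  rw [Nat.testBit_eq_decide_div_mod_eq, ← Nat.shiftRight_eq_div_pow, ← Nat.and_one_is_mod,
    Bool.eq_iff_iff, decide_eq_true_eq, bit, Nat.beq_eq]
  rfl

@[simp]
theorem force_eq (f : ℕ → Bool) (n : ℕ) : force f n = f n := by
  cases n <;> rfl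

@[simp]
theorem anyVertex_eq_true {p : Fin 8 → Bool} : anyVertex p = true ↔ ∃ v, p v = true := by
  simp [anyVertex, Fin.exists_fin_succ]

@[simp]
theorem allVertices_eq_true {p : Fin 8 → Bool} : allVertices p = true ↔ ∀ v, p v = true := by
  rw [allVertices, Bool.not_eq_true', ← Bool.not_eq_true, anyVertex_eq_true]
  simp

/-- The digits of `g` are the entries of the adjacency matrix of `H`. -/
def IsMask (g : ℕ) (H : SimpleGraph (Fin 8)) : Prop := ∀ i j, maskAdj g i j = true ↔ H.Adj i j

theorem maskAdj_eq_testBit (g : ℕ) (i j : Fin 8) : maskAdj g i j = g.testBit (8 * i + j) :=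
  bit_eq_testBit _ _

theorem testBit_row (g : ℕ) (i j : Fin 8) :
    (Nat.shiftRight g (Nat.mul 8 i)).testBit j = maskAdj g i j := by
  rw [maskAdj_eq_testBit]
  exact Nat.testBit_shiftRight g

theorem IsMask.sup_edge {g : ℕ} {H : SimpleGraph (Fin 8)} (hg : IsMask g H) {i j : Fin 8}
    (hij : i ≠ j) : IsMask (addEdge g i j) (H ⊔ edge i j) := by
  intro a b
  have h : addEdge g i j = g ||| 2 ^ (8 * i.val + j.val) ||| 2 ^ (8 * j.val + i.val) := rfl
  rw [sup_adj, edge_adj, ← hg, maskAdj_eq_testBit, maskAdj_eq_testBit, h, Nat.testBit_or,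
    Nat.testBit_or, Nat.testBit_two_pow, Nat.testBit_two_pow]
  simp only [Bool.or_eq_true, decide_eq_true_eq]
  grind

variable {g : ℕ} {H : SimpleGraph (Fin 8)}

theorem extendable_iff (hg : IsMask g H) (k rem : ℕ) (v : Fin 8) :
    extendable g k rem v = true ↔ ∃ l : List (Fin 8), l.length = k ∧ (v :: l).IsChain H.Adj ∧
      l.Nodup ∧ ∀ w ∈ l, rem.testBit w = true := by
  induction k generalizing rem v with
  | zero =>
    simp [extendable]
  | succ k ih =>
    have hxor (a b : ℕ) : Nat.xor a b = a ^^^ b := rfl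
    have hland (a b : ℕ) : Nat.land a b = a &&& b := rfl
    have hpow (b : ℕ) : Nat.pow 2 b = 2 ^ b := rfl
    have key : extendable g (k + 1) rem v = true ↔ ∃ w : Fin 8, H.Adj v w ∧
        rem.testBit w = true ∧ extendable g k (rem ^^^ 2 ^ w.val) w = true := by
      simp only [extendable, force_eq, Bool.and_eq_true, anyVertex_eq_true, bit_eq_testBit, hxor,
        hland, hpow, Nat.testBit_and, testBit_row, hg v, Bool.not_eq_true']
      constructor
      · rintro ⟨-, w, ⟨h1, h2⟩, h3⟩
        exact ⟨w, h1, h2, h3⟩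
      · rintro ⟨w, h1, h2, h3⟩
        refine ⟨?_, w, ⟨h1, h2⟩, h3⟩
        rw [← Bool.not_eq_true, Nat.beq_eq]
        intro h
        have := congrArg (Nat.testBit · w) h
        simp [← maskAdj_eq_testBit, (hg v w).2 h1, h2] at this
    simp only [key, ih, Nat.testBit_xor, Nat.testBit_two_pow]
    constructor
    · rintro ⟨w, h1, h2, l, hl, hc, hn, hr⟩
      refine ⟨w :: l, by simp [hl], List.isChain_cons_cons.2 ⟨h1, hc⟩,
        List.nodup_cons.2 ⟨fun hw => ?_, hn⟩, fun x hx => ?_⟩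
      · simpa [h2] using hr w hw
      · rcases List.mem_cons.1 hx with rfl | hx
        · exact h2
        · have := hr x hx
          have hxw : w ≠ x := by
            rintro rfl
            simp [h2] at this
          simpa [Fin.val_inj, hxw] using this
    · rintro ⟨_ | ⟨w, l⟩, hl, hc, hn, hr⟩
      · simp at hl
      rw [List.isChain_cons_cons] at hc
      rw [List.nodup_cons] at hn
      refine ⟨w, hc.1, hr w (by simp), l, by simpa using hl, hc.2, hn.2, fun x hx => ?_⟩
      have hxw : w ≠ x := by
        rintro rfl
        exact hn.1 hx
      simp [Fin.val_inj, hxw, hr x (by simp [hx])]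

theorem startsPath_iff (hg : IsMask g H) (v : Fin 8) : startsPath g v = true ↔
    ∃ t, (v :: t).IsChain H.Adj ∧ (v :: t).Nodup ∧ ∀ w, w ∈ v :: t := by
  have h255 (w : Fin 8) : (Nat.xor 255 (Nat.pow 2 v)).testBit w = true ↔ w ≠ v := by
    decide +revert
  simp only [startsPath, extendable_iff hg, h255]
  refine exists_congr fun t => ⟨?_, ?_⟩
  · rintro ⟨hl, hc, hn, ht⟩
    have hvt : (v :: t).Nodup := List.nodup_cons.2 ⟨fun h => ht v h rfl, hn⟩
    refine ⟨hc, hvt, fun w => ?_⟩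
    have : (v :: t).toFinset = Finset.univ := by
      rw [← Finset.card_eq_iff_eq_univ, List.toFinset_card_of_nodup hvt]
      simp [hl]
    simpa [this] using List.mem_toFinset (l := v :: t) (a := w)
  · rintro ⟨hc, hn, ht⟩
    refine ⟨?_, hc, (List.nodup_cons.1 hn).2, fun w hw => ?_⟩
    · have : (v :: t).toFinset = Finset.univ := by
        ext w
        simpa using ht w
      rw [← Finset.card_eq_iff_eq_univ, List.toFinset_card_of_nodup hn] at this
      simpa using this
    · rintro rfl
      exact (List.nodup_cons.1 hn).1 hw

theorem eq_of_isLeaf (hg : IsMask g H) {v a b : Fin 8} (hv : isLeaf g v = true)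
    (ha : H.Adj v a) (hb : H.Adj v b) : a = b := by
  rw [isLeaf, force_eq] at hv
  set r := Nat.land (Nat.shiftRight g (Nat.mul 8 v.val)) 255
  have hrw (w : Fin 8) (hw : H.Adj v w) : r.testBit w = true := by
    have h255 : ∀ w : Fin 8, (255 : ℕ).testBit w = true := by decide
    have : r = Nat.shiftRight g (Nat.mul 8 v.val) &&& 255 := rfl
    rw [this, Nat.testBit_and, testBit_row, (hg v w).2 hw, h255 w, Bool.and_self]
  rw [Bool.or_eq_true, Nat.beq_eq, Nat.beq_eq] at hv
  have ha' := hrw a ha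
  have hb' := hrw b hb
  rcases hv with h | h
  · simp [h] at ha'
  · have hpow : Nat.pow 2 (Nat.log2 r) = 2 ^ Nat.log2 r := rfl
    rw [h, hpow, Nat.testBit_two_pow, decide_eq_true_eq] at ha' hb'
    exact Fin.ext (ha'.symm.trans hb')

theorem hamiltonian_iff (hg : IsMask g H) : hamiltonian g = true ↔ Traceable H := by
  simp only [hamiltonian, force_eq, Bool.and_eq_true, allVertices_eq_true, anyVertex_eq_true,
    Bool.or_eq_true, Bool.not_eq_true', ← Bool.not_eq_true, startsPath_iff hg]
  constructor
  · rintro ⟨-, v, t, hc, hn, ht⟩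
    exact traceable_iff_exists_list.2 ⟨v :: t, by simp, hc, hn, ht⟩
  · intro h
    refine ⟨fun v => ?_, ?_⟩
    · by_cases hv : isLeaf g v = true
      · exact .inr (h.exists_isChain_cons fun a b => eq_of_isLeaf hg hv)
      · exact .inl hv
    · obtain ⟨_ | ⟨v, t⟩, hne, hc, hn, ht⟩ := traceable_iff_exists_list.1 h
      · exact absurd rfl hne
      · exact ⟨v, t, hc, hn, ht⟩

variable {G : SimpleGraph (Fin 8)}

theorem not_refuteDegreeTwo (hg : IsMask g H) (hHG : H ≤ G) (hG : MaxNontraceable G)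
    {next : ℕ → Bool}
    (hnext : ∀ i j, i ≠ j → ¬H.Adj i j → G.Adj i j → next (addEdge g i j) ≠ true) :
    refuteDegreeTwo next g ≠ true := by
  simp only [refuteDegreeTwo, force_eq, ne_eq, anyVertex_eq_true, Bool.and_eq_true,
    allVertices_eq_true, Bool.or_eq_true, Bool.not_eq_true', ← Bool.not_eq_true, hg _ _,
    Nat.beq_eq, Nat.ble_eq, Fin.val_inj]
  rintro ⟨v, -, a, hva, b, hlt, hvb, hadj, hnbr, hab, hall⟩
  have hne : a ≠ b := by grind
  by_cases h : ∀ w, G.Adj v w → w = a ∨ w = b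
  · exact hnext a b hne hadj (hG.adj_of_degree_two_s10 hne (hHG hva) (hHG hvb) h) hab
  · push Not at h
    obtain ⟨w, hw, hwa, hwb⟩ := h
    have hHw : ¬H.Adj v w := by grind
    exact hnext v w hw.ne hHw hw (by grind [hw.ne])

theorem not_refuteNonedge (hg : IsMask g H) (hHG : H ≤ G) (hG : MaxNontraceable G)
    {next : ℕ → Bool}
    (hnext : ∀ i j, i ≠ j → ¬H.Adj i j → G.Adj i j → next (addEdge g i j) ≠ true) :
    refuteNonedge next g ≠ true := by
  simp only [refuteNonedge, ne_eq, anyVertex_eq_true, Bool.and_eq_true,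
    allVertices_eq_true, Bool.or_eq_true, Bool.not_eq_true', ← Bool.not_eq_true, hg _ _,
    Nat.ble_eq]
  rintro ⟨⟨u, v, hlt, hadj, hham⟩, hall⟩
  have huv : u ≠ v := by grind
  rw [hamiltonian_iff (hg.sup_edge huv)] at hham
  refine hham ?_
  have : G = H := by
    refine le_antisymm (fun i j hij => ?_) hHG
    by_contra hH
    rcases lt_or_gt_of_ne hij.ne with h | h
    · refine hnext j i hij.ne' (fun h => hH h.symm) hij.symm ?_
      have := hall j i
      rw [H.adj_comm] at this
      grind
    · exact hnext i j hij.ne hH hij (by grind)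
  exact this ▸ hG.2 u v huv (this ▸ hadj)

theorem card_edgeSet_sup_edge {i j : Fin 8} (hij : i ≠ j) (h : ¬H.Adj i j) :
    Nat.card (H ⊔ edge i j).edgeSet = Nat.card H.edgeSet + 1 := by
  classical
  simpa only [Nat.card_eq_fintype_card, edgeFinset_card] using H.card_edgeFinset_sup_edge h hij

theorem not_refute (hg : IsMask g H) (hHG : H ≤ G) (hG : MaxNontraceable G) {b : ℕ}
    (hb : Nat.card G.edgeSet ≤ Nat.card H.edgeSet + b) : refute b g ≠ true := by
  have hsup {i j : Fin 8} (h : G.Adj i j) : H ⊔ edge i j ≤ G :=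
    sup_le hHG ((edge_le_iff G).2 (.inr h))
  have hham : hamiltonian g ≠ true := fun h => hG.1 (((hamiltonian_iff hg).1 h).mono hHG)
  induction b generalizing g H with
  | zero =>
    have hnext (i j : Fin 8) (hij : i ≠ j) (hH : ¬H.Adj i j) (h : G.Adj i j) : true ≠ true := by
      have h1 := card_edgeSet_sup_edge hij hH
      have h2 := Nat.card_mono (Set.toFinite _) (edgeSet_mono (hsup h))
      omega
    simp [refute, hham, not_refuteDegreeTwo hg hHG hG (next := fun _ => true) hnext,
      not_refuteNonedge hg hHG hG (next := fun _ => true) hnext]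
  | succ b ih =>
    have hnext (i j : Fin 8) (hij : i ≠ j) (hH : ¬H.Adj i j) (h : G.Adj i j) :
        force (refute b) (addEdge g i j) ≠ true := by
      rw [force_eq]
      have h1 := card_edgeSet_sup_edge hij hH
      have hm := hg.sup_edge hij
      exact ih hm (hsup h) (by omega) (fun h' => sup_le (hsup h) ((edge_le_iff G).2 (.inr h')))
        fun h' => hG.1 (((hamiltonian_iff hm).1 h').mono (hsup h))
    simp [refute, hham, not_refuteDegreeTwo hg hHG hG hnext, not_refuteNonedge hg hHG hG hnext]

theorem refute_brokenPath (k : Fin 7) : refute 3 (brokenPath k) = true := by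
  have h : ∀ k, force (refute 3) (brokenPath k) = true := by decide +kernel
  rw [← force_eq (refute 3)]
  exact h k

/-- The graph whose adjacency matrix has the binary digits of `g` as entries. -/
def maskGraph (g : ℕ) : SimpleGraph (Fin 8) := fromRel fun i j => maskAdj g i j = true

instance (g : ℕ) : DecidableRel (maskGraph g).Adj :=
  inferInstanceAs (DecidableRel (fromRel fun i j => maskAdj g i j = true).Adj)

theorem isMask_brokenPath (k : Fin 7) : IsMask (brokenPath k) (maskGraph (brokenPath k)) := by
  unfold IsMask
  decide +kernel +revert

theorem exists_of_maskGraph_brokenPath_adj {k : Fin 7} {i j : Fin 8}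
    (h : (maskGraph (brokenPath k)).Adj i j) :
    ∃ m ≠ k, (i = m.castSucc ∧ j = m.succ) ∨ (i = m.succ ∧ j = m.castSucc) := by
  decide +kernel +revert

theorem card_edgeSet_maskGraph_brokenPath (k : Fin 7) :
    Nat.card (maskGraph (brokenPath k)).edgeSet = 6 := by
  rw [Nat.card_eq_fintype_card]
  decide +kernel +revert

theorem ten_le_card_edgeSet_of_adj {G : SimpleGraph (Fin 8)} (hG : MaxNontraceable G) (k : Fin 7)
    (h : ∀ i ≠ k, G.Adj i.castSucc i.succ) : 10 ≤ Nat.card G.edgeSet := by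
  by_contra hlt
  refine not_refute (isMask_brokenPath k) (fun i j hij => ?_) hG (b := 3) ?_
    (refute_brokenPath k)
  · obtain ⟨m, hm, ⟨rfl, rfl⟩ | ⟨rfl, rfl⟩⟩ := exists_of_maskGraph_brokenPath_adj hij
    · exact h m hm
    · exact (h m hm).symm
  · rw [card_edgeSet_maskGraph_brokenPath]
    omega

theorem ten_le_card_edgeSet {G : SimpleGraph (Fin 8)} (hG : MaxNontraceable G) :
    10 ≤ Nat.card G.edgeSet := by
  obtain ⟨u, v, huv, hadj⟩ : ∃ u v, u ≠ v ∧ ¬G.Adj u v := by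
    by_contra! h
    exact hG.1 (traceable_iff_exists_list.2 ⟨List.finRange 8, by decide,
      List.IsChain.imp (R := (· ≠ ·)) h (by decide), by decide, by decide⟩)
  obtain ⟨l, -, hc, hn, hl⟩ := traceable_iff_exists_list.1 (hG.2 u v huv hadj)
  have hlen : l.length = 8 := by
    have : l.toFinset = Finset.univ := by
      ext w
      simpa using hl w
    rw [← Finset.card_eq_iff_eq_univ, List.toFinset_card_of_nodup hn] at this
    simpa using this
  let f : Fin 8 → Fin 8 := fun i => l[i]
  have hf : f.Injective := fun i j hij => Fin.ext (hn.getElem_inj_iff.1 hij)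
  let e : Fin 8 ≃ Fin 8 := Equiv.ofBijective f (Finite.injective_iff_bijective.1 hf)
  have hstep (i : Fin 7) : (G ⊔ edge u v).Adj (e i.castSucc) (e i.succ) :=
    List.isChain_iff_getElem.1 hc i.val (by omega)
  have hinj (i j : Fin 7) (hi : ¬G.Adj (e i.castSucc) (e i.succ))
      (hj : ¬G.Adj (e j.castSucc) (e j.succ)) : i = j := by
    have h1 := hstep i
    have h2 := hstep j
    simp only [sup_adj, edge_adj, hi, hj, false_or] at h1 h2
    have hij : (e i.castSucc = e j.castSucc ∧ e i.succ = e j.succ) ∨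
      (e i.castSucc = e j.succ ∧ e i.succ = e j.castSucc) := by grind
    simp only [e.apply_eq_iff_eq, Fin.ext_iff, Fin.val_castSucc, Fin.val_succ] at hij ⊢
    omega
  obtain ⟨k, hk⟩ : ∃ k : Fin 7, ∀ i ≠ k, G.Adj (e i.castSucc) (e i.succ) := by
    by_cases h : ∃ k : Fin 7, ¬G.Adj (e k.castSucc) (e k.succ)
    · obtain ⟨k, hk⟩ := h
      exact ⟨k, fun i hi => by_contra fun h => hi (hinj i k h hk)⟩
    · push Not at h
      exact ⟨0, fun i _ => h i⟩
  have φ : G.comap e ≃g G := Iso.comap e G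
  rw [← Nat.card_congr φ.mapEdgeSet]
  exact ten_le_card_edgeSet_of_adj (hG.map_iso φ.symm) k hk

/-- The adjacency matrix of a triangle with a pendant edge at one vertex and a triangle attached at
each of the other two. -/
def tenEdgeMask : ℕ :=
  [(0, 1), (0, 2), (1, 2), (0, 3), (1, 4), (1, 5), (4, 5), (2, 6), (2, 7), (6, 7)].foldl
    (fun g p => addEdge g p.1 p.2) 0

theorem isMask_tenEdgeMask : IsMask tenEdgeMask (maskGraph tenEdgeMask) := by
  unfold IsMask
  decide +kernel

theorem maxNontraceable_tenEdgeMask : MaxNontraceable (maskGraph tenEdgeMask) := by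
  have h : ∀ u v, u ≠ v → maskAdj tenEdgeMask u v ≠ true →
      hamiltonian (addEdge tenEdgeMask u v) = true := by decide +kernel
  have hg := isMask_tenEdgeMask
  refine ⟨fun ht => ?_, fun u v huv hadj => ?_⟩
  · exact absurd ((hamiltonian_iff hg).2 ht) (by decide +kernel)
  · exact (hamiltonian_iff (hg.sup_edge huv)).1 (h u v huv (by rwa [ne_eq, hg u v]))

theorem card_edgeSet_tenEdgeMask : Nat.card (maskGraph tenEdgeMask).edgeSet = 10 := by
  rw [Nat.card_eq_fintype_card]
  decide +kernel

end TraceSearch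

/-- Every MNT graph of order 8 has at least 10 edges, and some MNT graph of
order 8 has exactly 10 edges. -/
theorem stmt_10 :
    (∀ G : SimpleGraph (Fin 8), MaxNontraceable G → 10 ≤ Nat.card G.edgeSet) ∧
    (∃ G : SimpleGraph (Fin 8), MaxNontraceable G ∧ Nat.card G.edgeSet = 10) := by
  exact ⟨fun _ => TraceSearch.ten_le_card_edgeSet, _, TraceSearch.maxNontraceable_tenEdgeMask,
    TraceSearch.card_edgeSet_tenEdgeMask⟩
end
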